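/- Let k be a finitely generated field of characteristic 0 and K = k^alg. Consider the category 𝒱_k whose objects are pairs (X, S) with X a normal geometrically irreducible algebraic variety over k and S a set of prime divisors on X_K = X ×_k K, and whose morphisms (X, S) → (Y, T) are dominant rational maps φ : X → Y over k with geometrically irreducible generic fibre such that the symmetric difference between S and {φ_K*t : t ∈ T} is finite. Then for every object (X, S) of 𝒱_k there is a morphism π : (X, S) → (X′, S′) that is terminal with respect to all morphisms originating from (X, S): for every morphism φ : (X, S) → (Y, T) there is a unique morphism ψ : (Y, T) → (X′, S′) with ψ∘φ = π. -/

import Mathlib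

open scoped TensorProduct

set_option synthInstance.maxHeartbeats 1000000
set_option maxHeartbeats 1000000

/-!
# Theorem 7.2: terminal morphisms in the category 𝒱_k

`k` is a finitely generated field of characteristic 0 and `K = k^alg` its algebraic
closure (`AlgebraicClosure k`).  An object `(X, S)` of `𝒱_k` is modelled by the coordinate
ring of a (normal, affine model of the) geometrically irreducible normal `k`-variety `X`:
a finitely generated integrally closed `k`-algebra domain — geometric irreducibility (with
reducedness, automatic in characteristic 0) being encoded by `K ⊗_k X` a domain — together
with a set `S` of prime divisors on `X_K`, i.e. height-one primes of `K ⊗_k X`.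

A morphism `(X, S) → (Y, T)` of `𝒱_k` is a dominant rational map `φ : X → Y` over `k` with
geometrically irreducible generic fibre such that `S` and `{φ_K^* t : t ∈ T}` differ by
finitely many prime divisors.  It is modelled (`IsVMor`) by a basic open `D(r) ⊆ X` on
which `φ` is regular and the corresponding injective pullback `f : Y → X_r` on coordinate
rings, with:  geometric irreducibility of the generic fibre encoded by `K(Y_K)` being
relatively algebraically closed in `K(X_K)` via the base change `f_K`
(`FracRelAlgClosedVia`), and the divisor condition by the finiteness of the symmetric
difference between `S` (transported to the open subset `D(r)_K` of `X_K`) and the set of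
proper transforms `φ_K^* t = PTset f_K t` for `t ∈ T`.

The theorem: every object `(X, S)` admits a terminal morphism `π : (X, S) → (X', S')`.
Here `X'` is produced as a finitely generated subalgebra of the function field
`Frac(X)` — so that the rational map `π` is dual to the inclusion `X' ⊆ Frac(X)`, as is
enforced by the compatibility of `π` with the canonical embeddings — and for every
morphism `φ : (X, S) → (Y, T)` there is a morphism `ψ : (Y, T) → (X', S')` with
`ψ ∘ φ = π` as rational maps (checked in the function fields), unique as a rational map.
-/

/-- A prime ideal `P` of a commutative ring has height one. -/
def HeightOnePrime {R : Type*} [CommRing R] (P : Ideal R) : Prop :=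
  P.IsPrime ∧ P ≠ ⊥ ∧ ∀ Q : Ideal R, Q.IsPrime → Q < P → Q = ⊥

/-- `Frac(A)` is relatively algebraically closed in `Frac(B)` via `f : A → B`. -/
def FracRelAlgClosedVia {A B : Type*} [CommRing A] [CommRing B] (f : A →+* B) : Prop :=
  ∀ a b : B, b ≠ 0 →
    (∃ p : Polynomial A, p ≠ 0 ∧
        ∑ i ∈ Finset.range (p.natDegree + 1),
          f (p.coeff i) * a ^ i * b ^ (p.natDegree - i) = 0) →
    ∃ c d : A, d ≠ 0 ∧ a * f d = b * f c

/-- The set of irreducible components of the proper transform of the prime divisor `V(t)`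
along the dominant map induced by `f`; for all but finitely many prime divisors `t` this
is a single prime divisor, the proper transform `f^* t`. -/
def PTset {A B : Type*} [CommRing A] [CommRing B] (f : A →+* B) (t : Ideal A) :
    Set (Ideal B) :=
  {Q | Q ∈ (t.map f).minimalPrimes ∧ Q.comap f = t}

/-- Base change of a `k`-algebra homomorphism to the algebraic closure of `k`. -/
noncomputable def baseChange (k : Type*) [Field k] {A B : Type*} [CommRing A] [CommRing B]
    [Algebra k A] [Algebra k B] (f : A →ₐ[k] B) :
    AlgebraicClosure k ⊗[k] A →+* AlgebraicClosure k ⊗[k] B :=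
  (Algebra.TensorProduct.map (AlgHom.id k (AlgebraicClosure k)) f).toRingHom

/-- `f : Y →ₐ[k] X_r` (the pullback of a rational map `X ⇢ Y` regular on `D(r) ⊆ X`)
is a morphism `(X, S) → (Y, T)` of the category `𝒱_k`: it is dominant, has geometrically
irreducible generic fibre, and up to finitely many exceptions `S` consists exactly of the
proper transforms of the prime divisors in `T`. -/
def IsVMor (k : Type*) [Field k] {X Y : Type*} [CommRing X] [CommRing Y]
    [Algebra k X] [Algebra k Y]
    (S : Set (Ideal (AlgebraicClosure k ⊗[k] X)))
    (T : Set (Ideal (AlgebraicClosure k ⊗[k] Y)))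
    (r : X) (f : Y →ₐ[k] Localization.Away r) : Prop :=
  Function.Injective f ∧
  FracRelAlgClosedVia (baseChange k f) ∧
  (symmDiff
      {Q : Ideal (AlgebraicClosure k ⊗[k] Localization.Away r) |
        HeightOnePrime Q ∧
        Q.comap (baseChange k (IsScalarTower.toAlgHom k X (Localization.Away r))) ∈ S}
      (⋃ t ∈ T, PTset (baseChange k f) t)).Finite

/-- `η` is a derivation along the ring homomorphism `j`. -/
structure IsDer {R M : Type*} [CommRing R] [CommRing M] (j : R →+* M) (η : R → M) : Prop where
  add : ∀ x y, η (x + y) = η x + η y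
  mul : ∀ x y, η (x * y) = j x * η y + j y * η x

namespace IsDer

section Ring

variable {R M : Type*} [CommRing R] [CommRing M] {j : R →+* M} {η : R → M}

theorem zero (h : IsDer j η) : η 0 = 0 := by
  have := h.add 0 0
  simpa using this

theorem one (h : IsDer j η) : η 1 = 0 := by
  have := h.mul 1 1
  simpa using this

/-- The underlying additive homomorphism. -/
def toAddHom (h : IsDer j η) : R →+ M where
  toFun := η
  map_zero' := h.zero
  map_add' := h.add

theorem neg (h : IsDer j η) (x : R) : η (-x) = -η x := h.toAddHom.map_neg x

theorem sum (h : IsDer j η) {ι : Type*} (s : Finset ι) (f : ι → R) :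
    η (∑ i ∈ s, f i) = ∑ i ∈ s, η (f i) := map_sum h.toAddHom f s

theorem pow (h : IsDer j η) (x : R) (n : ℕ) : η (x ^ n) = n * j x ^ (n - 1) * η x := by
  induction n with
  | zero => simp [h.one]
  | succ n ih =>
    rw [pow_succ, h.mul, ih]
    rcases n with _ | n
    · simp
    · simp only [Nat.add_sub_cancel, map_pow]
      push_cast
      ring

theorem zero_map (j : R →+* M) : IsDer j (fun _ => (0 : M)) := ⟨by simp, by simp⟩

theorem add_map {η' : R → M} (h : IsDer j η) (h' : IsDer j η') :
    IsDer j (fun x => η x + η' x) :=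
  ⟨fun x y => by rw [h.add, h'.add]; ring, fun x y => by rw [h.mul, h'.mul]; ring⟩

theorem sub_map {η' : R → M} (h : IsDer j η) (h' : IsDer j η') :
    IsDer j (fun x => η x - η' x) :=
  ⟨fun x y => by rw [h.add, h'.add]; ring, fun x y => by rw [h.mul, h'.mul]; ring⟩

theorem smul_map (h : IsDer j η) (m : M) : IsDer j (fun x => m * η x) :=
  ⟨fun x y => by rw [h.add]; ring, fun x y => by rw [h.mul]; ring⟩

theorem sum_map {ι : Type*} (s : Finset ι) (f : ι → R → M) (h : ∀ i ∈ s, IsDer j (f i)) :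
    IsDer j (fun x => ∑ i ∈ s, f i x) := by
  classical
  induction s using Finset.induction_on with
  | empty => simpa using zero_map j
  | insert a s ha ih =>
    simp only [Finset.sum_insert ha]
    exact (h a (by simp)).add_map (ih fun i hi => h i (by simp [hi]))

theorem comp_left {N : Type*} [CommRing N] (h : IsDer j η) (g : M →+* N) :
    IsDer (g.comp j) (fun x => g (η x)) :=
  ⟨fun x y => by rw [h.add, map_add], fun x y => by rw [h.mul]; simp⟩

theorem comp_right {N : Type*} [CommRing N] (h : IsDer j η) (g : N →+* R) :
    IsDer (j.comp g) (fun x => η (g x)) :=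
  ⟨fun x y => by rw [map_add, h.add], fun x y => by rw [map_mul, h.mul]; simp⟩

theorem bracket {θ : R → R} {lam : R → R} (h : IsDer (RingHom.id R) θ)
    (h' : IsDer (RingHom.id R) lam) : IsDer (RingHom.id R) (fun x => θ (lam x) - lam (θ x)) :=
  ⟨fun x y => by rw [h.add, h'.add, h.add, h'.add]; ring,
   fun x y => by
    simp only [h.mul, h'.mul, h.add, h'.add, RingHom.id_apply]; ring⟩

/-- The constants of a derivation. -/
def constants (h : IsDer j η) : Subring R where
  carrier := {x | η x = 0}
  mul_mem' {a b} ha hb := by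
    simp only [Set.mem_ofPred_eq] at *; rw [h.mul, ha, hb]; simp
  one_mem' := h.one
  add_mem' {a b} ha hb := by simp only [Set.mem_ofPred_eq] at *; rw [h.add, ha, hb]; simp
  zero_mem' := h.zero
  neg_mem' {a} ha := by simp only [Set.mem_ofPred_eq] at *; rw [h.neg, ha]; simp

theorem eval (h : IsDer j η) {A : Type*} [CommRing A] (g : A →+* R)
    (hg : ∀ a, η (g a) = 0) (p : Polynomial A) (x : R) :
    η (p.eval₂ g x) = j (p.derivative.eval₂ g x) * η x := by
  induction p using Polynomial.induction_on' with
  | add p q hp hq =>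
    simp only [Polynomial.eval₂_add, h.add, hp, hq, map_add]
    ring
  | monomial n a =>
    simp only [Polynomial.eval₂_monomial, h.mul, hg, h.pow, Polynomial.derivative_monomial,
      map_mul, map_pow, map_natCast]
    ring

end Ring

section Field

variable {F M : Type*} [Field F] [Field M] {j : F →+* M} {η : F → M}

theorem inv (h : IsDer j η) (x : F) : η x⁻¹ = - (η x) / j x ^ 2 := by
  by_cases hx : x = 0
  · simp [hx, h.zero]
  · have := h.mul x x⁻¹
    rw [mul_inv_cancel₀ hx, h.one] at this
    have hj : j x ≠ 0 := by simpa using hx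
    rw [map_inv₀] at this
    field_simp at this ⊢
    linear_combination -this

/-- The constants of a derivation on a field. -/
def fieldConstants (h : IsDer j η) : Subfield F where
  __ := h.constants
  inv_mem' x hx := by
    change η x⁻¹ = 0
    rw [h.inv, show η x = 0 from hx]; simp

theorem eq_zero_of_isAlgebraic [CharZero F] (h : IsDer j η) (E : Subfield F)
    (hE : ∀ e ∈ E, η e = 0) {x : F} (hx : IsAlgebraic E x) : η x = 0 := by
  have hi : IsIntegral E x := hx.isIntegral
  have hsep : (minpoly E x).Separable := (minpoly.irreducible hi).separable
  have h1 := h.eval (algebraMap E F) (fun a => hE _ a.2) (minpoly E x) x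
  rw [← Polynomial.aeval_def, minpoly.aeval, h.zero] at h1
  have h2 := hsep.aeval_derivative_ne_zero (minpoly.aeval E x)
  rw [Polynomial.aeval_def] at h2
  rcases mul_eq_zero.mp h1.symm with h3 | h3
  · exact absurd ((map_eq_zero j).mp h3) h2
  · exact h3

theorem eq_zero_of_isAlgebraic_adjoin [CharZero F] (h : IsDer j η) (E : Subfield F)
    (hE : ∀ e ∈ E, η e = 0) {x : F} (hx : η x = 0)
    {y : F} (hy : IsAlgebraic (Subfield.closure ((E : Set F) ∪ {x})) y) : η y = 0 := by
  refine h.eq_zero_of_isAlgebraic _ (fun e he => ?_) hy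
  have : Subfield.closure ((E : Set F) ∪ {x}) ≤ h.fieldConstants := by
    rw [Subfield.closure_le]
    rintro z (hz | hz)
    · exact hE z hz
    · rw [Set.mem_singleton_iff.mp hz]; exact hx
  exact this he

end Field

end IsDer

open scoped DualNumber in
/-- The ring homomorphism to dual numbers attached to a derivation. -/
def IsDer.toDual {R M : Type*} [CommRing R] [CommRing M] {j : R →+* M} {η : R → M}
    (h : IsDer j η) : R →+* DualNumber M where
  toFun x := TrivSqZeroExt.inl (j x) + TrivSqZeroExt.inr (η x)
  map_one' := by ext <;> simp [h.one]
  map_mul' x y := by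
    ext
    · simp
    · simp [h.mul, mul_comm]
  map_zero' := by ext <;> simp [h.zero]
  map_add' x y := by
    ext
    · simp
    · simp [h.add]

open scoped DualNumber in
theorem IsDer.fst_toDual {R M : Type*} [CommRing R] [CommRing M] {j : R →+* M} {η : R → M}
    (h : IsDer j η) (x : R) : (h.toDual x).fst = j x := by simp [toDual]

open scoped DualNumber in
theorem IsDer.snd_toDual {R M : Type*} [CommRing R] [CommRing M] {j : R →+* M} {η : R → M}
    (h : IsDer j η) (x : R) : (h.toDual x).snd = η x := by simp [toDual]

theorem IsDer.of_toDual {R M : Type*} [CommRing R] [CommRing M] {j : R →+* M}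
    (g : R →+* DualNumber M) (hg : ∀ x, (g x).fst = j x) : IsDer j (fun x => (g x).snd) :=
  ⟨fun x y => by simp, fun x y => by
    simp [TrivSqZeroExt.snd_mul, hg]; try ring⟩

theorem IsDer.extend_field {K Ω M : Type} [Field K] [Field Ω] [Field M] [CharZero K]
    (i : K →+* Ω) (h : Ω →+* M) {η : K → M} (hη : IsDer (h.comp i) η) :
    ∃ δ : Ω → M, IsDer h δ ∧ ∀ x, δ (i x) = η x := by
  let _ : Algebra K Ω := i.toAlgebra
  let _ : Algebra K (DualNumber M) := hη.toDual.toAlgebra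
  let _ : Algebra K M := (h.comp i).toAlgebra
  obtain ⟨s, hs⟩ := exists_isTranscendenceBasis K Ω
  have : CharZero (IntermediateField.adjoin K (Set.range ((↑) : s → Ω))) :=
    charZero_of_injective_algebraMap (algebraMap K _).injective
  have : Algebra.IsAlgebraic (IntermediateField.adjoin K (Set.range ((↑) : s → Ω))) Ω :=
    hs.isAlgebraic_field
  have : Algebra.FormallySmooth K Ω :=
    Algebra.FormallySmooth.of_algebraicIndependent_of_isSeparable hs.1
  let f : Ω →ₐ[K] M := { h with commutes' := fun x => rfl }
  let g : DualNumber M →ₐ[K] M :=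
    { (TrivSqZeroExt.fstHom M M M).toRingHom with commutes' := fun x => hη.fst_toDual x }
  have hg : Function.Surjective g := fun m => ⟨TrivSqZeroExt.inl m, rfl⟩
  have hn : IsNilpotent (RingHom.ker (g : DualNumber M →+* M)) := by
    refine ⟨2, ?_⟩
    refine (pow_two (RingHom.ker (g : DualNumber M →+* M))).trans ?_
    rw [Ideal.zero_eq_bot, eq_bot_iff, Ideal.mul_le]
    intro a ha b hb
    rw [RingHom.mem_ker] at ha hb
    have ha' : a.fst = 0 := ha
    have hb' : b.fst = 0 := hb
    rw [Ideal.mem_bot]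
    ext
    · simp [ha']
    · simp [TrivSqZeroExt.snd_mul, ha', hb']
  let L := Algebra.FormallySmooth.liftOfSurjective f g hg hn
  have hL : ∀ x, g (L x) = f x := fun x =>
    Algebra.FormallySmooth.liftOfSurjective_apply f g hg hn x
  refine ⟨fun x => (L x).snd, IsDer.of_toDual (L : Ω →+* DualNumber M) hL, fun x => ?_⟩
  have : L (i x) = hη.toDual x := L.commutes x
  simp only [this, hη.snd_toDual]

theorem IsDer.extend {R Ω M : Type} [CommRing R] [Field Ω] [Field M] [CharZero Ω]
    (i : R →+* Ω) (hi : Function.Injective i) (h : Ω →+* M) {η : R → M}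
    (hη : IsDer (h.comp i) η) :
    ∃ δ : Ω → M, IsDer h δ ∧ ∀ x, δ (i x) = η x := by
  have : IsDomain R := hi.isDomain i
  have hu : ∀ y : nonZeroDivisors R, IsUnit (hη.toDual y) := fun y => by
    rw [TrivSqZeroExt.isUnit_iff_isUnit_fst, isUnit_iff_ne_zero]
    rw [hη.fst_toDual]
    change h (i y) ≠ 0
    have := nonZeroDivisors.ne_zero y.2
    rw [Ne, map_eq_zero, ← map_zero i, hi.eq_iff]
    exact this
  let G : FractionRing R →+* DualNumber M := IsLocalization.lift hu
  let I : FractionRing R →+* Ω := IsFractionRing.lift hi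
  have hIa : ∀ x, I (algebraMap R _ x) = i x := fun x => IsFractionRing.lift_algebraMap hi x
  have hGa : ∀ x, G (algebraMap R _ x) = hη.toDual x := fun x => IsLocalization.lift_eq hu x
  have hG : ∀ x, (G x).fst = (h.comp I) x := by
    have : ((TrivSqZeroExt.fstHom M M M).toRingHom.comp G) = h.comp I := by
      apply IsLocalization.ringHom_ext (nonZeroDivisors R)
      ext x
      simp only [RingHom.comp_apply, hIa, hGa]
      exact hη.fst_toDual x
    intro x
    exact congrArg (fun f => f x) this
  have : CharZero (FractionRing R) := (RingHom.charZero_iff I.injective).mpr inferInstance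
  obtain ⟨δ, h1, h2⟩ := IsDer.extend_field I h (IsDer.of_toDual G hG)
  refine ⟨δ, h1, fun x => ?_⟩
  rw [← hIa, h2, hGa, hη.snd_toDual]

theorem exists_dual_points {Ω I ι : Type*} [Field Ω] [Fintype ι] [DecidableEq ι] {f : ι → I → Ω}
    (hf : LinearIndependent Ω f) :
    ∃ (y : ι → I) (g : ι → I → Ω), (∀ a, g a ∈ Submodule.span Ω (Set.range f)) ∧
      (∀ a b, g a (y b) = if a = b then 1 else 0) ∧
      ∀ h ∈ Submodule.span Ω (Set.range f), ∀ x, h x = ∑ a, h (y a) * g a x := by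
  classical
  let ev : I → ι → Ω := fun x a => f a x
  have hspan : ⊤ ≤ Submodule.span Ω (Set.range ev) := by
    by_contra hlt
    obtain ⟨φ, hφ, hle⟩ := Submodule.exists_le_ker_of_lt_top _ (lt_top_iff_ne_top.mpr
      (fun h => hlt h.ge))
    apply hφ
    have hc : ∀ v, φ v = ∑ a, v a * φ (Pi.single a 1) := fun v => by
      conv_lhs => rw [← Finset.univ_sum_single v, map_sum]
      refine Finset.sum_congr rfl fun a _ => ?_
      rw [← smul_eq_mul, ← map_smul]
      congr 1
      ext b
      by_cases hb : b = a
      · subst hb; simp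
      · simp [hb]
    have h0 : ∑ a, φ (Pi.single a 1) • f a = 0 := by
      ext x
      have hx : φ (ev x) = 0 := hle (Submodule.subset_span ⟨x, rfl⟩)
      rw [hc] at hx
      simpa [mul_comm, ev] using hx
    have h1 := Fintype.linearIndependent_iff.mp hf _ h0
    ext a
    simp [h1]
  let B := Module.Basis.ofSpan hspan
  let e := B.indexEquiv (Pi.basisFun Ω ι)
  let B' := B.reindex e
  have hB : ∀ b, ∃ x, ev x = B' b := fun b => by
    obtain ⟨x, hx⟩ := Module.Basis.ofSpan_subset hspan ⟨e.symm b, rfl⟩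
    exact ⟨x, by rw [Module.Basis.reindex_apply]; exact hx⟩
  choose y hy using hB
  refine ⟨y, fun a x => B'.coord a (ev x), fun a => ?_, fun a b => ?_, fun h hh => ?_⟩
  · have : (fun x => B'.coord a (ev x)) = ∑ c, B'.coord a (Pi.single c 1) • f c := by
      ext x
      conv_lhs => rw [← Finset.univ_sum_single (ev x), map_sum]
      simp only [Finset.sum_apply, Pi.smul_apply]
      refine Finset.sum_congr rfl fun c _ => ?_
      rw [smul_eq_mul, mul_comm, ← smul_eq_mul (f c x), ← map_smul]
      congr 1
      ext b
      by_cases hb : b = c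
      · subst hb; simp [ev]
      · simp [hb]
    change (fun x => B'.coord a (ev x)) ∈ _
    rw [this]
    exact Submodule.sum_mem _ fun c _ => Submodule.smul_mem _ _ (Submodule.subset_span ⟨c, rfl⟩)
  · change B'.coord a (ev (y b)) = _
    rw [hy]
    simp [Finsupp.single_apply, eq_comm]
  · induction hh using Submodule.span_induction with
    | mem h hh =>
      obtain ⟨c, rfl⟩ := hh
      intro x
      have h1 := congrFun (B'.sum_repr (ev x)) c
      simp only [Finset.sum_apply, Pi.smul_apply, smul_eq_mul] at h1
      change ev x c = _
      rw [← h1]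
      refine Finset.sum_congr rfl fun a _ => ?_
      rw [mul_comm, ← hy]
      rfl
    | zero => simp
    | add u v _ _ hu hv =>
      intro x
      simp only [Pi.add_apply, add_mul, Finset.sum_add_distrib, ← hu x, ← hv x]
    | smul c u _ hu =>
      intro x
      simp only [Pi.smul_apply, smul_eq_mul, mul_assoc, ← Finset.mul_sum, ← hu x]

/-- `θ x = 1` and the whole field is algebraic over the field generated by `x` and the
constants of `θ`. -/
def IsAlgDer {F : Type*} [Field F] (θ : F → F) (x : F) : Prop :=
  θ x = 1 ∧ ∀ C : Subfield F, (∀ c, c ∈ C ↔ θ c = 0) →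
    ∀ y : F, IsAlgebraic (Subfield.closure ((C : Set F) ∪ {x})) y

theorem IsAlgDer.eq_mul {F M : Type*} [Field F] [CharZero F] [Field M] {θ : F → F} {x : F}
    (hθ : IsDer (RingHom.id F) θ) (ha : IsAlgDer θ x) {j : F →+* M} {η : F → M}
    (hη : IsDer j η) (h0 : ∀ c, θ c = 0 → η c = 0) (y : F) : η y = η x * j (θ y) := by
  have h1 : IsDer j (fun y => η y - η x * j (θ y)) :=
    hη.sub_map ((hθ.comp_left j).smul_map (η x))
  have h2 := h1.eq_zero_of_isAlgebraic_adjoin hθ.fieldConstants (x := x)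
    (fun e he => by
      have he' : θ e = 0 := he
      simp [h0 e he', he']) (by simp only [ha.1, map_one, mul_one, sub_self])
    (ha.2 hθ.fieldConstants (fun c => Iff.rfl) y)
  exact sub_eq_zero.mp h2

/-- A Lie algebra `L` of derivations of `F`, finite-dimensional over `F`, with a set of algebraic
elements whose common constants form the field `E`. -/
structure AlgFoliation {F : Type} [Field F] (k₀ : Subfield F) (L : Submodule F (F → F))
    (𝒯 : Set (F → F)) (E : Subfield F) : Prop where
  der : ∀ lam ∈ L, IsDer (RingHom.id F) lam
  const : ∀ lam ∈ L, ∀ c ∈ k₀, lam c = 0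
  bracket : ∀ lam ∈ L, ∀ mu ∈ L, (fun x => lam (mu x) - mu (lam x)) ∈ L
  sub : 𝒯 ⊆ L
  alg : ∀ θ ∈ 𝒯, ∃ x, IsAlgDer θ x
  mem_E : ∀ x, x ∈ E ↔ ∀ θ ∈ 𝒯, θ x = 0
  fin : ∃ (n : ℕ) (z : Fin n → F), ∀ (M : Type) [Field M] (j : F →+* M) (η : F → M),
    IsDer j η → (∀ e ∈ k₀, η e = 0) → (∀ i, η (z i) = 0) → ∀ x, η x = 0

namespace AlgFoliation

variable {F : Type} [Field F] [CharZero F] {k₀ : Subfield F} {L : Submodule F (F → F)}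
  {𝒯 : Set (F → F)} {E : Subfield F}

omit [CharZero F] in
theorem finiteDimensional (H : AlgFoliation k₀ L 𝒯 E) : FiniteDimensional F L := by
  obtain ⟨n, z, hz⟩ := H.fin
  let f : L →ₗ[F] (Fin n → F) :=
    { toFun := fun l i => l.1 (z i), map_add' := fun _ _ => rfl, map_smul' := fun _ _ => rfl }
  refine FiniteDimensional.of_injective f ?_
  rw [← LinearMap.ker_eq_bot, LinearMap.ker_eq_bot']
  intro l hl
  ext x
  exact hz F (RingHom.id F) l.1 (H.der l.1 l.2) (H.const l.1 l.2) (fun i => congrFun hl i) x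

/-- The elements of `L` normalising the constants of `θ` span `L`. -/
theorem span_normalizer (H : AlgFoliation k₀ L 𝒯 E) {θ : F → F} (hθ : θ ∈ 𝒯) :
    L ≤ Submodule.span F {lam | lam ∈ L ∧ ∀ e, θ e = 0 → θ (lam e) = 0} := by
  classical
  have := H.finiteDimensional
  have hd := H.der θ (H.sub hθ)
  obtain ⟨x, hx⟩ := H.alg θ hθ
  let C := hd.fieldConstants
  let res : (F → F) →ₗ[F] (C → F) :=
    { toFun := fun l i => l i, map_add' := fun _ _ => rfl, map_smul' := fun _ _ => rfl }
  let U := L.map res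
  have : FiniteDimensional F U := inferInstance
  let B := Module.finBasis F U
  have hB : LinearIndependent F (fun i => (B i : C → F)) :=
    B.linearIndependent.map' U.subtype (Submodule.ker_subtype U)
  have hspan : Submodule.span F (Set.range fun i => (B i : C → F)) = U := by
    have h1 := congrArg (Submodule.map U.subtype) B.span_eq
    rw [Submodule.map_span, ← Set.range_comp, Submodule.map_top, Submodule.range_subtype] at h1
    exact h1
  obtain ⟨y, g, hg, hgy, hall⟩ := exists_dual_points hB
  rw [hspan] at hg hall
  choose l hlL hl using fun a => hg a
  have hl' : ∀ a (e : C), l a e = g a e := fun a e => congrFun (hl a) e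
  have key : ∀ mu ∈ L, (∀ a, mu (y a) = 0) → ∀ e, θ e = 0 → mu e = 0 := by
    intro mu hmu h0 e he
    have := hall (res mu) ⟨mu, hmu, rfl⟩ ⟨e, he⟩
    change mu e = ∑ a, mu (y a) * _ at this
    simpa [h0] using this
  have hlN : ∀ a, ∀ e, θ e = 0 → θ (l a e) = 0 := by
    intro a e he
    have h1 := key _ (H.bracket θ (H.sub hθ) (l a) (hlL a)) (fun b => by
      have h2 : θ (y b) = 0 := (y b).2
      change θ (l a (y b)) - l a (θ (y b)) = 0
      rw [h2, (H.der _ (hlL a)).zero, hl', hgy]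
      split_ifs
      · simp [hd.one]
      · simp [hd.zero]) e he
    simpa [he, (H.der _ (hlL a)).zero] using h1
  intro lam hlam
  have hmu : lam - ∑ a, lam (y a) • l a ∈ L :=
    L.sub_mem hlam (L.sum_mem fun a _ => L.smul_mem _ (hlL a))
  set mu := lam - ∑ a, lam (y a) • l a with hmudef
  have hmu0 : ∀ e, θ e = 0 → mu e = 0 := by
    refine key mu hmu fun b => ?_
    simp [hmudef, hl', hgy]
  have hmu1 : mu = mu x • θ := by
    ext e
    exact hx.eq_mul hd (H.der mu hmu) hmu0 e
  have : lam = mu x • θ + ∑ a, lam (y a) • l a := by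
    rw [← hmu1, hmudef]; abel
  rw [this]
  refine Submodule.add_mem _ (Submodule.smul_mem _ _ (Submodule.subset_span
    ⟨H.sub hθ, fun e he => by rw [he, hd.zero]⟩)) ?_
  exact Submodule.sum_mem _ fun a _ => Submodule.smul_mem _ _ (Submodule.subset_span
    ⟨hlL a, hlN a⟩)

end AlgFoliation

/-- The exponential `f ↦ ∑ θⁿ(f)/n! · sⁿ` of a derivation. -/
noncomputable def IsDer.exp {F Ω : Type} [Field F] [Field Ω] [CharZero Ω] {θ : F → F}
    (hθ : IsDer (RingHom.id F) θ) (j : F →+* Ω) : F →+* PowerSeries Ω where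
  toFun f := PowerSeries.mk fun n => j (θ^[n] f) / (n.factorial : Ω)
  map_zero' := by
    ext n
    have : θ^[n] 0 = 0 := Function.iterate_fixed hθ.zero n
    simp [this]
  map_one' := by
    ext n
    rcases n with _ | n
    · simp
    · have : θ^[n] 0 = 0 := Function.iterate_fixed hθ.zero n
      simp [Function.iterate_succ_apply, hθ.one, this, PowerSeries.coeff_one]
  map_add' x y := by
    ext n
    have : ∀ x y, θ^[n] (x + y) = θ^[n] x + θ^[n] y := by
      induction n with
      | zero => simp
      | succ n ih => intro x y; simp only [Function.iterate_succ_apply, hθ.add, ih]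
    simp [this, add_div]
  map_mul' := by
    have hder : ∀ f, PowerSeries.derivative Ω
        (PowerSeries.mk fun n => j (θ^[n] f) / (n.factorial : Ω)) =
        PowerSeries.mk fun n => j (θ^[n] (θ f)) / (n.factorial : Ω) := by
      intro f
      ext n
      rw [PowerSeries.coeff_derivative, PowerSeries.coeff_mk, PowerSeries.coeff_mk,
        Function.iterate_succ_apply, Nat.factorial_succ]
      have h1 : (n.factorial : Ω) ≠ 0 := Nat.cast_ne_zero.mpr n.factorial_ne_zero
      have h2 : ((n : Ω) + 1) ≠ 0 := Nat.cast_add_one_ne_zero n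
      push_cast
      field_simp
    have hadd : ∀ n x y, θ^[n] (x + y) = θ^[n] x + θ^[n] y := by
      intro n
      induction n with
      | zero => simp
      | succ n ih => intro x y; simp only [Function.iterate_succ_apply, hθ.add, ih]
    intro f g
    ext n
    induction n generalizing f g with
    | zero => simp [PowerSeries.coeff_mul]
    | succ n ih =>
      set Ef := PowerSeries.mk fun n => j (θ^[n] f) / (n.factorial : Ω) with hEf
      set Eg := PowerSeries.mk fun n => j (θ^[n] g) / (n.factorial : Ω) with hEg
      have h2 : ((n : Ω) + 1) ≠ 0 := Nat.cast_add_one_ne_zero n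
      apply mul_right_cancel₀ h2
      rw [← PowerSeries.coeff_derivative, ← PowerSeries.coeff_derivative, hder,
        Derivation.leibniz, hEf, hEg, hder, hder]
      simp only [smul_eq_mul, map_add]
      have i1 := ih f (θ g)
      have i2 := ih (θ f) g
      rw [mul_comm (PowerSeries.mk fun n => j (θ^[n] g) / (n.factorial : Ω)),
        ← i1, ← i2, hθ.mul]
      simp only [PowerSeries.coeff_mk, hadd, map_add, RingHom.id_apply, add_div]
      rw [mul_comm g]

theorem IsDer.exp_apply {F Ω : Type} [Field F] [Field Ω] [CharZero Ω] {θ : F → F}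
    (hθ : IsDer (RingHom.id F) θ) (j : F →+* Ω) (f : F) :
    hθ.exp j f = PowerSeries.mk fun n => j (θ^[n] f) / (n.factorial : Ω) := rfl

theorem IsDer.exp_const {F Ω : Type} [Field F] [Field Ω] [CharZero Ω] {θ : F → F}
    (hθ : IsDer (RingHom.id F) θ) (j : F →+* Ω) {e : F} (he : θ e = 0) :
    hθ.exp j e = PowerSeries.C (j e) := by
  ext n
  rw [hθ.exp_apply, PowerSeries.coeff_mk, PowerSeries.coeff_C]
  rcases n with _ | n
  · simp
  · have : θ^[n] 0 = 0 := Function.iterate_fixed hθ.zero n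
    simp [Function.iterate_succ_apply, he, this]

theorem IsDer.exp_one {F Ω : Type} [Field F] [Field Ω] [CharZero Ω] {θ : F → F}
    (hθ : IsDer (RingHom.id F) θ) (j : F →+* Ω) {x : F} (hx : θ x = 1) :
    hθ.exp j x = PowerSeries.C (j x) + PowerSeries.X := by
  ext n
  rw [hθ.exp_apply, PowerSeries.coeff_mk, map_add, PowerSeries.coeff_C, PowerSeries.coeff_X]
  rcases n with _ | _ | n
  · simp
  · simp [hx]
  · have : θ^[n] 0 = 0 := Function.iterate_fixed hθ.zero n
    simp [Function.iterate_succ_apply, hx, hθ.one, this]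

/-- Two embeddings `i`, `j` of `F` that agree on `E` and such that derivations trivial on `i`
induce along `j` combinations of elements of `L`. -/
def FolGood {F : Type} [Field F] (L : Submodule F (F → F)) (E : Subfield F)
    {Ω : Type} [Field Ω] (i j : F →+* Ω) : Prop :=
  (∀ e ∈ E, j e = i e) ∧ ∀ (M : Type) [Field M] (h : Ω →+* M) (δ : Ω → M), IsDer h δ →
    (∀ f, δ (i f) = 0) → (fun f => δ (j f)) ∈
      Submodule.span M ((fun lam f => h (j (lam f))) '' (L : Set (F → F)))

namespace AlgFoliation

variable {F : Type} [Field F] [CharZero F] {k₀ : Subfield F} {L : Submodule F (F → F)}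
  {𝒯 : Set (F → F)} {E : Subfield F}

omit [CharZero F] in
theorem folGood_id : FolGood L E (RingHom.id F) (RingHom.id F) := by
  refine ⟨fun e _ => rfl, fun M _ h δ _ h0 => ?_⟩
  have : (fun f => δ (RingHom.id F f)) = 0 := funext h0
  rw [this]
  exact Submodule.zero_mem _

theorem exists_step (H : AlgFoliation k₀ L 𝒯 E) {Ω : Type} [Field Ω] {i j : F →+* Ω}
    (hg : FolGood L E i j) {θ : F → F} (hθ : θ ∈ 𝒯) {x : F} (hx : IsAlgDer θ x) :
    ∃ (Ω' : Type) (_ : Field Ω') (ι : Ω →+* Ω') (j' : F →+* Ω'),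
      FolGood L E (ι.comp i) j' ∧ (∀ e, θ e = 0 → j' e = ι (j e)) ∧
      ∃ D : Ω' → Ω', IsDer (RingHom.id Ω') D ∧ (∀ w, D (ι w) = 0) ∧ D (j' x) = 1 := by
  have hd := H.der θ (H.sub hθ)
  have : CharZero Ω := (RingHom.charZero_iff j.injective).mp inferInstance
  let Ω' := FractionRing (PowerSeries Ω)
  let c : PowerSeries Ω →+* Ω' := algebraMap _ _
  have hc : Function.Injective c := IsFractionRing.injective _ _
  let ι : Ω →+* Ω' := c.comp PowerSeries.C
  have : CharZero Ω' := (RingHom.charZero_iff ι.injective).mp inferInstance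
  let j' : F →+* Ω' := c.comp (hd.exp j)
  have hj'c : ∀ e, θ e = 0 → j' e = ι (j e) := fun e he => by
    change c (hd.exp j e) = c (PowerSeries.C (j e))
    rw [hd.exp_const j he]
  refine ⟨Ω', inferInstance, ι, j', ⟨fun e he => ?_, ?_⟩, hj'c, ?_⟩
  · rw [hj'c e ((H.mem_E e).mp he θ hθ), hg.1 e he]; rfl
  · intro M _ h δ hδ h0
    have h1 := hg.2 M (h.comp ι) (fun w => δ (ι w)) (hδ.comp_right ι) h0
    have h2 : Submodule.span M ((fun lam f => (h.comp ι) (j (lam f))) '' (L : Set (F → F))) ≤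
        Submodule.span M ((fun lam f => (h.comp ι) (j (lam f))) ''
          {lam | lam ∈ L ∧ ∀ e, θ e = 0 → θ (lam e) = 0}) := by
      rw [Submodule.span_le]
      rintro _ ⟨lam, hlam, rfl⟩
      have := H.span_normalizer hθ hlam
      induction this using Submodule.span_induction with
      | mem l hl => exact Submodule.subset_span ⟨l, hl, rfl⟩
      | zero =>
        rw [SetLike.mem_coe]
        convert Submodule.zero_mem _ using 1
        ext f; simp
      | add u v hu hv hu' hv' =>
        have hsub : Submodule.span F {lam | lam ∈ L ∧ ∀ e, θ e = 0 → θ (lam e) = 0} ≤ L :=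
          Submodule.span_le.mpr fun l hl => hl.1
        rw [SetLike.mem_coe]
        convert Submodule.add_mem _ (hu' (hsub hu)) (hv' (hsub hv)) using 1
        ext f; simp
      | smul a u hu hu' =>
        have hsub : Submodule.span F {lam | lam ∈ L ∧ ∀ e, θ e = 0 → θ (lam e) = 0} ≤ L :=
          Submodule.span_le.mpr fun l hl => hl.1
        rw [SetLike.mem_coe]
        convert Submodule.smul_mem _ (h (ι (j a))) (hu' (hsub hu)) using 1
        ext f; simp
    obtain ⟨n, m, l, hl⟩ := Submodule.mem_span_set'.mp (h2 h1)
    choose lam hlam hlam' using fun a => (l a).2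
    have hsum : ∀ f, ∑ a, m a * h (ι (j (lam a f))) = δ (ι (j f)) := fun f => by
      have := congrFun hl f
      simp only [Finset.sum_apply, Pi.smul_apply, smul_eq_mul, ← hlam'] at this
      exact this
    have hη : IsDer (h.comp j') (fun f => δ (j' f) - ∑ a, m a * h (j' (lam a f))) := by
      refine (hδ.comp_right j').sub_map (IsDer.sum_map _ _ fun a _ => ?_)
      exact ((H.der _ (hlam a).1).comp_left (h.comp j')).smul_map (m a)
    have hfin := hx.eq_mul hd hη (fun e he => by
      rw [sub_eq_zero, hj'c e he, ← hsum]
      refine Finset.sum_congr rfl fun a _ => ?_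
      rw [hj'c _ ((hlam a).2 e he)])
    set q := δ (j' x) - ∑ a, m a * h (j' (lam a x)) with hq
    have : (fun f => δ (j' f)) = q • (fun f => h (j' (θ f))) +
        ∑ a, m a • (fun f => h (j' (lam a f))) := by
      ext f
      have := hfin f
      simp only [RingHom.comp_apply] at this
      simp only [Pi.add_apply, Pi.smul_apply, Finset.sum_apply, smul_eq_mul, ← this]
      ring
    rw [this]
    refine Submodule.add_mem _ (Submodule.smul_mem _ _ (Submodule.subset_span
      ⟨θ, H.sub hθ, rfl⟩)) (Submodule.sum_mem _ fun a _ => Submodule.smul_mem _ _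
      (Submodule.subset_span ⟨lam a, (hlam a).1, rfl⟩))
  · have hD0 : IsDer ((RingHom.id Ω').comp c) (fun p => c (PowerSeries.derivative Ω p)) :=
      ⟨fun p q => by rw [map_add, map_add], fun p q => by
        rw [Derivation.leibniz]
        simp⟩
    obtain ⟨D, hD, hD'⟩ := IsDer.extend c hc (RingHom.id Ω') hD0
    refine ⟨D, hD, fun w => ?_, ?_⟩
    · change D (c (PowerSeries.C w)) = 0
      rw [hD', PowerSeries.derivative_C, map_zero]
    · change D (c (hd.exp j x)) = 1
      rw [hd.exp_one j hx.1, hD', map_add, PowerSeries.derivative_C]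
      have : PowerSeries.derivative Ω (PowerSeries.X : PowerSeries Ω) = 1 := by
        ext n
        rw [PowerSeries.coeff_derivative, PowerSeries.coeff_X, PowerSeries.coeff_one]
        rcases n with _ | n <;> simp
      rw [this]; simp

end AlgFoliation

namespace AlgFoliation

variable {F : Type} [Field F] [CharZero F] {k₀ : Subfield F} {L : Submodule F (F → F)}
  {𝒯 : Set (F → F)} {E : Subfield F}

/-- There is a good pair of embeddings with `m` independent transversal derivations. -/
def HasRank (L : Submodule F (F → F)) (E : Subfield F) (m : ℕ) : Prop :=
  ∃ (Ω : Type) (_ : Field Ω) (i j : F →+* Ω), FolGood L E i j ∧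
    ∃ (ι : Type) (_ : Fintype ι) (_ : DecidableEq ι) (δ : ι → Ω → Ω) (y : ι → F),
      Fintype.card ι = m ∧ (∀ a, IsDer (RingHom.id Ω) (δ a)) ∧ (∀ a f, δ a (i f) = 0) ∧
      ∀ a b, δ a (j (y b)) = if a = b then 1 else 0

omit [CharZero F] in
theorem hasRank_le (H : AlgFoliation k₀ L 𝒯 E) :
    ∃ n, ∀ m, HasRank L E m → m ≤ n := by
  obtain ⟨n, z, hz⟩ := H.fin
  refine ⟨n, ?_⟩
  rintro m ⟨Ω, _, i, j, hg, ι, _, _, δ, y, rfl, hδ, hδi, hδy⟩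
  have hk : ∀ c ∈ k₀, c ∈ E := fun c hc =>
    (H.mem_E c).mpr fun θ hθ => H.const θ (H.sub hθ) c hc
  have hli : LinearIndependent Ω (fun a (t : Fin n) => δ a (j (z t))) := by
    rw [Fintype.linearIndependent_iff]
    intro c hc b
    have h1 : IsDer j (fun f => ∑ a, c a * δ a (j f)) :=
      IsDer.sum_map _ _ fun a _ => ((hδ a).comp_right j).smul_map (c a)
    have h2 := hz Ω j _ h1 (fun e he => by
      refine Finset.sum_eq_zero fun a _ => ?_
      rw [hg.1 e (hk e he), hδi, mul_zero]) (fun t => by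
      have := congrFun hc t
      simpa using this) (y b)
    simpa [hδy] using h2
  simpa using hli.fintype_card_le_finrank

/-- There is a good pair such that every element of `𝒯` lifts along `j`. -/
theorem exists_saturated (H : AlgFoliation k₀ L 𝒯 E) :
    ∃ (Ω : Type) (_ : Field Ω) (i j : F →+* Ω), FolGood L E i j ∧
      ∀ θ ∈ 𝒯, ∃ δ : Ω → Ω, IsDer (RingHom.id Ω) δ ∧ (∀ f, δ (i f) = 0) ∧
        ∀ f, δ (j f) = j (θ f) := by
  classical
  obtain ⟨n, hn⟩ := H.hasRank_le
  have h0 : HasRank L E 0 := ⟨F, inferInstance, _, _, folGood_id, Empty, inferInstance,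
    inferInstance, fun a => a.elim, fun a => a.elim, rfl, fun a => a.elim, fun a => a.elim,
    fun a => a.elim⟩
  have hmax : ∃ m, HasRank L E m ∧ ¬ HasRank L E (m + 1) := by
    by_contra hcon
    push Not at hcon
    have : ∀ m, HasRank L E m := fun m => by
      induction m with
      | zero => exact h0
      | succ m ih => exact hcon m ih
    exact absurd (hn _ (this (n + 1))) (by omega)
  obtain ⟨m, ⟨Ω, _, i, j, hg, ι, _, _, δ, y, hcard, hδ, hδi, hδy⟩, hm⟩ := hmax
  refine ⟨Ω, inferInstance, i, j, hg, fun θ hθ => ?_⟩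
  have hd := H.der θ (H.sub hθ)
  obtain ⟨x, hx⟩ := H.alg θ hθ
  let C := hd.fieldConstants
  by_cases hli : LinearIndependent Ω (fun a (e : C) => δ a (j e))
  · exfalso
    apply hm
    obtain ⟨y', g, hgs, hgy, -⟩ := exists_dual_points hli
    have hex : ∀ a, ∃ c : ι → Ω, ∀ e : C, ∑ b, c b * δ b (j e) = g a e := fun a => by
      obtain ⟨c, hc⟩ := (Submodule.mem_span_range_iff_exists_fun Ω).mp (hgs a)
      refine ⟨c, fun e => ?_⟩
      rw [← hc]; simp
    choose c hc using hex
    obtain ⟨Ω', _, κ, j', hg', hj', D, hD, hDκ, hDx⟩ := H.exists_step hg hθ hx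
    have : CharZero Ω := (RingHom.charZero_iff j.injective).mp inferInstance
    have hext : ∀ a, ∃ d : Ω' → Ω', IsDer (RingHom.id Ω') d ∧
        ∀ w, d (κ w) = κ (∑ b, c a b * δ b w) := fun a => by
      have h1 : IsDer (RingHom.id Ω) (fun w => ∑ b, c a b * δ b w) :=
        IsDer.sum_map _ _ fun b _ => (hδ b).smul_map (c a b)
      exact IsDer.extend_field κ (RingHom.id Ω') (h1.comp_left κ)
    choose d hd1 hd2 using hext
    have hyy : ∀ b, j' (y' b) = κ (j (y' b)) := fun b => hj' _ (y' b).2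
    have hdy : ∀ a b, d a (j' (y' b)) = if a = b then 1 else 0 := fun a b => by
      rw [hyy, hd2, hc, hgy]; split_ifs <;> simp
    have hDy : ∀ b, D (j' (y' b)) = 0 := fun b => by rw [hyy, hDκ]
    have hdi : ∀ a f, d a (κ (i f)) = 0 := fun a f => by
      rw [hd2]; simp [hδi]
    refine ⟨Ω', inferInstance, κ.comp i, j', hg', Option ι, inferInstance, inferInstance,
      fun a => a.elim D (fun a w => d a w - d a (j' x) * D w),
      fun a => a.elim x (fun b => (y' b : F)), by simp [hcard], ?_, ?_, ?_⟩
    · rintro (_ | a)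
      · exact hD
      · exact (hd1 a).sub_map (hD.smul_map _)
    · rintro (_ | a) f
      · exact hDκ _
      · simp [hdi, hDκ]
    · rintro (_ | a) (_ | b)
      · simp [hDx]
      · simp [hDy]
      · simp [hDx]
      · simp [hDy, hdy]
  · rw [Fintype.not_linearIndependent_iff] at hli
    obtain ⟨c, hc0, b, hb⟩ := hli
    have h1 : IsDer (RingHom.id Ω) (fun w => ∑ a, c a * δ a w) :=
      IsDer.sum_map _ _ fun a _ => (hδ a).smul_map (c a)
    have h2 := hx.eq_mul hd (h1.comp_right j) (fun e he => by
      have := congrFun hc0 ⟨e, he⟩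
      simpa using this)
    set q := ∑ a, c a * δ a (j x) with hq
    have hq0 : q ≠ 0 := by
      intro hq0
      have := h2 (y b)
      rw [hq0, zero_mul] at this
      apply hb
      simpa [hδy] using this
    refine ⟨_, h1.smul_map q⁻¹, fun f => by simp [hδi], fun f => ?_⟩
    have := h2 f
    simp only [RingHom.comp_apply, RingHom.id_apply] at this
    rw [this]
    field_simp

omit [CharZero F] in
theorem eq_zero_of_relation (H : AlgFoliation k₀ L 𝒯 E) {Ω : Type} [Field Ω] {i j : F →+* Ω}
    (hij : ∀ e ∈ E, j e = i e)
    (hsat : ∀ θ ∈ 𝒯, ∃ δ : Ω → Ω, IsDer (RingHom.id Ω) δ ∧ (∀ f, δ (i f) = 0) ∧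
        ∀ f, δ (j f) = j (θ f))
    {κ : Type*} {a : κ → F} (ha : LinearIndependent E a) :
    ∀ c : κ →₀ F, c.sum (fun m b => i (a m) * j b) = 0 → c = 0 := by
  classical
  intro c
  induction hn : c.support.card using Nat.strong_induction_on generalizing c with
  | _ n ih =>
  intro hc
  by_contra hne
  obtain ⟨m₀, hm₀⟩ := Finsupp.ne_iff.mp hne
  simp only [Finsupp.coe_zero, Pi.zero_apply] at hm₀
  let c' : κ →₀ F := c.mapRange (fun b => (c m₀)⁻¹ * b) (by simp)
  have hsupp : c'.support ⊆ c.support := Finsupp.support_mapRange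
  have hc'0 : c' m₀ = 1 := by simp [c', hm₀]
  have hc' : ∑ m ∈ c.support, i (a m) * j (c' m) = 0 := by
    have : ∑ m ∈ c.support, i (a m) * j (c' m) =
        j (c m₀)⁻¹ * ∑ m ∈ c.support, i (a m) * j (c m) := by
      rw [Finset.mul_sum]
      refine Finset.sum_congr rfl fun m _ => ?_
      simp only [c', Finsupp.mapRange_apply, map_mul]
      ring
    rw [this]
    rw [Finsupp.sum] at hc
    rw [hc, mul_zero]
  have hE : ∀ m, c' m ∈ E := by
    intro m
    rw [H.mem_E]
    intro θ hθ
    have hd := H.der θ (H.sub hθ)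
    obtain ⟨δ, hδ, hδi, hδj⟩ := hsat θ hθ
    have h1 := congrArg δ hc'
    rw [hδ.zero, hδ.sum] at h1
    simp only [hδ.mul, hδi, hδj, mul_zero, add_zero, RingHom.id_apply] at h1
    let c'' : κ →₀ F := c'.mapRange θ hd.zero
    have hs2 : c''.support ⊆ c.support.erase m₀ := by
      intro m hm
      rw [Finset.mem_erase]
      refine ⟨?_, hsupp (Finsupp.support_mapRange hm)⟩
      rintro rfl
      rw [Finsupp.mem_support_iff] at hm
      simp [c'', hc'0, hd.one] at hm
    have hlt : c''.support.card < n := by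
      rw [← hn]
      exact (Finset.card_le_card hs2).trans_lt
        (Finset.card_erase_lt_of_mem (Finsupp.mem_support_iff.mpr hm₀))
    have h2 := ih _ hlt c'' rfl (by
      rw [Finsupp.sum_of_support_subset _ (hs2.trans (Finset.erase_subset _ _)) _ (by simp)]
      exact h1)
    have := DFunLike.congr_fun h2 m
    simpa [c''] using this
  have h3 : ∑ m ∈ c.support, (⟨c' m, hE m⟩ : E) • a m = 0 := by
    apply i.injective
    rw [map_sum, map_zero, ← hc']
    refine Finset.sum_congr rfl fun m _ => ?_
    rw [hij _ (hE m), ← map_mul, mul_comm]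
    rfl
  have h4 := linearIndependent_iff'.mp ha _ _ h3 m₀ (Finsupp.mem_support_iff.mpr hm₀)
  have h5 : c' m₀ = 0 := congrArg Subtype.val h4
  rw [hc'0] at h5
  exact one_ne_zero h5

/-- Every derivation of `F` over `E` lies in `L`. -/
theorem mem_of_isDer (H : AlgFoliation k₀ L 𝒯 E) {η : F → F}
    (hη : IsDer (RingHom.id F) η) (hηE : ∀ e ∈ E, η e = 0) : η ∈ L := by
  classical
  obtain ⟨Ω, _, i, j, hg, hsat⟩ := H.exists_saturated
  have : CharZero Ω := (RingHom.charZero_iff j.injective).mp inferInstance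
  obtain ⟨δ, hδ, hδi, hδj⟩ : ∃ δ : Ω → Ω, IsDer (RingHom.id Ω) δ ∧ (∀ f, δ (i f) = 0) ∧
      ∀ f, δ (j f) = j (η f) := by
    let _ : Algebra E Ω := (i.comp E.subtype).toAlgebra
    let iA : F →ₐ[E] Ω := { i with commutes' := fun e => rfl }
    let jA : F →ₐ[E] Ω := { j with commutes' := fun e => hg.1 e e.2 }
    let P : F ⊗[E] F →ₐ[E] Ω := Algebra.TensorProduct.productMap iA jA
    have hP : ∀ a b, P (a ⊗ₜ b) = i a * j b := fun a b =>
      Algebra.TensorProduct.productMap_apply_tmul iA jA a b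
    let B := Module.Basis.ofVectorSpace E F
    have hinj : Function.Injective P := by
      rw [injective_iff_map_eq_zero]
      intro t ht
      obtain ⟨c, rfl⟩ := (TensorProduct.equivFinsuppOfBasisLeft (N := F) B).symm.surjective t
      rw [TensorProduct.equivFinsuppOfBasisLeft_symm_apply] at ht ⊢
      rw [Finsupp.sum, map_sum] at ht
      have : c = 0 := H.eq_zero_of_relation hg.1 hsat B.linearIndependent c (by
        rw [Finsupp.sum, ← ht]
        exact Finset.sum_congr rfl fun m _ => (hP _ _).symm)
      rw [this]; simp
    let ηL : F →ₗ[E] F :=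
      { toFun := η
        map_add' := hη.add
        map_smul' := fun e f => by
          change η (e.1 * f) = e.1 * η f
          rw [hη.mul, hηE e.1 e.2]; simp }
    let d : F ⊗[E] F →ₗ[E] F ⊗[E] F := ηL.lTensor F
    have hdt : ∀ a b, d (a ⊗ₜ b) = a ⊗ₜ η b := fun a b => rfl
    have hd : IsDer (RingHom.id (F ⊗[E] F)) d := by
      refine ⟨fun x y => map_add d x y, fun x y => ?_⟩
      induction x using TensorProduct.induction_on with
      | zero => simp
      | add x x' hx hx' =>
        simp only [add_mul, map_add, hx, hx', RingHom.id_apply]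
        ring
      | tmul a b =>
        induction y using TensorProduct.induction_on with
        | zero => simp
        | add y y' hy hy' =>
          simp only [mul_add, map_add, hy, hy', RingHom.id_apply]
          ring
        | tmul a' b' =>
          simp only [Algebra.TensorProduct.tmul_mul_tmul, hdt, RingHom.id_apply, hη.mul,
            TensorProduct.tmul_add]
          rw [mul_comm a' a]
    have hPd : IsDer ((RingHom.id Ω).comp (P : F ⊗[E] F →+* Ω)) (fun t => P (d t)) :=
      hd.comp_left (P : F ⊗[E] F →+* Ω)
    obtain ⟨δ, hδ, hδ'⟩ := IsDer.extend (P : F ⊗[E] F →+* Ω) hinj (RingHom.id Ω) hPd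
    refine ⟨δ, hδ, fun f => ?_, fun f => ?_⟩
    · have h1 : (P : F ⊗[E] F →+* Ω) (f ⊗ₜ 1) = i f := by
        change P (f ⊗ₜ 1) = _
        rw [hP]; simp
      rw [← h1, hδ', hdt, hη.one]; simp
    · have h1 : ∀ f, (P : F ⊗[E] F →+* Ω) (1 ⊗ₜ f) = j f := fun f => by
        change P (1 ⊗ₜ f) = _
        rw [hP]; simp
      rw [← h1, hδ', hdt]; exact h1 _
  have hmem := hg.2 Ω (RingHom.id Ω) δ hδ hδi
  simp only [hδj, RingHom.id_apply] at hmem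
  have := H.finiteDimensional
  let B := Module.finBasis F L
  have hB : LinearIndependent F (fun i => (B i : F → F)) :=
    B.linearIndependent.map' L.subtype (Submodule.ker_subtype L)
  have hspan : Submodule.span F (Set.range fun i => (B i : F → F)) = L := by
    have h1 := congrArg (Submodule.map L.subtype) B.span_eq
    rw [Submodule.map_span, ← Set.range_comp, Submodule.map_top, Submodule.range_subtype] at h1
    exact h1
  obtain ⟨y, g, hgs, hgy, hall⟩ := exists_dual_points hB
  rw [hspan] at hgs hall
  have key : ∀ h ∈ Submodule.span Ω ((fun lam f => j (lam f)) '' (L : Set (F → F))), ∀ f,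
      h f = ∑ a, h (y a) * j (g a f) := by
    intro h hh
    induction hh using Submodule.span_induction with
    | mem h hh =>
      obtain ⟨l, hl, rfl⟩ := hh
      intro f
      have h1 := hall l hl f
      simp only
      conv_lhs => rw [h1]
      simp
    | zero => simp
    | add u v _ _ hu hv =>
      intro f
      simp only [Pi.add_apply, add_mul, Finset.sum_add_distrib, ← hu f, ← hv f]
    | smul c u _ hu =>
      intro f
      simp only [Pi.smul_apply, smul_eq_mul, mul_assoc, ← Finset.mul_sum, ← hu f]
  have hfin : η = ∑ a, η (y a) • g a := by
    ext f
    apply j.injective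
    rw [key _ hmem f]
    simp
  rw [hfin]
  exact L.sum_mem fun a _ => L.smul_mem _ (hgs a)

end AlgFoliation

section HeightOne

variable {A B : Type*} [CommRing A] [CommRing B]

theorem heightOnePrime_iff [IsDomain A] {P : Ideal A} :
    HeightOnePrime P ↔ P.IsPrime ∧ P.height = 1 := by
  constructor
  · rintro ⟨hP, h0, h⟩
    refine ⟨hP, le_antisymm ?_ ?_⟩
    · refine (Ideal.height_le_iff (n := 1)).2 fun q hq hlt => ?_
      rw [h q hq hlt, Ideal.height_bot]
      norm_num
    · rw [Order.one_le_iff_ne_zero]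
      exact fun h1 => h0 (Ideal.height_eq_zero_iff_eq_bot.1 h1)
  · rintro ⟨hP, h⟩
    refine ⟨hP, fun h0 => by simp [h0, Ideal.height_bot] at h, fun Q hQ hlt => ?_⟩
    have := (Ideal.height_le_iff (n := 1)).1 h.le Q hQ hlt
    have h0 : Q.height = 0 := by simpa [Order.lt_one_iff] using this
    exact Ideal.height_eq_zero_iff_eq_bot.1 h0

theorem HeightOnePrime.eq_of_le {P Q : Ideal A} (hQ : HeightOnePrime Q)
    (hP : P.IsPrime) (h0 : P ≠ ⊥) (hle : P ≤ Q) : P = Q := by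
  by_contra hne
  exact h0 (hQ.2.2 P hP (lt_of_le_of_ne hle hne))

variable [IsDomain A] [IsNoetherianRing A]

theorem heightOnePrime_of_mem_minimalPrimes {b : A} (hb : b ≠ 0) {P : Ideal A}
    (hP : P ∈ (Ideal.span {b}).minimalPrimes) : HeightOnePrime P := by
  rw [heightOnePrime_iff]
  have hpr : P.IsPrime := hP.1.1
  refine ⟨hpr, le_antisymm (Ideal.height_le_one_of_isPrincipal_of_mem_minimalPrimes _ _ hP) ?_⟩
  rw [Order.one_le_iff_ne_zero]
  intro h
  rw [Ideal.height_eq_zero_iff_eq_bot] at h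
  have : b ∈ P := hP.1.2 (Ideal.mem_span_singleton_self b)
  rw [h] at this
  exact hb (by simpa using this)

theorem exists_heightOnePrime_le {I : Ideal A} [I.IsPrime] (hI : I ≠ ⊥) :
    ∃ P, HeightOnePrime P ∧ P ≤ I := by
  obtain ⟨b, hbI, hb⟩ := Submodule.exists_mem_ne_zero_of_ne_bot hI
  obtain ⟨P, hP, hle⟩ := Ideal.exists_minimalPrimes_le
    ((Ideal.span_singleton_le_iff_mem I).2 hbI)
  exact ⟨P, heightOnePrime_of_mem_minimalPrimes hb hP, hle⟩

theorem finite_heightOnePrime_mem {b : A} (hb : b ≠ 0) :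
    {P : Ideal A | HeightOnePrime P ∧ b ∈ P}.Finite := by
  refine (Ideal.finite_minimalPrimes_of_isNoetherianRing A (Ideal.span {b})).subset ?_
  rintro P ⟨hP, hbP⟩
  have := hP.1
  obtain ⟨P', hP', hle⟩ := Ideal.exists_minimalPrimes_le
    ((Ideal.span_singleton_le_iff_mem P).2 hbP)
  have h1 := heightOnePrime_of_mem_minimalPrimes hb hP'
  rw [← hP.eq_of_le h1.1 h1.2.1 hle]
  exact hP'

theorem mem_PTset_iff [IsDomain B] [IsNoetherianRing B] {f : A →+* B}
    (hf : Function.Injective f) {t : Ideal A} (ht : HeightOnePrime t) {Q : Ideal B} :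
    Q ∈ PTset f t ↔ HeightOnePrime Q ∧ Q.comap f = t := by
  have hne : t.map f ≠ ⊥ := by
    intro h
    obtain ⟨b, hb, hb0⟩ := Submodule.exists_mem_ne_zero_of_ne_bot ht.2.1
    have := Ideal.mem_map_of_mem f hb
    rw [h] at this
    exact hb0 (hf (by simpa using this))
  constructor
  · rintro ⟨hQ, hc⟩
    refine ⟨?_, hc⟩
    have hQp : Q.IsPrime := hQ.1.1
    rw [heightOnePrime_iff]
    refine ⟨hQp, le_antisymm ?_ ?_⟩
    · let := f.toAlgebra
      have : t.IsPrime := ht.1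
      have hl : Q.LiesOver t := ⟨hc.symm⟩
      refine (Ideal.height_le_height_add_of_liesOver t Q).trans ?_
      have h1 : (Ideal.map (Ideal.Quotient.mk (Ideal.map (algebraMap A B) t)) Q).height = 0 := by
        have hker : RingHom.ker (Ideal.Quotient.mk (Ideal.map (algebraMap A B) t)) ≤ Q := by
          rw [Ideal.mk_ker]
          exact hQ.1.2
        have hpr := Ideal.map_isPrime_of_surjective
          (f := Ideal.Quotient.mk (Ideal.map (algebraMap A B) t)) Ideal.Quotient.mk_surjective hker
        refine le_antisymm ((Ideal.height_le_iff (n := 0)).2 fun q hq hlt => ?_) zero_le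
        exfalso
        have hle : q.comap (Ideal.Quotient.mk (Ideal.map (algebraMap A B) t)) ≤ Q := by
          refine (Ideal.comap_mono hlt.le).trans ?_
          rw [Ideal.comap_map_of_surjective _ Ideal.Quotient.mk_surjective]
          exact sup_le le_rfl hker
        have h3 := hQ.2 ⟨Ideal.comap_isPrime _ q, by
          rw [← Ideal.mk_ker (I := Ideal.map f t)]
          exact Ideal.comap_mono bot_le⟩ hle
        exact hlt.not_ge (Ideal.map_le_iff_le_comap.2 h3)
      rw [h1, add_zero, (heightOnePrime_iff.1 ht).2]
    · rw [Order.one_le_iff_ne_zero]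
      intro h
      rw [Ideal.height_eq_zero_iff_eq_bot] at h
      exact hne (le_bot_iff.1 (h ▸ hQ.1.2))
  · rintro ⟨hQ, hc⟩
    refine ⟨⟨⟨hQ.1, Ideal.map_le_iff_le_comap.2 hc.ge⟩, fun P hP hle => ?_⟩, hc⟩
    refine (hQ.eq_of_le hP.1 (fun h => hne (le_bot_iff.1 (h ▸ hP.2))) hle).ge

end HeightOne

section Transport

variable {A B : Type*} [CommRing A] [CommRing B] [IsDomain A] [IsDomain B] [IsNoetherianRing A]

/-- The ring homomorphism `g` is the localization inverting `b`. -/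
def IsAwayHom {A B : Type*} [CommRing A] [CommRing B] (g : A →+* B) (b : A) : Prop :=
  letI := g.toAlgebra
  IsLocalization.Away b B

omit [IsNoetherianRing A] in
theorem IsAwayHom.heightOnePrime_comap {g : A →+* B} {b : A} (h : IsAwayHom g b) {Q : Ideal B}
    (hQ : HeightOnePrime Q) : HeightOnePrime (Q.comap g) := by
  let := g.toAlgebra
  have : IsLocalization.Away b B := h
  rw [heightOnePrime_iff] at hQ ⊢
  have := hQ.1
  exact ⟨inferInstance, (IsLocalization.height_under (.powers b) Q).trans hQ.2⟩

omit [IsDomain A] [IsDomain B] [IsNoetherianRing A] in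
theorem IsAwayHom.comap_injective {g : A →+* B} {b : A} (h : IsAwayHom g b) :
    Function.Injective (Ideal.comap g) := by
  let := g.toAlgebra
  have : IsLocalization.Away b B := h
  intro P Q hPQ
  rw [← IsLocalization.map_under (.powers b) B P, ← IsLocalization.map_under (.powers b) B Q]
  exact congrArg _ hPQ

omit [IsNoetherianRing A] in
theorem IsAwayHom.exists_heightOnePrime {g : A →+* B} {b : A} (h : IsAwayHom g b) {Q : Ideal A}
    (hQ : HeightOnePrime Q) (hb : b ∉ Q) : ∃ Q' : Ideal B, HeightOnePrime Q' ∧ Q'.comap g = Q := by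
  let := g.toAlgebra
  have : IsLocalization.Away b B := h
  have hd : Disjoint (Submonoid.powers b : Set A) Q := by
    rw [Set.disjoint_left]
    rintro _ ⟨n, rfl⟩ hn
    exact hb (hQ.1.mem_of_pow_mem n hn)
  have h1 : Ideal.under A (Q.map g) = Q :=
    IsLocalization.under_map_of_isPrime_disjoint (.powers b) B hQ.1 hd
  refine ⟨Q.map g, ?_, h1⟩
  rw [heightOnePrime_iff] at hQ ⊢
  refine ⟨IsLocalization.isPrime_of_isPrime_disjoint (.powers b) B Q hQ.1 hd, ?_⟩
  rw [← IsLocalization.height_under (.powers b) (Q.map g), h1, hQ.2]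

theorem IsAwayHom.finite_iff {g : A →+* B} {b : A} (h : IsAwayHom g b) (hb : b ≠ 0)
    (P : Ideal A → Prop) :
    {Q : Ideal B | HeightOnePrime Q ∧ P (Q.comap g)}.Finite ↔
      {Q : Ideal A | HeightOnePrime Q ∧ P Q}.Finite := by
  constructor
  · intro hf
    refine ((hf.image (Ideal.comap g)).union (finite_heightOnePrime_mem hb)).subset ?_
    rintro Q ⟨hQ, hP⟩
    by_cases hbQ : b ∈ Q
    · exact Or.inr ⟨hQ, hbQ⟩
    · obtain ⟨Q', hQ', rfl⟩ := h.exists_heightOnePrime hQ hbQ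
      exact Or.inl ⟨Q', ⟨hQ', hP⟩, rfl⟩
  · intro hf
    refine Set.Finite.of_finite_image (f := Ideal.comap g) (hf.subset ?_) h.comap_injective.injOn
    rintro _ ⟨Q, ⟨hQ, hP⟩, rfl⟩
    exact ⟨h.heightOnePrime_comap hQ, hP⟩

end Transport

section BaseChange

variable {k : Type*} [Field k] {A B : Type*} [CommRing A] [CommRing B]
    [Algebra k A] [Algebra k B]

theorem baseChange_isAwayHom {f : A →ₐ[k] B} {b : A} (h : IsAwayHom f.toRingHom b) :
    IsAwayHom (baseChange k f) (1 ⊗ₜ b) := by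
  let := f.toRingHom.toAlgebra
  have : IsLocalization.Away b B := h
  have : IsScalarTower k A B := .of_algebraMap_eq fun x => (f.commutes x).symm
  let := (baseChange k f).toAlgebra
  have : IsScalarTower (AlgebraicClosure k) (AlgebraicClosure k ⊗[k] A)
      (AlgebraicClosure k ⊗[k] B) := .of_algebraMap_eq fun x => by
    change x ⊗ₜ 1 = baseChange k f (x ⊗ₜ 1)
    simp [baseChange]
  have := IsLocalization.tensorProduct_tensorProduct_right k (AlgebraicClosure k)
    (Submonoid.powers b) B (by
      ext x
      change baseChange k f (1 ⊗ₜ x) = 1 ⊗ₜ f x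
      simp [baseChange])
  rw [Submonoid.map_powers] at this
  exact this

theorem baseChange_injective {f : A →ₐ[k] B} (h : Function.Injective f) :
    Function.Injective (baseChange k f) := by
  have := Module.Flat.lTensor_preserves_injective_linearMap (M := AlgebraicClosure k)
    f.toLinearMap h
  exact this

theorem baseChange_comp {C : Type*} [CommRing C] [Algebra k C] (g : B →ₐ[k] C) (f : A →ₐ[k] B) :
    baseChange k (g.comp f) = (baseChange k g).comp (baseChange k f) := by
  have : Algebra.TensorProduct.map (AlgHom.id k (AlgebraicClosure k)) (g.comp f) =
    (Algebra.TensorProduct.map (AlgHom.id k (AlgebraicClosure k)) g).comp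
      (Algebra.TensorProduct.map (AlgHom.id k (AlgebraicClosure k)) f) := by
    ext <;> simp
  unfold baseChange
  rw [this]
  rfl

instance [Algebra.FiniteType k A] : IsNoetherianRing (AlgebraicClosure k ⊗[k] A) :=
  Algebra.FiniteType.isNoetherianRing (AlgebraicClosure k) _

end BaseChange

section Dual

variable {F : Type} [Field F] [CharZero F]

theorem exists_dual_derivation (E : Subfield F) {ι : Type*} {x : ι → F}
    (hx : AlgebraicIndependent E x) (i : ι) :
    ∃ θ : F → F, IsDer (RingHom.id F) θ ∧ (∀ e ∈ E, θ e = 0) ∧ θ (x i) = 1 ∧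
      ∀ j, j ≠ i → θ (x j) = 0 := by
  have htr : Transcendental (Algebra.adjoin E (x '' {i}ᶜ)) (x i) :=
    hx.transcendental_adjoin (by simp)
  rw [transcendental_iff_injective] at htr
  set R₀ := Algebra.adjoin E (x '' {i}ᶜ)
  obtain ⟨δ, hδ, hδ'⟩ := IsDer.extend (R := Polynomial R₀) (M := F)
    (Polynomial.aeval (x i) : Polynomial R₀ →ₐ[R₀] F).toRingHom htr (RingHom.id F)
    (η := fun p => Polynomial.aeval (x i) (Polynomial.derivative p))
    ⟨fun p q => by simp, fun p q => by simp; ring⟩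
  have hR : ∀ r : R₀, δ r = 0 := fun r => by
    have := hδ' (Polynomial.C r)
    simpa using this
  refine ⟨δ, hδ, fun e he => ?_, ?_, fun j hj => ?_⟩
  · exact hR (algebraMap E R₀ ⟨e, he⟩)
  · have := hδ' Polynomial.X
    simpa using this
  · exact hR ⟨x j, Algebra.subset_adjoin ⟨j, hj, rfl⟩⟩

omit [CharZero F] in
theorem isAlgDer_of_isTranscendenceBasis {E : Subfield F} {ι : Type*} {x : ι → F}
    (hx : IsTranscendenceBasis E x) {i : ι} {θ : F → F}
    (hE : ∀ e ∈ E, θ e = 0) (hi : θ (x i) = 1) (hj : ∀ j, j ≠ i → θ (x j) = 0) :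
    IsAlgDer θ (x i) := by
  refine ⟨hi, fun C hC y => ?_⟩
  have hA := hx.isAlgebraic_field.isAlgebraic y
  set G := Subfield.closure ((C : Set F) ∪ {x i})
  have hCG : ∀ c ∈ C, c ∈ G := fun c hc => Subfield.subset_closure (Or.inl hc)
  have hle : (IntermediateField.adjoin E (Set.range x)).toSubfield ≤ G := by
    rw [IntermediateField.adjoin_toSubfield, Subfield.closure_le]
    rintro z (⟨e, rfl⟩ | ⟨j, rfl⟩)
    · exact hCG _ ((hC _).2 (hE _ e.2))
    · by_cases h : j = i
      · subst h
        exact Subfield.subset_closure (Or.inr rfl)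
      · exact hCG _ ((hC _).2 (hj j h))
  obtain ⟨p, hp0, hp⟩ := hA
  let f : IntermediateField.adjoin E (Set.range x) →+* G :=
    { toFun := fun z => ⟨z, hle z.2⟩
      map_one' := rfl
      map_mul' := fun _ _ => rfl
      map_zero' := rfl
      map_add' := fun _ _ => rfl }
  refine ⟨p.map f, (Polynomial.map_ne_zero_iff f.injective).2 hp0, ?_⟩
  rw [Polynomial.aeval_def, Polynomial.eval₂_map]
  exact hp

end Dual

section Theta

variable {F : Type} [Field F]

/-- Derivations of `F` over `k₀` preserving almost all members of a family of pairs `(O, M)`. -/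
def thetaModule (k₀ : Subfield F) {ι : Type*} (O : ι → Subring F) (M : ι → AddSubgroup F)
    (hOM : ∀ i, ∀ a ∈ O i, ∀ m ∈ M i, a * m ∈ M i) (hfin : ∀ f, {i | f ∉ O i}.Finite) :
    Submodule F (F → F) where
  carrier := {θ | IsDer (RingHom.id F) θ ∧ (∀ c ∈ k₀, θ c = 0) ∧
    {i | ¬ ((∀ x ∈ O i, θ x ∈ O i) ∧ ∀ x ∈ M i, θ x ∈ M i)}.Finite}
  add_mem' := by
    rintro θ θ' ⟨h1, h2, h3⟩ ⟨h1', h2', h3'⟩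
    refine ⟨h1.add_map h1', fun c hc => by simp [h2 c hc, h2' c hc], (h3.union h3').subset ?_⟩
    intro i hi
    by_contra h
    rw [Set.mem_union, not_or] at h
    have h4 := not_not.1 h.1
    have h5 := not_not.1 h.2
    exact hi ⟨fun x hx => add_mem (h4.1 x hx) (h5.1 x hx),
      fun x hx => add_mem (h4.2 x hx) (h5.2 x hx)⟩
  zero_mem' := by
    refine ⟨IsDer.zero_map _, fun _ _ => rfl, ?_⟩
    convert Set.finite_empty
    ext i
    simp only [Set.mem_ofPred_eq, Set.mem_empty_iff_false, iff_false, not_not]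
    exact ⟨fun x _ => zero_mem _, fun x _ => zero_mem _⟩
  smul_mem' := by
    rintro f θ ⟨h1, h2, h3⟩
    refine ⟨h1.smul_map f, fun c hc => by simp [h2 c hc], (h3.union (hfin f)).subset ?_⟩
    intro i hi
    by_contra h
    rw [Set.mem_union, not_or] at h
    have h4 := not_not.1 h.1
    have h5 := not_not.1 h.2
    exact hi ⟨fun x hx => mul_mem h5 (h4.1 x hx), fun x hx => hOM i _ h5 _ (h4.2 x hx)⟩

/-- The algebraic elements of a space of derivations. -/
def algElements (L : Submodule F (F → F)) : Set (F → F) := {θ | θ ∈ L ∧ ∃ x, IsAlgDer θ x}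

/-- The common constants of the algebraic elements of a space of derivations. -/
def algConstants (L : Submodule F (F → F)) : Subfield F :=
  sInf {C | ∃ θ ∈ algElements L, ∀ x, x ∈ C ↔ θ x = 0}

variable (k₀ : Subfield F) {ι : Type*} (O : ι → Subring F) (M : ι → AddSubgroup F)
    (hOM : ∀ i, ∀ a ∈ O i, ∀ m ∈ M i, a * m ∈ M i) (hfin : ∀ f, {i | f ∉ O i}.Finite)

theorem mem_algConstants {L : Submodule F (F → F)} (hL : ∀ θ ∈ L, IsDer (RingHom.id F) θ) {x : F} :
    x ∈ algConstants L ↔ ∀ θ ∈ algElements L, θ x = 0 := by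
  rw [algConstants, Subfield.mem_sInf]
  constructor
  · intro h θ hθ
    exact h (hL θ hθ.1).fieldConstants ⟨θ, hθ, fun _ => Iff.rfl⟩
  · rintro h C ⟨θ, hθ, hC⟩
    exact (hC x).2 (h θ hθ)

theorem algFoliation_thetaModule
    (hfg : ∃ (n : ℕ) (z : Fin n → F), ∀ (M : Type) [Field M] (j : F →+* M) (η : F → M),
      IsDer j η → (∀ e ∈ k₀, η e = 0) → (∀ i, η (z i) = 0) → ∀ x, η x = 0) :
    AlgFoliation k₀ (thetaModule k₀ O M hOM hfin) (algElements (thetaModule k₀ O M hOM hfin))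
      (algConstants (thetaModule k₀ O M hOM hfin)) where
  der := fun _ h => h.1
  const := fun _ h => h.2.1
  bracket := by
    rintro θ ⟨h1, h2, h3⟩ θ' ⟨h1', h2', h3'⟩
    refine ⟨h1.bracket h1', fun c hc => by
      simp [h2 c hc, h2' c hc, h1.zero, h1'.zero], (h3.union h3').subset ?_⟩
    intro i hi
    by_contra h
    rw [Set.mem_union, not_or] at h
    have h4 := not_not.1 h.1
    have h5 := not_not.1 h.2
    exact hi ⟨fun x hx => sub_mem (h4.1 _ (h5.1 x hx)) (h5.1 _ (h4.1 x hx)),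
      fun x hx => sub_mem (h4.2 _ (h5.2 x hx)) (h5.2 _ (h4.2 x hx))⟩
  sub := fun _ h => h.1
  alg := fun _ h => h.2
  mem_E := fun _ => mem_algConstants fun θ (h : θ ∈ thetaModule k₀ O M hOM hfin) => h.1
  fin := hfg

theorem AlgFoliation.mem_of_isAlgebraic [CharZero F] {k₀ : Subfield F} {L : Submodule F (F → F)}
    {𝒯 : Set (F → F)} {E : Subfield F} (H : AlgFoliation k₀ L 𝒯 E) {x : F}
    (hx : IsAlgebraic E x) : x ∈ E :=
  (H.mem_E x).2 fun θ hθ => (H.der θ (H.sub hθ)).eq_zero_of_isAlgebraic E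
    (fun e he => (H.mem_E e).1 he θ hθ) hx

theorem algConstants_le [CharZero F] {L : Submodule F (F → F)}
    (hL : ∀ θ ∈ L, IsDer (RingHom.id F) θ) {G : Subfield F}
    (hG : ∀ x, IsAlgebraic G x → x ∈ G)
    (hGL : ∀ θ, IsDer (RingHom.id F) θ → (∀ e ∈ G, θ e = 0) → θ ∈ L) : algConstants L ≤ G := by
  intro x hx
  by_contra hxG
  have htr : Transcendental G x := fun h => hxG (hG x h)
  have hind : AlgebraicIndepOn G id ({x} : Set F) :=
    (algebraicIndependent_singleton_iff (⟨x, rfl⟩ : ({x} : Set F))).2 htr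
  obtain ⟨s, hs, hb⟩ := exists_isTranscendenceBasis_superset hind
  obtain ⟨θ, h1, h2, h3, h4⟩ := exists_dual_derivation G hb.1 ⟨x, hs rfl⟩
  have hθ : θ ∈ algElements L := ⟨hGL θ h1 h2, _, isAlgDer_of_isTranscendenceBasis hb h2 h3 h4⟩
  have := (mem_algConstants hL).1 hx θ hθ
  rw [this] at h3
  exact zero_ne_one h3

end Theta

section Seidenberg

theorem IsDer.mem_of_mem_minimalPrimes {B : Type*} [CommRing B] [Algebra ℚ B] {D : B → B}
    (hD : IsDer (RingHom.id B) D) {I Q : Ideal B} (hI : ∀ b ∈ I, D b ∈ I)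
    (hQ : Q ∈ I.minimalPrimes) {f : B} (hf : f ∈ Q) : D f ∈ Q := by
  have hp : Q.IsPrime := hQ.1.1
  have hex : ∃ n : ℕ, ∃ s, s ∉ Q ∧ s * f ^ n ∈ I := by
    have h1 := IsLocalization.AtPrime.radical_map_of_mem_minimalPrimes (Localization.AtPrime Q) Q I
        hQ
    have h2 : algebraMap B (Localization.AtPrime Q) f ∈
        (Ideal.map (algebraMap B (Localization.AtPrime Q)) I).radical := by
      rw [h1]; exact Ideal.mem_map_of_mem _ hf
    obtain ⟨n, hn⟩ := h2
    rw [← map_pow, IsLocalization.algebraMap_mem_map_algebraMap_iff Q.primeCompl] at hn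
    obtain ⟨s, hs, hsf⟩ := hn
    exact ⟨n, s, hs, hsf⟩
  classical
  obtain ⟨s, hs, hsf⟩ := Nat.find_spec hex
  rcases hn : Nat.find hex with _ | n
  · rw [hn, pow_zero, mul_one] at hsf
    exact absurd (hQ.1.2 hsf) hs
  · by_contra hDf
    rw [hn] at hsf
    have h3 : s * D (s * f ^ (n + 1)) ∈ I := I.mul_mem_left _ (hI _ hsf)
    rw [hD.mul, hD.pow] at h3
    simp only [RingHom.id_apply, Nat.add_sub_cancel] at h3
    have h4 : ((n + 1 : ℕ) : B) * (s * s * D f * f ^ n) ∈ I := by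
      have h5 : D s * (s * f ^ (n + 1)) ∈ I := I.mul_mem_left _ hsf
      have := I.sub_mem h3 h5
      convert this using 1
      ring
    have h6 : s * s * D f * f ^ n ∈ I := by
      have := I.mul_mem_left (algebraMap ℚ B ((n + 1 : ℕ) : ℚ)⁻¹) h4
      rw [← mul_assoc, ← map_natCast (algebraMap ℚ B), ← map_mul, inv_mul_cancel₀ (by positivity),
        map_one, one_mul] at this
      exact this
    refine Nat.find_min hex (m := n) (by omega) ⟨s * s * D f, ?_, h6⟩
    intro h7
    rcases hp.mem_or_mem h7 with h8 | h8
    · rcases hp.mem_or_mem h8 with h9 | h9 <;> exact hs h9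
    · exact hDf h8

end Seidenberg

section TensorDer

variable {k K A : Type*} [Field k] [CommRing K] [Algebra k K] [CommRing A] [Algebra k A]

theorem IsDer.lTensor {N : Type*} [CommRing N] [Algebra k N] {j : A →ₐ[k] N} {D : A →ₗ[k] N}
    (hD : IsDer j.toRingHom D) :
    IsDer (Algebra.TensorProduct.map (AlgHom.id k K) j).toRingHom
      (LinearMap.lTensor K D) := by
  refine ⟨fun x y => map_add _ _ _, fun x y => ?_⟩
  induction x with
  | zero => simp
  | add x₁ x₂ h₁ h₂ => rw [add_mul, map_add, h₁, h₂, map_add, map_add]; ring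
  | tmul a b =>
    induction y with
    | zero => simp
    | add x₁ x₂ h₁ h₂ => rw [mul_add, map_add, h₁, h₂, map_add, map_add]; ring
    | tmul c d =>
      have h : D (b * d) = j b * D d + j d * D b := hD.mul b d
      simp [h, TensorProduct.tmul_add, mul_comm]

end TensorDer

section Away

theorem isAwayHom_algebraMap {A B : Type*} [CommRing A] [CommRing B] [Algebra A B] (b : A)
    [h : IsLocalization.Away b B] : IsAwayHom (algebraMap A B) b := by
  have : (algebraMap A B).toAlgebra = (inferInstance : Algebra A B) :=
      Algebra.algebra_ext _ _ fun _ => rfl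
  unfold IsAwayHom
  rw [this]
  exact h

theorem IsAwayHom.isDomain {A B : Type*} [CommRing A] [CommRing B] [IsDomain A] {g : A →+* B}
    {b : A}
    (h : IsAwayHom g b) (hb : b ≠ 0) : IsDomain B := by
  let := g.toAlgebra
  have : IsLocalization.Away b B := h
  exact IsLocalization.isDomain_of_le_nonZeroDivisors B
    (powers_le_nonZeroDivisors_of_noZeroDivisors hb)

variable {k : Type*} [Field k] {A : Type*} [CommRing A] [Algebra k A]

theorem includeRight_inj : Function.Injective
    (Algebra.TensorProduct.includeRight : A →ₐ[k] AlgebraicClosure k ⊗[k] A) :=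
  Algebra.TensorProduct.includeRight_injective (algebraMap k (AlgebraicClosure k)).injective

theorem one_tmul_ne_zero {a : A} (ha : a ≠ 0) : (1 : AlgebraicClosure k) ⊗ₜ[k] a ≠ 0 := fun h =>
  ha (includeRight_inj (k := k) (by simpa using h))

/-- The base change of `A → A_r` inverts `1 ⊗ r`. -/
theorem isAwayHom_baseChange_away (r : A) :
    IsAwayHom (baseChange k (IsScalarTower.toAlgHom k A (Localization.Away r))) (1 ⊗ₜ r) :=
  baseChange_isAwayHom (isAwayHom_algebraMap r)

theorem isDomain_tensor_away [IsDomain (AlgebraicClosure k ⊗[k] A)] {r : A} (hr : r ≠ 0) :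
    IsDomain (AlgebraicClosure k ⊗[k] Localization.Away r) :=
  (isAwayHom_baseChange_away r).isDomain (one_tmul_ne_zero hr)

theorem isDomain_away [IsDomain A] {r : A} (hr : r ≠ 0) : IsDomain (Localization.Away r) :=
  (isAwayHom_algebraMap (B := Localization.Away r) r).isDomain hr

theorem exists_awayEmb [IsDomain A] {r : A} (hr : r ≠ 0) :
    ∃ ι : Localization.Away r →+* FractionRing A,
    ι.comp (algebraMap A (Localization.Away r)) = algebraMap A (FractionRing A) := by
  have hu : IsUnit (algebraMap A (FractionRing A) r) := by
    rw [isUnit_iff_ne_zero]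
    exact fun h => hr ((FaithfulSMul.algebraMap_injective A (FractionRing A)) (by simpa using h))
  exact ⟨IsLocalization.Away.lift r hu, IsLocalization.Away.lift_comp r hu⟩

theorem awayEmb_unique [IsDomain A] {r : A} {ι ι' : Localization.Away r →+* FractionRing A}
    (h : ι.comp (algebraMap A (Localization.Away r)) = algebraMap A (FractionRing A))
    (h' : ι'.comp (algebraMap A (Localization.Away r)) = algebraMap A (FractionRing A)) : ι = ι' :=
  IsLocalization.ringHom_ext (Submonoid.powers r) (h.trans h'.symm)

theorem awayEmb_injective [IsDomain A] {r : A} {ι : Localization.Away r →+* FractionRing A}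
    (h : ι.comp (algebraMap A (Localization.Away r)) = algebraMap A (FractionRing A)) :
    Function.Injective ι := by
  rw [injective_iff_map_eq_zero]
  intro x hx
  obtain ⟨⟨a, b⟩, hb⟩ := IsLocalization.surj (Submonoid.powers r) x
  have h1 := congrArg ι hb
  rw [map_mul, hx, zero_mul] at h1
  have h2 : algebraMap A (FractionRing A) a = 0 := by rw [← h]; exact h1.symm
  have h3 : a = 0 := (FaithfulSMul.algebraMap_injective A (FractionRing A)) (by simpa using h2)
  rw [h3, map_zero] at hb
  exact (IsUnit.mul_left_eq_zero (IsLocalization.map_units _ b)).1 hb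

end Away

section LocalSub

variable {X F : Type*} [CommRing X] [Field F] [Algebra X F]

/-- The local ring at a prime `q`, as a subring of the fraction field. -/
def locO (F : Type*) [Field F] [Algebra X F] (q : Ideal X) (hq : q.IsPrime) : Subring F where
  carrier := {x | ∃ a b : X, b ∉ q ∧ x * algebraMap X F b = algebraMap X F a}
  zero_mem' := ⟨0, 1, fun h => hq.ne_top ((Ideal.eq_top_iff_one q).2 h), by simp⟩
  one_mem' := ⟨1, 1, fun h => hq.ne_top ((Ideal.eq_top_iff_one q).2 h), by simp⟩
  add_mem' := by
    rintro x y ⟨a, b, hb, h⟩ ⟨c, d, hd, h'⟩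
    refine ⟨a * d + c * b, b * d, fun h => (hq.mem_or_mem h).elim hb hd, ?_⟩
    simp only [map_mul, map_add, ← h, ← h']
    ring
  mul_mem' := by
    rintro x y ⟨a, b, hb, h⟩ ⟨c, d, hd, h'⟩
    refine ⟨a * c, b * d, fun h => (hq.mem_or_mem h).elim hb hd, ?_⟩
    simp only [map_mul, ← h, ← h']
    ring
  neg_mem' := by
    rintro x ⟨a, b, hb, h⟩
    exact ⟨-a, b, hb, by simp [h]⟩

/-- The maximal ideal of the local ring at a prime `q`, as a subset of the fraction field. -/
def locM (F : Type*) [Field F] [Algebra X F] (q : Ideal X) (hq : q.IsPrime) : AddSubgroup F where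
  carrier := {x | ∃ a b : X, a ∈ q ∧ b ∉ q ∧ x * algebraMap X F b = algebraMap X F a}
  zero_mem' := ⟨0, 1, q.zero_mem, fun h => hq.ne_top ((Ideal.eq_top_iff_one q).2 h), by simp⟩
  add_mem' := by
    rintro x y ⟨a, b, ha, hb, h⟩ ⟨c, d, hc, hd, h'⟩
    refine ⟨a * d + c * b, b * d, q.add_mem (q.mul_mem_right _ ha) (q.mul_mem_right _ hc),
      fun h => (hq.mem_or_mem h).elim hb hd, ?_⟩
    simp only [map_mul, map_add, ← h, ← h']
    ring
  neg_mem' := by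
    rintro x ⟨a, b, ha, hb, h⟩
    exact ⟨-a, b, q.neg_mem ha, hb, by simp [h]⟩

theorem locO_mul_locM {q : Ideal X} (hq : q.IsPrime) {x y : F} (hx : x ∈ locO F q hq)
    (hy : y ∈ locM F q hq) : x * y ∈ locM F q hq := by
  obtain ⟨a, b, hb, h⟩ := hx
  obtain ⟨c, d, hc, hd, h'⟩ := hy
  refine ⟨a * c, b * d, q.mul_mem_left _ hc, fun h => (hq.mem_or_mem h).elim hb hd, ?_⟩
  simp only [map_mul, ← h, ← h']
  ring

theorem algebraMap_mem_locO {q : Ideal X} (hq : q.IsPrime) (a : X) :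
    algebraMap X F a ∈ locO F q hq :=
  ⟨a, 1, fun h => hq.ne_top ((Ideal.eq_top_iff_one q).2 h), by simp⟩

theorem algebraMap_mem_locM {q : Ideal X} (hq : q.IsPrime) {a : X} (ha : a ∈ q) :
    algebraMap X F a ∈ locM F q hq :=
  ⟨a, 1, ha, fun h => hq.ne_top ((Ideal.eq_top_iff_one q).2 h), by simp⟩

theorem inv_mem_locO [FaithfulSMul X F] {q : Ideal X} (hq : q.IsPrime) {a : X} (ha : a ∉ q) :
    (algebraMap X F a)⁻¹ ∈ locO F q hq := by
  refine ⟨1, a, ha, ?_⟩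
  rw [map_one, inv_mul_cancel₀]
  intro h
  rw [FaithfulSMul.algebraMap_eq_zero_iff] at h
  exact ha (h ▸ q.zero_mem)

theorem IsDer.loc_mem [FaithfulSMul X F] {q : Ideal X} (hq : q.IsPrime) {d : F → F}
    (hd : IsDer (RingHom.id F) d)
    (h : ∀ a : X, ∃ a', d (algebraMap X F a) = algebraMap X F a' ∧ (a ∈ q → a' ∈ q)) :
    (∀ x ∈ locO F q hq, d x ∈ locO F q hq) ∧ ∀ x ∈ locM F q hq, d x ∈ locM F q hq := by
  have key : ∀ x : F, ∀ a b : X, b ∉ q → x * algebraMap X F b = algebraMap X F a →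
      d x = (algebraMap X F b)⁻¹ * (d (algebraMap X F a) - x * d (algebraMap X F b)) := by
    intro x a b hb hx
    have hb0 : algebraMap X F b ≠ 0 := fun h0 => by
      rw [FaithfulSMul.algebraMap_eq_zero_iff] at h0
      exact hb (h0 ▸ q.zero_mem)
    rw [← hx, hd.mul]
    simp only [RingHom.id_apply]
    field_simp
    ring
  constructor
  · rintro x ⟨a, b, hb, hx⟩
    rw [key x a b hb hx]
    obtain ⟨a', ha', -⟩ := h a
    obtain ⟨b', hb', -⟩ := h b
    rw [ha', hb']
    exact mul_mem (inv_mem_locO hq hb) (sub_mem (algebraMap_mem_locO hq _)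
      (mul_mem ⟨a, b, hb, hx⟩ (algebraMap_mem_locO hq _)))
  · rintro x ⟨a, b, ha, hb, hx⟩
    rw [key x a b hb hx]
    obtain ⟨a', ha', haq⟩ := h a
    obtain ⟨b', hb', -⟩ := h b
    rw [ha', hb']
    refine locO_mul_locM hq (inv_mem_locO hq hb) (sub_mem (algebraMap_mem_locM hq (haq ha)) ?_)
    rw [mul_comm]
    exact locO_mul_locM hq (algebraMap_mem_locO hq _) ⟨a, b, ha, hb, hx⟩

end LocalSub

section ThetaS

variable (k : Type) [Field k] {X : Type} [CommRing X] [IsDomain X] [Algebra k X]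
  [Algebra.FiniteType k X] [IsDomain (AlgebraicClosure k ⊗[k] X)]
  {S : Set (Ideal (AlgebraicClosure k ⊗[k] X))} (hS : ∀ P ∈ S, HeightOnePrime P)

/-- The trace on `X` of an ideal of `K ⊗ X`. -/
noncomputable def trace {k : Type} [Field k] {X : Type} [CommRing X] [Algebra k X]
    (Q : Ideal (AlgebraicClosure k ⊗[k] X)) : Ideal X :=
  Q.comap (Algebra.TensorProduct.includeRight : X →ₐ[k] AlgebraicClosure k ⊗[k] X)

theorem trace_isPrime {k : Type} [Field k] {X : Type} [CommRing X] [Algebra k X]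
    {Q : Ideal (AlgebraicClosure k ⊗[k] X)} (h : HeightOnePrime Q) : (trace Q).IsPrime :=
  have := h.1
  Ideal.comap_isPrime _ Q

omit [IsDomain X] in
theorem finite_mem_trace {b : X} (hb : b ≠ 0) :
    {Q : Ideal (AlgebraicClosure k ⊗[k] X) | HeightOnePrime Q ∧ b ∈ trace Q}.Finite :=
  finite_heightOnePrime_mem (one_tmul_ne_zero hb)

/-- The derivations of the function field preserving almost all members of `S`. -/
noncomputable def thetaS : Submodule (FractionRing X) (FractionRing X → FractionRing X) :=
  thetaModule (algebraMap k (FractionRing X)).fieldRange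
    (fun Q : S => locO (FractionRing X) (trace Q.1) (trace_isPrime (hS _ Q.2)))
    (fun Q : S => locM (FractionRing X) (trace Q.1) (trace_isPrime (hS _ Q.2)))
    (fun _ _ h _ h' => locO_mul_locM _ h h')
    (fun f => by
      obtain ⟨a, b, hb, rfl⟩ := IsFractionRing.div_surjective (A := X) f
      refine Set.Finite.of_finite_image (f := Subtype.val)
        ((finite_mem_trace k (nonZeroDivisors.ne_zero hb)).subset ?_) Subtype.val_injective.injOn
      rintro _ ⟨Q, hQ, rfl⟩
      refine ⟨hS _ Q.2, ?_⟩
      by_contra hbQ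
      apply hQ
      rw [div_eq_mul_inv]
      exact mul_mem (algebraMap_mem_locO _ _) (inv_mem_locO _ hbQ))

theorem mem_thetaS {θ : FractionRing X → FractionRing X} : θ ∈ thetaS k hS ↔
    IsDer (RingHom.id _) θ ∧ (∀ c : k, θ (algebraMap k _ c) = 0) ∧
    {Q : S | ¬ ((∀ x ∈ locO (FractionRing X) (trace Q.1) (trace_isPrime (hS _ Q.2)),
        θ x ∈ locO (FractionRing X) (trace Q.1) (trace_isPrime (hS _ Q.2))) ∧
      ∀ x ∈ locM (FractionRing X) (trace Q.1) (trace_isPrime (hS _ Q.2)),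
        θ x ∈ locM (FractionRing X) (trace Q.1) (trace_isPrime (hS _ Q.2)))}.Finite := by
  have : (∀ c ∈ (algebraMap k (FractionRing X)).fieldRange, θ c = 0) ↔
      (∀ c : k, θ (algebraMap k _ c) = 0) := by
    simp [RingHom.mem_fieldRange]
  rw [← this]
  rfl

theorem algFoliation_thetaS :
    AlgFoliation (algebraMap k (FractionRing X)).fieldRange (thetaS k hS)
      (algElements (thetaS k hS)) (algConstants (thetaS k hS)) := by
  refine algFoliation_thetaModule _ _ _ _ _ ?_
  obtain ⟨s, hs⟩ := (Algebra.FiniteType.out : (⊤ : Subalgebra k X).FG)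
  refine ⟨s.card, fun i => algebraMap X _ (s.equivFin.symm i : X), ?_⟩
  intro M _ j η hη hk hz
  have h1 : ∀ a : X, η (algebraMap X _ a) = 0 := by
    intro a
    have ha : a ∈ Algebra.adjoin k (s : Set X) := hs ▸ Algebra.mem_top
    induction ha using Algebra.adjoin_induction with
    | mem x hx =>
      have := hz (s.equivFin ⟨x, hx⟩)
      simpa using this
    | algebraMap c =>
      rw [← IsScalarTower.algebraMap_apply]
      exact hk _ ⟨c, rfl⟩
    | add x y _ _ hx hy => rw [map_add, hη.add, hx, hy, add_zero]
    | mul x y _ _ hx hy => rw [map_mul, hη.mul, hx, hy, mul_zero, mul_zero, add_zero]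
  intro x
  obtain ⟨a, b, hb, rfl⟩ := IsFractionRing.div_surjective (A := X) x
  rw [div_eq_mul_inv, hη.mul, hη.inv, h1, h1]
  simp

end ThetaS

section Restrict

variable {k : Type} [Field k] {X : Type} [CommRing X] [IsDomain X] [Algebra k X]

/-- A derivation of the function field becomes regular after scaling. -/
theorem IsDer.exists_scaling [Algebra.FiniteType k X] {D : FractionRing X → FractionRing X}
    (hD : IsDer (RingHom.id _) D) (hk : ∀ c : k, D (algebraMap k _ c) = 0) :
    ∃ c : X, c ≠ 0 ∧ ∀ a : X, ∃ a' : X,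
      algebraMap X _ c * D (algebraMap X _ a) = algebraMap X _ a' := by
  classical
  obtain ⟨s, hs⟩ := (Algebra.FiniteType.out : (⊤ : Subalgebra k X).FG)
  obtain ⟨b, hb⟩ := IsLocalization.exist_integer_multiples_of_finset (nonZeroDivisors X)
    (s.image fun a => D (algebraMap X (FractionRing X) a))
  refine ⟨b, nonZeroDivisors.ne_zero b.2, fun a => ?_⟩
  have ha : a ∈ Algebra.adjoin k (s : Set X) := hs ▸ Algebra.mem_top
  induction ha using Algebra.adjoin_induction with
  | mem x hx =>
    obtain ⟨a', ha'⟩ := hb _ (Finset.mem_image_of_mem _ hx)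
    refine ⟨a', ?_⟩
    rw [ha']
    exact (Algebra.smul_def _ _).symm
  | algebraMap c =>
    refine ⟨0, ?_⟩
    rw [← IsScalarTower.algebraMap_apply, hk]
    simp
  | add x y _ _ hx hy =>
    obtain ⟨x', hx⟩ := hx
    obtain ⟨y', hy⟩ := hy
    exact ⟨x' + y', by rw [map_add, hD.add, mul_add, hx, hy, map_add]⟩
  | mul x y _ _ hx hy =>
    obtain ⟨x', hx⟩ := hx
    obtain ⟨y', hy⟩ := hy
    refine ⟨x * y' + y * x', ?_⟩
    rw [map_mul, hD.mul, map_add, map_mul, map_mul, ← hx, ← hy]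
    simp only [RingHom.id_apply]
    ring

/-- A derivation of the function field preserving `X` restricts to any `X_r`. -/
theorem IsDer.exists_restrict {r : X} {d : FractionRing X → FractionRing X}
    (hd : IsDer (RingHom.id _) d) (hk : ∀ c : k, d (algebraMap k _ c) = 0)
    (h : ∀ a : X, ∃ a' : X, d (algebraMap X _ a) = algebraMap X _ a')
    {ι : Localization.Away r →+* FractionRing X}
    (hι : ι.comp (algebraMap X (Localization.Away r)) = algebraMap X (FractionRing X)) :
    ∃ D : Localization.Away r →ₗ[k] Localization.Away r, IsDer (RingHom.id _) D ∧
      ∀ x, ι (D x) = d (ι x) := by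
  have hinj := awayEmb_injective hι
  have hιa : ∀ a, ι (algebraMap X _ a) = algebraMap X _ a := fun a => by rw [← hι]; rfl
  have hιk : ∀ c : k, ι (algebraMap k _ c) = algebraMap k _ c := fun c => by
    rw [IsScalarTower.algebraMap_apply k X, hιa, ← IsScalarTower.algebraMap_apply]
  have hex : ∀ x, ∃ y, ι y = d (ι x) := by
    intro x
    obtain ⟨⟨a, b⟩, hb⟩ := IsLocalization.surj (Submonoid.powers r) x
    obtain ⟨a', ha'⟩ := h a
    obtain ⟨b', hb'⟩ := h b
    obtain ⟨u, hu⟩ := IsLocalization.map_units (Localization.Away r) b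
    have h1 := congrArg (fun z => d (ι z)) hb
    simp only [map_mul] at h1
    rw [hd.mul, hιa, hιa, ha', hb'] at h1
    simp only [RingHom.id_apply] at h1
    refine ⟨↑u⁻¹ * (algebraMap X _ a' - x * algebraMap X _ b'), ?_⟩
    have h2 : ι (↑u⁻¹) * algebraMap X (FractionRing X) b = 1 := by
      rw [← hιa, ← hu, ← map_mul, Units.inv_mul, map_one]
    rw [map_mul, map_sub, map_mul, hιa, hιa, ← h1, add_sub_cancel_left, ← mul_assoc, h2, one_mul]
  choose D hDι using hex
  refine ⟨⟨⟨D, fun x y => hinj ?_⟩, fun c x => hinj ?_⟩, ⟨fun x y => hinj ?_, fun x y => hinj ?_⟩,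
      hDι⟩
  · rw [hDι, map_add, hd.add, map_add, hDι, hDι]
  · rw [RingHom.id_apply, Algebra.smul_def, Algebra.smul_def, hDι, map_mul, map_mul, hd.mul, hDι,
      hιk, hk]
    simp
  · change ι (D _) = ι (D _ + D _)
    rw [hDι, map_add, hd.add, map_add, hDι, hDι]
  · change ι (D _) = ι (x * D _ + y * D _)
    rw [hDι, map_mul, hd.mul, map_add, map_mul, map_mul, hDι, hDι]
    rfl

end Restrict

section Morphism

variable {k : Type} [Field k] [CharZero k] {X : Type} [CommRing X] [IsDomain X] [Algebra k X]
  [Algebra.FiniteType k X] [IsDomain (AlgebraicClosure k ⊗[k] X)]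
  {S : Set (Ideal (AlgebraicClosure k ⊗[k] X))} (hS : ∀ P ∈ S, HeightOnePrime P)

theorem IsDer.mem_of_mem_PTset {A Y : Type} [CommRing A] [Algebra k A] [CommRing Y] [Algebra k Y]
    {f : Y →ₐ[k] A} {D : A →ₗ[k] A} (hD : IsDer (RingHom.id A) D) (hf : ∀ y, D (f y) = 0)
    {t : Ideal (AlgebraicClosure k ⊗[k] Y)} {Q : Ideal (AlgebraicClosure k ⊗[k] A)}
    (hQ : Q ∈ PTset (baseChange k f) t) {a : A} (ha : 1 ⊗ₜ a ∈ Q) : 1 ⊗ₜ D a ∈ Q := by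
  have hD' : IsDer (RingHom.id _) (LinearMap.lTensor (AlgebraicClosure k) D) := by
    have := IsDer.lTensor (K := AlgebraicClosure k) (j := AlgHom.id k A) hD
    rw [Algebra.TensorProduct.map_id] at this
    exact this
  have h0 : ∀ z, LinearMap.lTensor (AlgebraicClosure k) D (baseChange k f z) = 0 := by
    intro z
    induction z with
    | zero => simp
    | add x y hx hy => rw [map_add, map_add, hx, hy, add_zero]
    | tmul a b => simp [baseChange, hf]
  have : CharZero (AlgebraicClosure k) := charZero_of_injective_algebraMap
    (algebraMap k (AlgebraicClosure k)).injective
  let : Algebra ℚ (AlgebraicClosure k ⊗[k] A) :=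
    ((algebraMap (AlgebraicClosure k) (AlgebraicClosure k ⊗[k] A)).comp
      (algebraMap ℚ (AlgebraicClosure k))).toAlgebra
  have hpres : ∀ b ∈ t.map (baseChange k f),
      LinearMap.lTensor (AlgebraicClosure k) D b ∈ t.map (baseChange k f) := by
    intro b hb
    rw [Ideal.map] at hb
    induction hb using Submodule.span_induction with
    | mem x hx =>
      obtain ⟨y, -, rfl⟩ := hx
      rw [h0]
      exact zero_mem _
    | zero => simp
    | add x y _ _ hx hy => rw [map_add]; exact add_mem hx hy
    | smul a x hx ih =>
      rw [smul_eq_mul, hD'.mul]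
      exact add_mem (Ideal.mul_mem_left _ _ ih) (Ideal.mul_mem_right _ _ hx)
  have := hD'.mem_of_mem_minimalPrimes hpres hQ.1 ha
  simpa using this

theorem IsVMor.mem_thetaS {Y : Type} [CommRing Y] [Algebra k Y]
    {T : Set (Ideal (AlgebraicClosure k ⊗[k] Y))} {r : X} (hr : r ≠ 0)
    {φ : Y →ₐ[k] Localization.Away r} (hφ : IsVMor k S T r φ)
    {ι : Localization.Away r →+* FractionRing X}
    (hι : ι.comp (algebraMap X (Localization.Away r)) = algebraMap X (FractionRing X))
    {θ : FractionRing X → FractionRing X} (hθ : IsDer (RingHom.id _) θ)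
    (h0 : ∀ y, θ (ι (φ y)) = 0) : θ ∈ thetaS k hS := by
  have hιa : ∀ a, ι (algebraMap X _ a) = algebraMap X _ a := fun a => by rw [← hι]; rfl
  have hk : ∀ c : k, θ (algebraMap k _ c) = 0 := fun c => by
    rw [← h0 (algebraMap k _ c), φ.commutes,
        IsScalarTower.algebraMap_apply k X (Localization.Away r),
      hιa, ← IsScalarTower.algebraMap_apply]
  obtain ⟨c, hc, hcX⟩ := hθ.exists_scaling hk
  have hd := hθ.smul_map (algebraMap X (FractionRing X) c)
  obtain ⟨D, hD, hDι⟩ := hd.exists_restrict (k := k) (fun a => by simp [hk]) hcX hι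
  have hinj := awayEmb_injective hι
  have hD0 : ∀ y, D (φ y) = 0 := fun y => hinj (by rw [hDι, h0]; simp)
  have := isDomain_tensor_away (k := k) hr
  rw [_root_.mem_thetaS]
  refine ⟨hθ, hk, ?_⟩
  refine Set.Finite.of_finite_image (f := Subtype.val)
    (((hφ.2.2.image (Ideal.comap (baseChange k
      (IsScalarTower.toAlgHom k X (Localization.Away r))))).union
      ((finite_mem_trace k hr).union (finite_mem_trace k hc))).subset ?_)
    Subtype.val_injective.injOn
  rintro _ ⟨⟨Q, hQS⟩, hQ, rfl⟩
  by_contra hcon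
  simp only [Set.mem_union, not_or, Set.mem_ofPred_eq, not_and] at hcon
  obtain ⟨hcon, hrQ, hcQ⟩ := hcon
  have hQ1 := hS Q hQS
  have hrQ := hrQ hQ1
  have hcQ := hcQ hQ1
  apply hQ
  obtain ⟨Q', hQ', hQQ'⟩ := (isAwayHom_baseChange_away r).exists_heightOnePrime hQ1 hrQ
  have hPT : Q' ∈ ⋃ t ∈ T, PTset (baseChange k φ) t := by
    by_contra hn
    exact hcon ⟨Q', Or.inl ⟨⟨hQ', by rw [hQQ']; exact hQS⟩, hn⟩, hQQ'⟩
  simp only [Set.mem_iUnion] at hPT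
  obtain ⟨t, -, hPT⟩ := hPT
  have htr : ∀ a : X, a ∈ trace Q ↔ (1 : AlgebraicClosure k) ⊗ₜ algebraMap X (Localization.Away r) a
      ∈ Q' := by
    intro a
    rw [← hQQ']
    change baseChange k _ (1 ⊗ₜ a) ∈ Q' ↔ _
    simp [baseChange]
  have hloc := hd.loc_mem (trace_isPrime hQ1) (fun a => by
    obtain ⟨a', ha'⟩ := hcX a
    refine ⟨a', ha', fun haq => ?_⟩
    rw [htr] at haq ⊢
    have h1 := hD.mem_of_mem_PTset hD0 hPT haq
    have h2 : D (algebraMap X _ a) = algebraMap X _ a' := hinj (by rw [hDι, hιa, hιa, ha'])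
    rwa [h2] at h1)
  have hc0 : algebraMap X (FractionRing X) c ≠ 0 := fun h =>
    hc ((FaithfulSMul.algebraMap_injective X (FractionRing X)) (by simpa using h))
  have hθd : ∀ x, θ x =
      (algebraMap X (FractionRing X) c)⁻¹ * (algebraMap X (FractionRing X) c * θ x) :=
    fun x => by field_simp
  refine ⟨fun x hx => ?_, fun x hx => ?_⟩
  · rw [hθd]
    exact mul_mem (inv_mem_locO _ hcQ) (hloc.1 x hx)
  · rw [hθd]
    exact locO_mul_locM _ (inv_mem_locO _ hcQ) (hloc.2 x hx)

end Morphism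

section Slice

variable {k : Type} [Field k] {A B : Type} [CommRing A] [Algebra k A] [CommRing B] [Algebra k B]

/-- The slice of a tensor along a linear form on `K`. -/
noncomputable def slice (A : Type) [CommRing A] [Algebra k A] (l : AlgebraicClosure k →ₗ[k] k) :
    AlgebraicClosure k ⊗[k] A →ₗ[k] A :=
  (TensorProduct.lid k A).toLinearMap ∘ₗ LinearMap.rTensor A l

@[simp]
theorem slice_tmul (l : AlgebraicClosure k →ₗ[k] k) (x : AlgebraicClosure k) (a : A) :
    slice A l (x ⊗ₜ a) = l x • a := by
  simp [slice]

theorem slice_one_tmul_mul (l : AlgebraicClosure k →ₗ[k] k) (a : A)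
    (z : AlgebraicClosure k ⊗[k] A) : slice A l ((1 ⊗ₜ a) * z) = a * slice A l z := by
  induction z with
  | zero => simp
  | add x y hx hy => rw [mul_add, map_add, hx, hy, map_add, mul_add]
  | tmul x y => simp

theorem slice_baseChange (l : AlgebraicClosure k →ₗ[k] k) (f : A →ₐ[k] B)
    (z : AlgebraicClosure k ⊗[k] A) : slice B l (baseChange k f z) = f (slice A l z) := by
  induction z with
  | zero => simp
  | add x y hx hy => rw [map_add, map_add, hx, hy, map_add, map_add]
  | tmul x y => simp [baseChange]

theorem slice_lTensor (l : AlgebraicClosure k →ₗ[k] k) (f : A →ₗ[k] B)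
    (z : AlgebraicClosure k ⊗[k] A) :
    slice B l (LinearMap.lTensor (AlgebraicClosure k) f z) = f (slice A l z) := by
  induction z with
  | zero => simp
  | add x y hx hy => rw [map_add, map_add, hx, hy, map_add, map_add]
  | tmul x y => simp

theorem exists_eq_sum_slice (z : AlgebraicClosure k ⊗[k] A) :
    ∃ s : Finset (AlgebraicClosure k × (AlgebraicClosure k →ₗ[k] k)),
      z = ∑ i ∈ s, i.1 ⊗ₜ slice A i.2 z := by
  classical
  let ℬ := Module.Basis.ofVectorSpace k (AlgebraicClosure k)
  have h := (TensorProduct.equivFinsuppOfBasisLeft (N := A) ℬ).symm_apply_apply z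
  rw [TensorProduct.equivFinsuppOfBasisLeft_symm_apply, Finsupp.sum] at h
  refine ⟨(TensorProduct.equivFinsuppOfBasisLeft (N := A) ℬ z).support.image
    fun i => (ℬ i, ℬ.coord i), ?_⟩
  rw [Finset.sum_image fun i _ j _ hij => ℬ.injective (congrArg Prod.fst hij)]
  refine h.symm.trans (Finset.sum_congr rfl fun i _ => ?_)
  rw [TensorProduct.equivFinsuppOfBasisLeft_apply]
  rfl

theorem exists_slice_ne_zero {z : AlgebraicClosure k ⊗[k] A} (hz : z ≠ 0) :
    ∃ l, slice A l z ≠ 0 := by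
  by_contra h
  push Not at h
  obtain ⟨s, hs⟩ := exists_eq_sum_slice z
  apply hz
  rw [hs]
  exact Finset.sum_eq_zero fun i _ => by rw [h, TensorProduct.tmul_zero]

/-- A tensor whose slices are fractions over `A` is itself a fraction over `K ⊗ A`. -/
theorem exists_clear_denominators [IsDomain A] (f : A →ₐ[k] B) {z : AlgebraicClosure k ⊗[k] B}
    (h : ∀ l, ∃ d : A, d ≠ 0 ∧ ∃ c, f d * slice B l z = f c) :
    ∃ d : A, d ≠ 0 ∧ ∃ c, (1 ⊗ₜ f d) * z = baseChange k f c := by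
  obtain ⟨s, hs⟩ := exists_eq_sum_slice z
  have key : ∀ s : Finset (AlgebraicClosure k × (AlgebraicClosure k →ₗ[k] k)),
      ∃ d : A, d ≠ 0 ∧ ∃ c, (1 ⊗ₜ f d) * (∑ i ∈ s, i.1 ⊗ₜ slice B i.2 z) = baseChange k f c := by
    classical
    intro s
    induction s using Finset.induction_on with
    | empty => exact ⟨1, one_ne_zero, 0, by simp⟩
    | insert i s hi ih =>
      obtain ⟨d, hd, c, hc⟩ := ih
      obtain ⟨d', hd', c', hc'⟩ := h i.2
      refine ⟨d * d', mul_ne_zero hd hd', i.1 ⊗ₜ (d * c') + (1 ⊗ₜ d') * c, ?_⟩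
      have h1 : (1 : AlgebraicClosure k) ⊗ₜ[k] f d' = baseChange k f (1 ⊗ₜ d') := by
        simp [baseChange]
      rw [Finset.sum_insert hi, mul_add, map_add, map_mul (baseChange k f), ← hc, ← h1]
      congr 1
      · simp only [baseChange, AlgHom.toRingHom_eq_coe, RingHom.coe_coe,
          Algebra.TensorProduct.map_tmul, Algebra.TensorProduct.tmul_mul_tmul, map_mul, ← hc',
          AlgHom.coe_id, id_eq, one_mul, mul_assoc]
      · rw [← mul_assoc, Algebra.TensorProduct.tmul_mul_tmul, one_mul, map_mul, mul_comm (f d)]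
  obtain ⟨d, hd, c, hc⟩ := key s
  exact ⟨d, hd, c, by rwa [← hs] at hc⟩

end Slice

section Down

variable {k : Type} [Field k]

/-- Relative algebraic closedness over `K` descends to `k`. -/
theorem mem_of_fracRelAlgClosedVia {A Y F : Type} [CommRing A] [Algebra k A] [CommRing Y]
    [Algebra k Y]
    [Field F] {f : Y →ₐ[k] A} (hf : FracRelAlgClosedVia (baseChange k f))
    {ι : A →+* F} (hι : Function.Injective ι) (hfrac : ∀ x : F, ∃ a b : A, b ≠ 0 ∧ x = ι a / ι b)
    {x : F} {p : Polynomial Y} (hp : p ≠ 0) (hx : p.eval₂ (ι.comp f.toRingHom) x = 0) :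
    ∃ c d : Y, d ≠ 0 ∧ x * ι (f d) = ι (f c) := by
  obtain ⟨a, b, hb, rfl⟩ := hfrac x
  have hb' : ι b ≠ 0 := fun h => hb (hι (by rw [h, map_zero]))
  let j : Y →+* AlgebraicClosure k ⊗[k] Y :=
      (Algebra.TensorProduct.includeRight : Y →ₐ[k] _).toRingHom
  have hj : Function.Injective j := includeRight_inj
  have hsum : ∑ i ∈ Finset.range (p.natDegree + 1),
      f (p.coeff i) * a ^ i * b ^ (p.natDegree - i) = 0 := by
    apply hι
    rw [Polynomial.eval₂_eq_sum_range] at hx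
    rw [map_zero, map_sum, ← mul_zero (ι b ^ p.natDegree), ← hx, Finset.mul_sum]
    refine Finset.sum_congr rfl fun i hi => ?_
    rw [Finset.mem_range, Nat.lt_succ_iff] at hi
    simp only [map_mul, map_pow, RingHom.comp_apply, AlgHom.toRingHom_eq_coe, RingHom.coe_coe,
        div_pow]
    field_simp
    rw [mul_assoc, ← pow_add, Nat.sub_add_cancel hi]
  obtain ⟨c, d, hd, hcd⟩ := hf (1 ⊗ₜ a) (1 ⊗ₜ b) (one_tmul_ne_zero hb) ⟨p.map j,
    (Polynomial.map_ne_zero_iff hj).2 hp, by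
      rw [Polynomial.natDegree_map_eq_of_injective hj]
      have := congrArg (Algebra.TensorProduct.includeRight : A →ₐ[k] AlgebraicClosure k ⊗[k] A) hsum
      rw [map_zero, map_sum] at this
      rw [← this]
      refine Finset.sum_congr rfl fun i _ => ?_
      simp [j, baseChange]⟩
  obtain ⟨l, hl⟩ := exists_slice_ne_zero hd
  refine ⟨slice Y l c, slice Y l d, hl, ?_⟩
  have := congrArg (fun z => ι (slice A l z)) hcd
  simp only [slice_one_tmul_mul, slice_baseChange, map_mul] at this
  rw [div_mul_eq_mul_div, this, mul_div_cancel_left₀ _ hb']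

end Down

section Up

variable {k : Type} [Field k] {X : Type} [CommRing X] [Algebra k X] [IsDomain X]
  [IsDomain (AlgebraicClosure k ⊗[k] X)]

omit [IsDomain (AlgebraicClosure k ⊗[k] X)] in
theorem tensor_exists_clear (z : AlgebraicClosure k ⊗[k] FractionRing X) :
    ∃ d : X, d ≠ 0 ∧ ∃ c, (1 ⊗ₜ algebraMap X (FractionRing X) d) * z =
      baseChange k (IsScalarTower.toAlgHom k X (FractionRing X)) c := by
  refine exists_clear_denominators (IsScalarTower.toAlgHom k X (FractionRing X)) fun l => ?_
  obtain ⟨a, b, hb, h⟩ := IsFractionRing.div_surjective (A := X) (slice (FractionRing X) l z)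
  have hb0 := nonZeroDivisors.ne_zero hb
  refine ⟨b, hb0, a, ?_⟩
  rw [← h]
  have : algebraMap X (FractionRing X) b ≠ 0 := by simpa using hb0
  change algebraMap X (FractionRing X) b * _ = algebraMap X (FractionRing X) a
  field_simp

theorem isDomain_tensor_fractionRing : IsDomain (AlgebraicClosure k ⊗[k] FractionRing X) := by
  have hu : ∀ d : X, d ≠ 0 →
      IsUnit ((1 : AlgebraicClosure k) ⊗ₜ[k] algebraMap X (FractionRing X) d) := by
    intro d hd
    have : algebraMap X (FractionRing X) d ≠ 0 := by simpa using hd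
    have h2 := (this.isUnit).map (Algebra.TensorProduct.includeRight :
      FractionRing X →ₐ[k] AlgebraicClosure k ⊗[k] FractionRing X)
    simpa using h2
  have hinj := baseChange_injective (k := k) (f := IsScalarTower.toAlgHom k X (FractionRing X))
    (FaithfulSMul.algebraMap_injective X (FractionRing X))
  have : NoZeroDivisors (AlgebraicClosure k ⊗[k] FractionRing X) := by
    constructor
    intro u v huv
    obtain ⟨d, hd, u', hu'⟩ := tensor_exists_clear u
    obtain ⟨e, he, v', hv'⟩ := tensor_exists_clear v
    have : u' * v' = 0 := hinj (by
      rw [map_mul, ← hu', ← hv', map_zero, mul_mul_mul_comm, huv, mul_zero])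
    rcases mul_eq_zero.1 this with h | h
    · left
      rw [h, map_zero] at hu'
      exact (hu d hd).mul_right_eq_zero.1 hu'
    · right
      rw [h, map_zero] at hv'
      exact (hu e he).mul_right_eq_zero.1 hv'
  have : Nontrivial (AlgebraicClosure k ⊗[k] FractionRing X) := hinj.nontrivial
  exact NoZeroDivisors.to_isDomain _

theorem isField_tensor_fractionRing : IsField (AlgebraicClosure k ⊗[k] FractionRing X) := by
  have := isDomain_tensor_fractionRing (k := k) (X := X)
  have : Algebra.IsIntegral (FractionRing X) (FractionRing X ⊗[k] AlgebraicClosure k) :=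
      inferInstance
  let e := Algebra.TensorProduct.comm k (AlgebraicClosure k) (FractionRing X)
  have h2 : IsDomain (FractionRing X ⊗[k] AlgebraicClosure k) := e.symm.toMulEquiv.isDomain _
  have h1 : IsField (FractionRing X ⊗[k] AlgebraicClosure k) :=
    isField_of_isIntegral_of_isField' (R := FractionRing X) (Field.toIsField _)
  exact e.toMulEquiv.isField h1

variable [CharZero k]

/-- If `Frac R` is algebraically closed in the function field, then it remains so over `K`. -/
theorem fracRelAlgClosedVia_of_isAlgClosed {r : X}
    {ι : Localization.Away r →+* FractionRing X}
    (hι : ι.comp (algebraMap X (Localization.Away r)) = algebraMap X (FractionRing X))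
    {R : Type} [CommRing R] [IsDomain R] [Algebra k R] {f : R →ₐ[k] Localization.Away r}
    (hf : Function.Injective f) (E : Subfield (FractionRing X))
    (hE : ∀ x, IsAlgebraic E x → x ∈ E) (hRE : ∀ c, ι (f c) ∈ E)
    (hER : ∀ e ∈ E, ∃ d : R, d ≠ 0 ∧ ∃ c, ι (f d) * e = ι (f c)) :
    FracRelAlgClosedVia (baseChange k f) := by
  have hinj := awayEmb_injective hι
  have hιk : ∀ c : k, ι (algebraMap k _ c) = algebraMap k _ c := fun c => by
    rw [IsScalarTower.algebraMap_apply k X, IsScalarTower.algebraMap_apply k X (FractionRing X),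
        ← hι]
    rfl
  let ι' : Localization.Away r →ₐ[k] FractionRing X := ⟨ι, hιk⟩
  have hbinj := baseChange_injective (k := k) (f := ι') hinj
  rintro a b hb ⟨p, hp, hsum⟩
  let _ : Field (AlgebraicClosure k ⊗[k] FractionRing X) := isField_tensor_fractionRing.toField
  have : CharZero (AlgebraicClosure k ⊗[k] FractionRing X) :=
    charZero_of_injective_algebraMap (algebraMap k _).injective
  have : CharZero (FractionRing X) :=
    charZero_of_injective_algebraMap (algebraMap k _).injective
  set β := baseChange k ι'
  have hβb : β b ≠ 0 := fun h => hb (hbinj (by rw [h, map_zero]))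
  set u := β a / β b with hu
  have hslice : ∀ l, slice _ l u ∈ E := by
    intro l
    by_contra hcon
    have htr : Transcendental E (slice _ l u) := fun h => hcon (hE _ h)
    have hai : AlgebraicIndependent E (fun _ : Unit => slice _ l u) :=
      algebraicIndependent_unique_type_iff.2 htr
    obtain ⟨θ, hθ, hθE, hθ1, -⟩ := exists_dual_derivation E hai ()
    have hθk : ∀ c : k, θ (algebraMap k _ c) = 0 := fun c => by
      rw [← hιk, ← f.commutes]
      exact hθE _ (hRE _)
    let D : FractionRing X →ₗ[k] FractionRing X := ⟨⟨θ, hθ.add⟩, fun c x => by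
      change θ (c • x) = c • θ x
      rw [Algebra.smul_def, Algebra.smul_def, hθ.mul, hθk]
      simp⟩
    have hD : IsDer (RingHom.id _) (LinearMap.lTensor (AlgebraicClosure k) D) := by
      have := IsDer.lTensor (K := AlgebraicClosure k) (j := AlgHom.id k (FractionRing X)) (D := D)
          hθ
      rw [Algebra.TensorProduct.map_id] at this
      exact this
    have h0 : ∀ c, LinearMap.lTensor (AlgebraicClosure k) D (β (baseChange k f c)) = 0 := by
      intro c
      induction c with
      | zero => simp
      | add x y hx hy => rw [map_add, map_add, map_add, hx, hy, add_zero]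
      | tmul x y =>
        have : D (ι (f y)) = 0 := hθE _ (hRE _)
        simp [β, baseChange, ι', this]
    have hu0 : LinearMap.lTensor (AlgebraicClosure k) D u = 0 := by
      refine hD.eq_zero_of_isAlgebraic hD.fieldConstants (fun e he => he) ?_
      let g : AlgebraicClosure k ⊗[k] R →+* hD.fieldConstants :=
        (β.comp (baseChange k f)).codRestrict _ h0
      have hg : Function.Injective g := fun x y hxy =>
        baseChange_injective hf (hbinj (congrArg Subtype.val hxy))
      refine ⟨p.map g, (Polynomial.map_ne_zero_iff hg).2 hp, ?_⟩
      rw [Polynomial.aeval_def, Polynomial.eval₂_map, Polynomial.eval₂_eq_sum_range]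
      have h1 := congrArg β hsum
      rw [map_zero, map_sum] at h1
      have h2 : β b ^ p.natDegree * ∑ i ∈ Finset.range (p.natDegree + 1),
          ((algebraMap hD.fieldConstants _).comp g) (p.coeff i) * u ^ i = 0 := by
        rw [← h1, Finset.mul_sum]
        refine Finset.sum_congr rfl fun i hi => ?_
        rw [Finset.mem_range, Nat.lt_succ_iff] at hi
        have h3 : ((algebraMap hD.fieldConstants _).comp g) (p.coeff i) =
            β (baseChange k f (p.coeff i)) := rfl
        have h4 : β b ^ p.natDegree = β b ^ (p.natDegree - i) * β b ^ i := by
          rw [← pow_add, Nat.sub_add_cancel hi]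
        rw [h3, map_mul, map_mul, map_pow, map_pow, hu, div_pow, h4]
        field_simp
      exact (mul_eq_zero.1 h2).resolve_left (pow_ne_zero _ hβb)
    have h1 := slice_lTensor l D u
    rw [hu0, map_zero] at h1
    exact one_ne_zero (hθ1.symm.trans h1.symm)
  obtain ⟨d, hd, c, hc⟩ :=
      exists_clear_denominators (ι'.comp f) (z := u) (fun l => hER _ (hslice l))
  refine ⟨c, 1 ⊗ₜ d, one_tmul_ne_zero hd, hbinj ?_⟩
  rw [baseChange_comp] at hc
  change _ = β (baseChange k f c) at hc
  have h1 : (1 : AlgebraicClosure k) ⊗ₜ[k] (ι'.comp f) d = β (baseChange k f (1 ⊗ₜ d)) := by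
    simp [β, baseChange]
  change β _ = β _
  rw [map_mul, map_mul, ← hc, h1, hu]
  field_simp

end Up

section Bertini

open MvPolynomial

/-- Linear independence over `L` persists over elements algebraic over `L`, when `L` is
algebraically closed in `N`. -/
theorem eq_zero_of_sum_mul_eq_zero {L N W : Type} [Field L] [Field N] [Field W] [Algebra L N]
    [Algebra L W] [Algebra N W] [IsScalarTower L N W] [IsGalois N W]
    (hcl : ∀ x : N, IsAlgebraic L x → x ∈ (algebraMap L N).range)
    {ι : Type*} {x : ι → N} (hx : LinearIndependent L x) (s : Finset ι) (c : ι → W)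
    (hc : ∀ i ∈ s, IsAlgebraic L (c i)) (h : ∑ i ∈ s, c i * algebraMap N W (x i) = 0) :
    ∀ i ∈ s, c i = 0 := by
  classical
  induction hn : s.card using Nat.strong_induction_on generalizing s c with
  | _ n ih =>
  intro i hi
  by_contra hci
  have hfix : ∀ j ∈ s, c j * (c i)⁻¹ ∈ (algebraMap L W).range := by
    intro j hj
    have halg : IsAlgebraic L (c j * (c i)⁻¹) := (hc j hj).mul (hc i hi).inv
    obtain ⟨m, hm⟩ : c j * (c i)⁻¹ ∈ Set.range (algebraMap N W) := by
      rw [InfiniteGalois.mem_range_algebraMap_iff_fixed]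
      intro σ
      have h1 : ∑ j ∈ s, (σ (c j * (c i)⁻¹) - c j * (c i)⁻¹) * algebraMap N W (x j) = 0 := by
        have h2 : ∑ j ∈ s, c j * (c i)⁻¹ * algebraMap N W (x j) = 0 := by
          rw [← zero_mul (c i)⁻¹, ← h, Finset.sum_mul]
          exact Finset.sum_congr rfl fun _ _ => by ring
        have h3 := congrArg σ h2
        rw [map_zero, map_sum] at h3
        rw [← sub_zero (0 : W)]
        nth_rw 1 [← h3]
        rw [← h2, ← Finset.sum_sub_distrib]
        refine Finset.sum_congr rfl fun j _ => ?_
        rw [sub_mul, map_mul σ (c j * _), σ.commutes]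
      rw [← Finset.add_sum_erase s _ hi, mul_inv_cancel₀ hci, map_one, sub_self, zero_mul,
        zero_add] at h1
      by_cases hji : j = i
      · rw [hji, mul_inv_cancel₀ hci, map_one]
      · refine sub_eq_zero.1 (ih _ ?_ (s.erase i) (fun j => σ (c j * (c i)⁻¹) - c j * (c i)⁻¹)
          ?_ h1 rfl j (Finset.mem_erase.2 ⟨hji, hj⟩))
        · rw [← hn]
          exact Finset.card_erase_lt_of_mem hi
        · intro l hl
          have h4 : IsAlgebraic L (c l * (c i)⁻¹) :=
            (hc l (Finset.mem_of_mem_erase hl)).mul (hc i hi).inv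
          exact (h4.algHom (σ.toAlgHom.restrictScalars L)).sub h4
    rw [← hm, isAlgebraic_algebraMap_iff (algebraMap N W).injective] at halg
    obtain ⟨l, hl⟩ := hcl m halg
    exact ⟨l, by rw [← hm, ← hl, ← IsScalarTower.algebraMap_apply]⟩
  choose! l hl using hfix
  have h5 : ∑ j ∈ s, l j • x j = 0 := by
    apply (algebraMap N W).injective
    rw [map_zero, map_sum, ← zero_mul (c i)⁻¹, ← h, Finset.sum_mul]
    refine Finset.sum_congr rfl fun j hj => ?_
    rw [Algebra.smul_def, map_mul, ← IsScalarTower.algebraMap_apply, hl j hj]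
    ring
  have h6 := linearIndependent_iff'.1 hx s l h5 i hi
  have h7 := hl i hi
  rw [h6, map_zero, mul_inv_cancel₀ hci] at h7
  exact zero_ne_one h7

variable {A : Type} [CommRing A] [IsDomain A] {τ : Type} [Finite τ] {Ω : Type} [Field Ω]
  [IsAlgClosed Ω]

theorem exists_specialization_bound_aux (j : A →+* Ω) (hj : Function.Injective j)
    (g : MvPolynomial τ A)
    (bd : τ →₀ ℕ) (m₁ m₂ : τ →₀ ℕ) (h₁ : m₁ ≤ bd) (h₂ : m₂ ≤ bd)
    (hg : ∀ u v : MvPolynomial τ Ω, u * v = map j g → coeff m₁ u = 0 ∨ coeff m₂ v = 0) :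
    ∃ a : A, a ≠ 0 ∧ ∀ (κ : Type) [Field κ] (ψ : A →+* κ), ψ a ≠ 0 →
      ∀ u v : MvPolynomial τ κ, (∀ m ∈ u.support, m ≤ bd) → (∀ m ∈ v.support, m ≤ bd) →
        u * v = map ψ g → coeff m₁ u = 0 ∨ coeff m₂ v = 0 := by
  classical
  have := Fintype.ofFinite τ
  let M := Finset.Iic bd
  let V := M ⊕ M ⊕ Unit
  let gu : MvPolynomial τ (MvPolynomial V A) := ∑ m : M, monomial m.1 (X (Sum.inl m))
  let gv : MvPolynomial τ (MvPolynomial V A) := ∑ m : M, monomial m.1 (X (Sum.inr (Sum.inl m)))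
  let n₁ : M := ⟨m₁, Finset.mem_Iic.2 h₁⟩
  let n₂ : M := ⟨m₂, Finset.mem_Iic.2 h₂⟩
  let q : MvPolynomial V A :=
      X (Sum.inr (Sum.inr ())) * X (Sum.inl n₁) * X (Sum.inr (Sum.inl n₂)) - 1
  let I : Ideal (MvPolynomial V A) :=
    Ideal.span (insert q (Set.range fun m => coeff m (gu * gv - map C g)))
  have hcoeff : ∀ {Z : Type} [CommRing Z] (w : M → Z) (n : M),
      coeff n.1 (∑ m : M, monomial m.1 (w m)) = w n := by
    intro Z _ w n
    rw [coeff_sum]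
    simp only [coeff_monomial]
    rw [Finset.sum_eq_single n]
    · simp
    · intro b _ hb
      rw [if_neg fun h => hb (Subtype.ext h)]
    · simp
  by_cases hI : ∃ a : A, a ≠ 0 ∧ C a ∈ I
  · obtain ⟨a, ha, haI⟩ := hI
    refine ⟨a, ha, fun κ _ ψ hψ u v hu hv huv => ?_⟩
    by_contra! hcon
    apply hψ
    let pt : V → κ := Sum.elim (fun m => coeff m.1 u)
      (Sum.elim (fun m => coeff m.1 v) fun _ => (coeff m₁ u * coeff m₂ v)⁻¹)
    have hsum : ∀ w : MvPolynomial τ κ, (∀ m ∈ w.support, m ≤ bd) →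
        ∑ m : M, monomial m.1 (coeff m.1 w) = w := by
      intro w hw
      rw [Finset.sum_coe_sort M (fun m => monomial m (coeff m w))]
      conv_rhs => rw [w.as_sum]
      refine (Finset.sum_subset (fun m hm => Finset.mem_Iic.2 (hw m hm)) fun m _ hm => ?_).symm
      rw [notMem_support_iff.1 hm, monomial_zero]
    have hIker : I ≤ RingHom.ker (eval₂Hom ψ pt) := by
      rw [Ideal.span_le]
      rintro _ (rfl | ⟨m, rfl⟩)
      · simp only [SetLike.mem_coe, RingHom.mem_ker, q, map_sub, map_mul, map_one, eval₂Hom_X', pt,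
          Sum.elim_inl, Sum.elim_inr, n₁, n₂]
        rw [mul_assoc, inv_mul_cancel₀ (mul_ne_zero hcon.1 hcon.2), sub_self]
      · simp only [SetLike.mem_coe, RingHom.mem_ker]
        rw [← coeff_map, map_sub, map_mul, map_map]
        have e1 : map (eval₂Hom ψ pt) gu = u := by
          rw [map_sum]
          simp only [map_monomial, eval₂Hom_X', pt, Sum.elim_inl]
          exact hsum u hu
        have e2 : map (eval₂Hom ψ pt) gv = v := by
          rw [map_sum]
          simp only [map_monomial, eval₂Hom_X', pt, Sum.elim_inl, Sum.elim_inr]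
          exact hsum v hv
        have e3 : (eval₂Hom ψ pt).comp C = ψ := by ext; simp
        rw [e1, e2, e3, huv, sub_self, coeff_zero]
    have := hIker haI
    simpa using this
  · exfalso
    let L := FractionRing A
    let jL : L →+* Ω := IsFractionRing.lift hj
    let : Algebra L Ω := jL.toAlgebra
    have hjL : ∀ a, algebraMap L Ω (algebraMap A L a) = j a := IsFractionRing.lift_algebraMap hj
    let := MvPolynomial.algebraMvPolynomial (R := A) (S := L) (σ := V)
    let J := I.map (algebraMap (MvPolynomial V A) (MvPolynomial V L))
    have hJ : J ≠ ⊤ := by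
      intro h
      rw [Ideal.eq_top_iff_one, ← map_one (algebraMap (MvPolynomial V A) (MvPolynomial V L)),
        IsLocalization.algebraMap_mem_map_algebraMap_iff
          ((nonZeroDivisors A).map (C (σ := V)))] at h
      obtain ⟨_, ⟨a, ha, rfl⟩, hm⟩ := h
      exact hI ⟨a, nonZeroDivisors.ne_zero ha, by simpa using hm⟩
    obtain ⟨pt, hpt⟩ : (zeroLocus Ω J).Nonempty := by
      rw [Set.nonempty_iff_ne_empty]
      intro h
      have h1 := vanishingIdeal_zeroLocus_eq_radical (K := Ω) J
      rw [h] at h1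
      apply hJ
      rw [← Ideal.radical_eq_top, ← h1, Ideal.eq_top_iff_one]
      intro x hx
      exact hx.elim
    let χ : MvPolynomial V A →+* Ω := eval₂Hom j pt
    have hχ : ∀ p ∈ I, χ p = 0 := by
      intro p hp
      rw [← hpt _ (Ideal.mem_map_of_mem _ hp), algebraMap_def, aeval_def, eval₂_map, coe_eval₂Hom]
      congr 1
      ext a
      exact (hjL a).symm
    have e0 : map χ gu * map χ gv = map j g := by
      rw [← sub_eq_zero]
      ext m
      have h1 := hχ _ (Ideal.subset_span (Or.inr ⟨m, rfl⟩))
      rw [← coeff_map, map_sub, map_mul, map_map] at h1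
      have e3 : χ.comp C = j := by ext; simp [χ]
      rwa [e3] at h1
    have h2 := hχ _ (Ideal.subset_span (Or.inl rfl))
    have e1 : coeff m₁ (map χ gu) = χ (X (Sum.inl n₁)) := by
      rw [coeff_map]
      exact congrArg χ (hcoeff (fun m => X (Sum.inl m)) n₁)
    have e2 : coeff m₂ (map χ gv) = χ (X (Sum.inr (Sum.inl n₂))) := by
      rw [coeff_map]
      exact congrArg χ (hcoeff (fun m => X (Sum.inr (Sum.inl m))) n₂)
    rw [map_sub, map_mul, map_mul, map_one, ← e1, ← e2] at h2
    rcases hg _ _ e0 with h | h <;> simp [h] at h2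

/-- The Bertini–Noether theorem: if `g` has no nontrivial factorization over an algebraically
closed field containing `A`, the same holds for almost all specializations of `g`. -/
theorem exists_specialization_bound (j : A →+* Ω) (hj : Function.Injective j) (g : MvPolynomial τ A)
    (hg : ∀ u v : MvPolynomial τ Ω, u * v = map j g → ∀ m₁ m₂, m₁ ≠ 0 → m₂ ≠ 0 →
      coeff m₁ u = 0 ∨ coeff m₂ v = 0) :
    ∃ a : A, a ≠ 0 ∧ ∀ (κ : Type) [Field κ] (ψ : A →+* κ), ψ a ≠ 0 →
      ∀ u v : MvPolynomial τ κ, u ≠ 0 → v ≠ 0 → u * v = map ψ g → ∀ m₁ m₂, m₁ ≠ 0 → m₂ ≠ 0 →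
        coeff m₁ u = 0 ∨ coeff m₂ v = 0 := by
  classical
  have := Fintype.ofFinite τ
  let bd : τ →₀ ℕ := Finsupp.equivFunOnFinite.symm fun i => degreeOf i g
  let M := (Finset.Iic bd).erase 0
  have h0 : ∀ p : M × M, ∃ a : A, a ≠ 0 ∧ ∀ (κ : Type) [Field κ] (ψ : A →+* κ), ψ a ≠ 0 →
      ∀ u v : MvPolynomial τ κ, (∀ m ∈ u.support, m ≤ bd) → (∀ m ∈ v.support, m ≤ bd) →
        u * v = map ψ g → coeff p.1.1 u = 0 ∨ coeff p.2.1 v = 0 := by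
    rintro ⟨⟨m₁, h₁⟩, ⟨m₂, h₂⟩⟩
    rw [Finset.mem_erase, Finset.mem_Iic] at h₁ h₂
    exact exists_specialization_bound_aux j hj g bd m₁ m₂ h₁.2 h₂.2
      (fun u v huv => hg u v huv m₁ m₂ h₁.1 h₂.1)
  choose a ha hak using h0
  refine ⟨∏ p, a p, Finset.prod_ne_zero_iff.2 fun p _ => ha p, ?_⟩
  intro κ _ ψ hψ u v hu0 hv0 huv m₁ m₂ h₁ h₂
  have hdeg : ∀ i, degreeOf i u + degreeOf i v ≤ bd i := by
    intro i
    rw [← degreeOf_mul_eq hu0 hv0, huv]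
    rw [degreeOf_eq_sup]
    exact (Finset.sup_mono (support_map_subset _ _)).trans_eq (degreeOf_eq_sup _ _).symm
  have hu : ∀ m ∈ u.support, m ≤ bd := fun m hm i =>
    (monomial_le_degreeOf i hm).trans ((Nat.le_add_right _ _).trans (hdeg i))
  have hv : ∀ m ∈ v.support, m ≤ bd := fun m hm i =>
    (monomial_le_degreeOf i hm).trans ((Nat.le_add_left _ _).trans (hdeg i))
  by_contra! hcon
  have hm₁ : m₁ ∈ M := Finset.mem_erase.2 ⟨h₁, Finset.mem_Iic.2 (hu _ (mem_support_iff.2 hcon.1))⟩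
  have hm₂ : m₂ ∈ M := Finset.mem_erase.2 ⟨h₂, Finset.mem_Iic.2 (hv _ (mem_support_iff.2 hcon.2))⟩
  rw [map_prod, Finset.prod_ne_zero_iff] at hψ
  rcases hak (⟨m₁, hm₁⟩, ⟨m₂, hm₂⟩) κ ψ (hψ _ (Finset.mem_univ _)) u v hu hv huv with h | h
  · exact hcon.1 h
  · exact hcon.2 h

end Bertini

section GeometricPrimes

open Polynomial in
/-- If `B` agrees with `S[y] = S[X]/(g)` after inverting `h` and the specialization of the monic
polynomial `g` along `ρ` is prime, then the kernel of `ρ` generates a prime ideal of `B` after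
inverting `h`. -/
theorem exists_prime_over_of_prime_map {S R B : Type} [CommRing S] [CommRing R] [IsDomain R]
    [CommRing B] (ρ : S →+* R) (ι : S →+* B) {g : S[X]} (hg : g.Monic) (hdeg : 0 < g.natDegree)
    (hprime : Prime (g.map ρ)) {y : B} (hgy : g.eval₂ ι y = 0)
    (hker : ∀ p : S[X], p.eval₂ ι y = 0 → g ∣ p) {h : S} (hh : ρ h ≠ 0)
    (hB : ∀ x : B, ∃ (m : ℕ) (p : S[X]), ι h ^ m * x = p.eval₂ ι y) :
    ∃ Q : Ideal B, Q.IsPrime ∧ Q.comap ι = RingHom.ker ρ ∧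
      ∀ Q' : Ideal B, Q'.IsPrime → ι h ∉ Q' → (∀ s ∈ RingHom.ker ρ, ι s ∈ Q') → Q ≤ Q' := by
  have hC : ∀ s : S, g.map ρ ∣ C (ρ s) → ρ s = 0 := by
    intro s hs
    by_contra h0
    have h1 := natDegree_le_of_dvd hs (C_ne_zero.2 h0)
    rw [hg.natDegree_map, natDegree_C] at h1
    omega
  have hwd : ∀ (x : B) (m m' : ℕ) (p p' : S[X]), ι h ^ m * x = p.eval₂ ι y →
      ι h ^ m' * x = p'.eval₂ ι y → g.map ρ ∣ p.map ρ → g.map ρ ∣ p'.map ρ := by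
    intro x m m' p p' hp hp' hd
    have h1 : g ∣ C h ^ m * p' - C h ^ m' * p := by
      apply hker
      rw [eval₂_sub, eval₂_mul, eval₂_mul, eval₂_pow, eval₂_pow, eval₂_C, ← hp, ← hp']
      ring
    have h2 := map_dvd (mapRingHom ρ) h1
    simp only [coe_mapRingHom, Polynomial.map_sub, Polynomial.map_mul, Polynomial.map_pow,
      map_C] at h2
    rw [dvd_sub_left (hd.mul_left _)] at h2
    rcases hprime.dvd_or_dvd h2 with h3 | h3
    · exact absurd (hC h (hprime.dvd_of_dvd_pow h3)) hh
    · exact h3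
  let Q : Ideal B :=
    { carrier := {x | ∃ (m : ℕ) (p : S[X]), ι h ^ m * x = p.eval₂ ι y ∧ g.map ρ ∣ p.map ρ}
      zero_mem' := ⟨0, 0, by simp, by simp⟩
      add_mem' := by
        rintro x x' ⟨m, p, hp, hd⟩ ⟨m', p', hp', hd'⟩
        refine ⟨m + m', C h ^ m' * p + C h ^ m * p', ?_, ?_⟩
        · rw [eval₂_add, eval₂_mul, eval₂_mul, eval₂_pow, eval₂_pow, eval₂_C, ← hp, ← hp']
          ring
        · rw [Polynomial.map_add, Polynomial.map_mul, Polynomial.map_mul]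
          exact dvd_add (hd.mul_left _) (hd'.mul_left _)
      smul_mem' := by
        rintro c x ⟨m, p, hp, hd⟩
        obtain ⟨l, q, hq⟩ := hB c
        refine ⟨l + m, q * p, ?_, ?_⟩
        · rw [eval₂_mul, ← hp, ← hq, smul_eq_mul]
          ring
        · rw [Polynomial.map_mul]
          exact hd.mul_left _ }
  have hQ : ∀ {x : B} {m : ℕ} {p : S[X]}, ι h ^ m * x = p.eval₂ ι y →
      (x ∈ Q ↔ g.map ρ ∣ p.map ρ) := by
    intro x m p hp
    refine ⟨?_, fun hd => ⟨m, p, hp, hd⟩⟩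
    rintro ⟨m', p', hp', hd'⟩
    exact hwd x m' m p' p hp' hp hd'
  have hQι : ∀ s, ι s ∈ Q ↔ ρ s = 0 := by
    intro s
    rw [hQ (m := 0) (p := C s) (by simp), map_C]
    refine ⟨hC s, fun h0 => ?_⟩
    rw [h0, C_0]
    exact dvd_zero _
  refine ⟨Q, ⟨?_, ?_⟩, ?_, ?_⟩
  · rw [Ideal.ne_top_iff_one, ← map_one ι, hQι, map_one]
    exact one_ne_zero
  · intro x x' hxx
    obtain ⟨m, p, hp⟩ := hB x
    obtain ⟨m', p', hp'⟩ := hB x'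
    rw [hQ hp, hQ hp']
    rw [hQ (m := m + m') (p := p * p') (by rw [eval₂_mul, ← hp, ← hp']; ring),
      Polynomial.map_mul] at hxx
    exact hprime.dvd_or_dvd hxx
  · ext s
    exact hQι s
  · rintro Q' hQ' hhQ' hker' x ⟨m, p, hp, hd⟩
    have h1 : p.eval₂ ι y ∈ Q' := by
      rw [← modByMonic_add_div p g, eval₂_add, eval₂_mul, hgy, zero_mul, add_zero, eval₂_eq_sum]
      refine Ideal.sum_mem _ fun i _ => Ideal.mul_mem_right _ _ (hker' _ ?_)
      rw [RingHom.mem_ker, ← coeff_map, map_modByMonic _ hg,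
        (modByMonic_eq_zero_iff_dvd (hg.map ρ)).2 hd, coeff_zero]
    rw [← hp] at h1
    exact (hQ'.mem_or_mem h1).resolve_left fun h2 => hhQ' (hQ'.mem_of_pow_mem _ h2)

end GeometricPrimes

section Primitive

open Polynomial IntermediateField

/-- A domain algebraic and of finite type over a domain `S` of characteristic zero is, after
inverting a nonzero element of `S`, generated by a single element with monic minimal polynomial. -/
theorem exists_monic_generator (S B : Type) [CommRing S] [IsDomain S] [CharZero S] [CommRing B]
    [IsDomain B] [Algebra S B] [FaithfulSMul S B] [Algebra.IsAlgebraic S B]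
    [Algebra.FiniteType S B] :
    ∃ (y : B) (g : S[X]), g.Monic ∧ 0 < g.natDegree ∧ aeval y g = 0 ∧
      (∀ p : S[X], p.natDegree < g.natDegree → aeval y p = 0 → p = 0) ∧
      ∃ h : S, h ≠ 0 ∧ ∀ x : B, ∃ (m : ℕ) (p : S[X]), algebraMap S B h ^ m * x = aeval y p := by
  classical
  let M := FractionRing S
  let N := FractionRing B
  have hSN : FaithfulSMul S N := by
    rw [faithfulSMul_iff_algebraMap_injective, IsScalarTower.algebraMap_eq S B N]
    exact (IsFractionRing.injective B N).comp (FaithfulSMul.algebraMap_injective S B)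
  let : Algebra M N := FractionRing.liftAlgebra S N
  have : IsScalarTower S M N := FractionRing.isScalarTower_liftAlgebra S N
  have hBN := IsFractionRing.injective B N
  have hSNi := FaithfulSMul.algebraMap_injective S N
  have hSNalg : Algebra.IsAlgebraic S N := by
    exact (IsFractionRing.isAlgebraic_iff' S B N).1 inferInstance
  have hMN : Algebra.IsAlgebraic M N := IsFractionRing.comap_isAlgebraic_iff.1 hSNalg
  have hCM : CharZero M := (algebraMap S M).charZero_iff (IsFractionRing.injective S M) |>.1 ‹_›
  obtain ⟨G, hG⟩ := (inferInstance : Algebra.FiniteType S B).out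
  have hden : ∀ x : N, ∃ d : S, d ≠ 0 ∧ ∃ b : B, algebraMap S N d * x = algebraMap B N b := by
    intro x
    obtain ⟨⟨b, ⟨_, d, hd, rfl⟩⟩, hb⟩ :=
      IsLocalization.surj (Algebra.algebraMapSubmonoid B (nonZeroDivisors S)) x
    refine ⟨d, nonZeroDivisors.ne_zero hd, b, ?_⟩
    rw [← hb, mul_comm, IsScalarTower.algebraMap_apply S B N]
  have htop : IntermediateField.adjoin M (algebraMap B N '' (G : Set B)) = ⊤ := by
    rw [eq_top_iff]
    rintro x -
    have hmem : ∀ b : B, algebraMap B N b ∈ IntermediateField.adjoin M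
        (algebraMap B N '' (G : Set B)) := by
      intro b
      have hb : b ∈ Algebra.adjoin S (G : Set B) := hG ▸ Algebra.mem_top
      induction hb using Algebra.adjoin_induction with
      | mem x hx => exact subset_adjoin _ _ ⟨x, hx, rfl⟩
      | algebraMap r =>
        rw [← IsScalarTower.algebraMap_apply, IsScalarTower.algebraMap_apply S M N]
        exact IntermediateField.algebraMap_mem _ _
      | add x y _ _ hx hy => rw [map_add]; exact add_mem hx hy
      | mul x y _ _ hx hy => rw [map_mul]; exact mul_mem hx hy
    obtain ⟨a, b, -, rfl⟩ := IsFractionRing.div_surjective (A := B) x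
    exact div_mem (hmem a) (hmem b)
  have hfin : FiniteDimensional M N := by
    have h1 : FiniteDimensional M (IntermediateField.adjoin M (algebraMap B N '' (G : Set B))) :=
      finiteDimensional_adjoin fun x _ => (hMN.isAlgebraic x).isIntegral
    rw [htop] at h1
    exact (IntermediateField.topEquiv (F := M) (E := N)).toLinearEquiv.finiteDimensional
  have hscale : ∀ (x : N) (d : S), d ≠ 0 → M⟮x⟯ = ⊤ → M⟮algebraMap S N d * x⟯ = ⊤ := by
    intro x d hd hx
    rw [eq_top_iff, ← hx, adjoin_simple_le_iff]
    have hd' : algebraMap S N d ≠ 0 := (map_ne_zero_iff _ hSNi).2 hd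
    have h1 : x = algebraMap M N (algebraMap S M d)⁻¹ * (algebraMap S N d * x) := by
      rw [map_inv₀, ← IsScalarTower.algebraMap_apply, inv_mul_cancel_left₀ hd']
    exact Set.mem_of_eq_of_mem h1
      (mul_mem (IntermediateField.algebraMap_mem _ _) (mem_adjoin_simple_self M _))
  obtain ⟨y₀, hy₀⟩ := Field.exists_primitive_element M N
  obtain ⟨d₁, hd₁, b₁, hb₁⟩ := hden y₀
  have hy₁ := hscale y₀ d₁ hd₁ hy₀
  rw [hb₁] at hy₁
  have hintM : ∀ x : N, IsIntegral M x := fun x => (hMN.isAlgebraic x).isIntegral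
  have hdegree : ∀ x : N, M⟮x⟯ = ⊤ → (minpoly M x).natDegree = Module.finrank M N := by
    intro x hx
    rw [← IntermediateField.adjoin.finrank (hintM x), hx, finrank_top']
  let μ := minpoly M (algebraMap B N b₁)
  obtain ⟨d, hd⟩ := IsLocalization.exist_integer_multiples_of_finset (nonZeroDivisors S)
    ((Finset.range μ.natDegree).image fun i => μ.coeff i)
  have hd0 : (d : S) ≠ 0 := nonZeroDivisors.ne_zero d.2
  have hlift : μ.scaleRoots (algebraMap S M d) ∈ lifts (algebraMap S M) := by
    rw [lifts_iff_coeff_lifts]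
    intro i
    rw [coeff_scaleRoots]
    rcases lt_trichotomy i μ.natDegree with hi | hi | hi
    · obtain ⟨c, hc⟩ := hd (μ.coeff i) (Finset.mem_image_of_mem _ (Finset.mem_range.2 hi))
      refine ⟨c * d ^ (μ.natDegree - i - 1), ?_⟩
      obtain ⟨e, he⟩ : ∃ e, μ.natDegree - i = e + 1 := ⟨μ.natDegree - i - 1, by omega⟩
      rw [map_mul, hc, map_pow, he, Algebra.smul_def, Nat.add_sub_cancel, pow_succ]
      ring
    · refine ⟨1, ?_⟩
      rw [hi, (minpoly.monic (hintM _)).coeff_natDegree, Nat.sub_self, pow_zero, map_one, one_mul]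
    · refine ⟨0, ?_⟩
      rw [coeff_eq_zero_of_natDegree_lt hi, map_zero, zero_mul]
  obtain ⟨g, hgμ, hgdeg, hgmon⟩ := lifts_and_natDegree_eq_and_monic hlift
    ((monic_scaleRoots_iff _).2 (minpoly.monic (hintM _)))
  rw [natDegree_scaleRoots] at hgdeg
  have hyN : algebraMap B N (algebraMap S B d * b₁) = algebraMap S N d * algebraMap B N b₁ := by
    rw [map_mul, ← IsScalarTower.algebraMap_apply]
  have hy₂ := hscale _ d hd0 hy₁
  have haeval : ∀ p : S[X], algebraMap B N (aeval (algebraMap S B d * b₁) p) =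
      aeval (algebraMap S N d * algebraMap B N b₁) (p.map (algebraMap S M)) := by
    intro p
    rw [← hyN, aeval_map_algebraMap, aeval_algebraMap_apply]
  have hgen : ∀ x : B, ∃ c : S, c ≠ 0 ∧ ∃ p : S[X],
      algebraMap S B c * x = aeval (algebraMap S B d * b₁) p := by
    intro x
    have hx : algebraMap B N x ∈ M⟮algebraMap S N d * algebraMap B N b₁⟯.toSubalgebra := by
      rw [hy₂]
      trivial
    rw [adjoin_simple_toSubalgebra_of_isAlgebraic (hMN.isAlgebraic _),
      Algebra.adjoin_singleton_eq_range_aeval] at hx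
    obtain ⟨P, hP⟩ := hx
    obtain ⟨c, hc, hcP⟩ := IsLocalization.integerNormalization_spec (nonZeroDivisors S) P
    refine ⟨c, nonZeroDivisors.ne_zero hc,
        IsLocalization.integerNormalization (nonZeroDivisors S) P, hBN ?_⟩
    rw [haeval, hcP, map_mul, ← hP, ← IsScalarTower.algebraMap_apply S B N]
    change _ = aeval _ (c • P)
    rw [← IsScalarTower.algebraMap_smul M c P, map_smul, Algebra.smul_def,
      ← IsScalarTower.algebraMap_apply]
    rfl
  choose c hc p hcp using hgen
  refine ⟨algebraMap S B d * b₁, g, hgmon, ?_, ?_, ?_, ∏ x ∈ G, c x,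
    Finset.prod_ne_zero_iff.2 fun x _ => hc x, ?_⟩
  · rw [hgdeg]
    exact minpoly.natDegree_pos (hintM _)
  · apply hBN
    rw [haeval, hgμ, map_zero, IsScalarTower.algebraMap_apply S M N]
    exact scaleRoots_aeval_eq_zero (minpoly.aeval _ _)
  · intro p hp hp0
    by_contra hne
    have h1 := haeval p
    rw [hp0, map_zero] at h1
    have h2 := natDegree_le_of_dvd (minpoly.dvd M _ h1.symm)
      ((Polynomial.map_ne_zero_iff (IsFractionRing.injective S M)).2 hne)
    rw [hdegree _ hy₂] at h2
    rw [hgdeg, hdegree _ hy₁] at hp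
    exact absurd (h2.trans natDegree_map_le) (not_le.2 hp)
  · intro x
    have hx : x ∈ Algebra.adjoin S (G : Set B) := hG ▸ Algebra.mem_top
    induction hx using Algebra.adjoin_induction with
    | mem x hx =>
      refine ⟨1, C (∏ z ∈ G.erase x, c z) * p x, ?_⟩
      rw [pow_one, map_mul, ← hcp, aeval_C, ← Finset.mul_prod_erase G c hx, map_mul]
      ring
    | algebraMap r => exact ⟨0, C r, by simp⟩
    | add x x' _ _ hx hx' =>
      obtain ⟨m, q, hq⟩ := hx
      obtain ⟨m', q', hq'⟩ := hx'
      refine ⟨m + m', C (∏ z ∈ G, c z) ^ m' * q + C (∏ z ∈ G, c z) ^ m * q', ?_⟩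
      simp only [map_add, map_mul, map_pow, aeval_C, ← hq, ← hq']
      ring
    | mul x x' _ _ hx hx' =>
      obtain ⟨m, q, hq⟩ := hx
      obtain ⟨m', q', hq'⟩ := hx'
      refine ⟨m + m', q * q', ?_⟩
      rw [map_mul, ← hq, ← hq']
      ring

end Primitive

section AbsoluteIrreducibility

open MvPolynomial

theorem optionEquivLeft_map {R R' σ : Type} [CommRing R] [CommRing R'] (f : R →+* R')
    (p : MvPolynomial (Option σ) R) :
    optionEquivLeft R' σ (map f p) = (optionEquivLeft R σ p).map (map f) := by
  induction p using MvPolynomial.induction_on with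
  | C a => simp
  | add p q hp hq => simp [hp, hq]
  | mul_X p i hp => cases i <;> simp [hp]

theorem eq_C_of_forall_coeff_eq_zero {R τ : Type} [CommRing R] {u : MvPolynomial τ R}
    (h : ∀ m ≠ 0, coeff m u = 0) : u = C (coeff 0 u) := by
  classical
  ext m
  rw [coeff_C]
  split_ifs with hm
  · rw [hm]
  · exact h m (Ne.symm hm)

/-- A factor of a polynomial monic in the first variable that has degree zero in that variable is
constant. -/
theorem coeff_eq_zero_of_natDegree_eq_zero {Ω σ : Type} [Field Ω]
    {u v : MvPolynomial (Option σ) Ω}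
    (hmon : (optionEquivLeft Ω σ u * optionEquivLeft Ω σ v).Monic)
    (hv : (optionEquivLeft Ω σ v).natDegree = 0) {m : Option σ →₀ ℕ} (hm : m ≠ 0) :
    coeff m v = 0 := by
  obtain ⟨c, hc⟩ := Polynomial.natDegree_eq_zero.1 hv
  have h1 : (optionEquivLeft Ω σ u).leadingCoeff * c = 1 := by
    rw [← hmon.leadingCoeff, Polynomial.leadingCoeff_mul, ← hc, Polynomial.leadingCoeff_C]
  have h2 := (isUnit_iff_totalDegree_of_isReduced.1 (IsUnit.of_mul_eq_one_right _ h1)).2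
  rw [totalDegree_eq_zero_iff_eq_C] at h2
  have h3 : v = C (coeff 0 c) := by
    apply (optionEquivLeft Ω σ).injective
    rw [← hc, optionEquivLeft_C, ← h2]
  classical
  rw [h3, coeff_C, if_neg (Ne.symm hm)]

theorem FracRelAlgClosedVia.mem_range {A B L N : Type} [CommRing A] [IsDomain A] [CommRing B]
    [IsDomain B] [Algebra A B] [Field L] [Field N] [Algebra A L] [IsFractionRing A L] [Algebra B N]
    [IsFractionRing B N] [Algebra A N] [Algebra L N] [IsScalarTower A B N] [IsScalarTower A L N]
    (hcl : FracRelAlgClosedVia (algebraMap A B)) {z : N} (hz : IsAlgebraic L z) :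
    z ∈ (algebraMap L N).range := by
  have hBN := IsFractionRing.injective B N
  have hANi : Function.Injective (algebraMap A N) := by
    rw [IsScalarTower.algebraMap_eq A L N]
    exact (algebraMap L N).injective.comp (IsFractionRing.injective A L)
  obtain ⟨p, hp, hpz⟩ := (IsFractionRing.isAlgebraic_iff A L N).2 hz
  obtain ⟨a, b, hb, rfl⟩ := IsFractionRing.div_surjective (A := B) z
  have hb0 : algebraMap B N b ≠ 0 := (map_ne_zero_iff _ hBN).2 (nonZeroDivisors.ne_zero hb)
  obtain ⟨c, d, hd, hcd⟩ := hcl a b (nonZeroDivisors.ne_zero hb) ⟨p, hp, by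
    apply hBN
    rw [map_zero, ← mul_zero (algebraMap B N b ^ p.natDegree), ← hpz,
      Polynomial.aeval_eq_sum_range, Finset.mul_sum, map_sum]
    refine Finset.sum_congr rfl fun i hi => ?_
    rw [Finset.mem_range, Nat.lt_succ_iff] at hi
    obtain ⟨e, he⟩ := Nat.exists_eq_add_of_le hi
    rw [he, Nat.add_sub_cancel_left, map_mul, map_mul, map_pow, map_pow, pow_add, div_pow,
      Algebra.smul_def, IsScalarTower.algebraMap_apply A B N]
    field_simp⟩
  have hd0 : algebraMap A N d ≠ 0 := (map_ne_zero_iff _ hANi).2 hd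
  refine ⟨algebraMap A L c / algebraMap A L d, ?_⟩
  rw [map_div₀, ← IsScalarTower.algebraMap_apply, ← IsScalarTower.algebraMap_apply,
    div_eq_div_iff hd0 hb0, IsScalarTower.algebraMap_apply A B N,
    IsScalarTower.algebraMap_apply A B N, ← map_mul, ← map_mul, hcd, mul_comm]

/-- The polynomial of a monic generator of a regular extension does not factor nontrivially over
the algebraic closure. -/
theorem coeff_eq_zero_of_mul_eq_map {A B σ : Type} [CommRing A] [IsDomain A] [CharZero A]
    [CommRing B] [IsDomain B] [Algebra A B] [FaithfulSMul A B]
    (hcl : FracRelAlgClosedVia (algebraMap A B)) (x : σ → B) {y : B}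
    {g : Polynomial (MvPolynomial σ A)} (hg : g.Monic) (hdeg : 0 < g.natDegree)
    (hgy : g.eval₂ (aeval (R := A) x).toRingHom y = 0)
    (hmin : ∀ p : Polynomial (MvPolynomial σ A), p.natDegree < g.natDegree →
      p.eval₂ (aeval (R := A) x).toRingHom y = 0 → p = 0)
    (u v : MvPolynomial (Option σ) (AlgebraicClosure (FractionRing A)))
    (huv : u * v = map (algebraMap A _) ((optionEquivLeft A σ).symm g))
    (m₁ m₂ : Option σ →₀ ℕ) (h₁ : m₁ ≠ 0) (h₂ : m₂ ≠ 0) : coeff m₁ u = 0 ∨ coeff m₂ v = 0 := by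
  classical
  let L := FractionRing A
  let Ω := AlgebraicClosure L
  let N := FractionRing B
  let W := AlgebraicClosure N
  have hAN : FaithfulSMul A N := by
    rw [faithfulSMul_iff_algebraMap_injective, IsScalarTower.algebraMap_eq A B N]
    exact (IsFractionRing.injective B N).comp (FaithfulSMul.algebraMap_injective A B)
  let : Algebra L N := FractionRing.liftAlgebra A N
  have : IsScalarTower A L N := FractionRing.isScalarTower_liftAlgebra A N
  have hBN := IsFractionRing.injective B N
  have hANi := FaithfulSMul.algebraMap_injective A N
  have : CharZero N := (algebraMap A N).charZero_iff hANi |>.1 ‹_›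
  have hclN : ∀ z : N, IsAlgebraic L z → z ∈ (algebraMap L N).range :=
    fun z hz => hcl.mem_range hz
  let e : Ω →ₐ[L] W := IsAlgClosed.lift
  let pt : Option σ → N := fun o => o.elim (algebraMap B N y) fun i => algebraMap B N (x i)
  have hpt : ∀ p : MvPolynomial (Option σ) A, aeval pt p =
      algebraMap B N ((optionEquivLeft A σ p).eval₂ (aeval (R := A) x).toRingHom y) := by
    intro p
    induction p using MvPolynomial.induction_on with
    | C a => simp [← IsScalarTower.algebraMap_apply]
    | add p q hp hq => simp only [map_add, hp, hq, Polynomial.eval₂_add]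
    | mul_X p i hp => cases i <;> simp [hp, pt, Polynomial.eval₂_mul]
  let ev : MvPolynomial (Option σ) Ω →+* W := eval₂Hom e.toRingHom fun i => algebraMap N W (pt i)
  have hev : ∀ p : MvPolynomial (Option σ) A, ev (map (algebraMap A Ω) p) =
      algebraMap N W (aeval pt p) := by
    intro p
    simp only [ev, coe_eval₂Hom, eval₂_map]
    rw [aeval_def, eval₂_comp_left (algebraMap N W) (algebraMap A N) pt p]
    refine congrArg (fun f => eval₂ f (fun i => algebraMap N W (pt i)) p) ?_
    ext a
    simp only [RingHom.comp_apply, AlgHom.toRingHom_eq_coe, RingHom.coe_coe]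
    rw [IsScalarTower.algebraMap_apply A L Ω, e.commutes, ← IsScalarTower.algebraMap_apply A L W,
      ← IsScalarTower.algebraMap_apply A N W]
  have hli : LinearIndependent L fun m : {m : Option σ →₀ ℕ // m none < g.natDegree} =>
      aeval (R := A) pt (monomial m.1 1) := by
    rw [← LinearIndependent.iff_fractionRing (R := A), linearIndependent_iff']
    intro s c hc m hm
    have h1 : aeval pt (∑ m ∈ s, monomial m.1 (c m)) = 0 := by
      rw [map_sum, ← hc]
      refine Finset.sum_congr rfl fun m _ => ?_
      rw [← map_smul, smul_monomial, smul_eq_mul, mul_one]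
    rw [hpt] at h1
    have h2 := hmin _ ?_ ((map_eq_zero_iff _ hBN).1 h1)
    · rw [map_eq_zero_iff _ (optionEquivLeft A σ).injective] at h2
      have h3 := congrArg (coeff m.1) h2
      rw [coeff_sum, Finset.sum_eq_single m, coeff_monomial, if_pos rfl, coeff_zero] at h3
      · exact h3
      · intro m' _ hm'
        rw [coeff_monomial, if_neg fun h => hm' (Subtype.ext h)]
      · exact fun h => absurd hm h
    · rw [natDegree_optionEquivLeft, degreeOf_lt_iff hdeg]
      intro m' hm'
      by_contra hlt
      rw [mem_support_iff, coeff_sum] at hm'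
      apply hm'
      refine Finset.sum_eq_zero fun m _ => ?_
      rw [coeff_monomial, if_neg]
      rintro rfl
      exact hlt m.2
  have hzero : ∀ p : MvPolynomial (Option σ) Ω,
      (optionEquivLeft Ω σ p).natDegree < g.natDegree → ev p = 0 → p = 0 := by
    intro p hp hp0
    rw [natDegree_optionEquivLeft, degreeOf_lt_iff hdeg] at hp
    have h1 : ∑ m ∈ p.support.subtype (fun m => m none < g.natDegree),
        e (coeff m.1 p) * algebraMap N W (aeval (R := A) pt (monomial m.1 1)) = 0 := by
      rw [← hp0]
      simp only [ev, coe_eval₂Hom, eval₂_eq]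
      rw [Finset.sum_subtype_of_mem (fun m => e (coeff m p) * algebraMap N W
        (aeval (R := A) pt (monomial m 1))) hp]
      refine Finset.sum_congr rfl fun m _ => ?_
      rw [aeval_monomial, map_one, one_mul, Finsupp.prod, map_prod]
      simp only [map_pow]
      rfl
    have h2 := eq_zero_of_sum_mul_eq_zero hclN hli _ (fun m => e (coeff m.1 p))
      (fun m _ => (Algebra.IsAlgebraic.isAlgebraic (R := L) (coeff m.1 p)).algHom e) h1
    rw [← support_eq_empty, Finset.eq_empty_iff_forall_notMem]
    intro m hm
    have h3 := h2 ⟨m, hp m hm⟩ (Finset.mem_subtype.2 hm)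
    exact mem_support_iff.1 hm ((map_eq_zero_iff e (RingHom.injective e.toRingHom)).1 h3)
  have key : ∀ u v : MvPolynomial (Option σ) Ω,
      u * v = map (algebraMap A Ω) ((optionEquivLeft A σ).symm g) → ev u = 0 →
      ∀ m ≠ 0, coeff m v = 0 := by
    intro u v huv hu m hm
    have h3 : optionEquivLeft Ω σ u * optionEquivLeft Ω σ v = g.map (map (algebraMap A Ω)) := by
      rw [← map_mul, huv, optionEquivLeft_map, AlgEquiv.apply_symm_apply]
    have hmon : (optionEquivLeft Ω σ u * optionEquivLeft Ω σ v).Monic := h3 ▸ hg.map _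
    have hne := hmon.ne_zero
    have h4 := congrArg Polynomial.natDegree h3
    rw [Polynomial.natDegree_mul (left_ne_zero_of_mul hne) (right_ne_zero_of_mul hne),
      hg.natDegree_map] at h4
    by_cases hlt : (optionEquivLeft Ω σ u).natDegree < g.natDegree
    · exact absurd (by rw [hzero u hlt hu, map_zero]) (left_ne_zero_of_mul hne)
    · exact coeff_eq_zero_of_natDegree_eq_zero hmon (by omega) hm
  have hprod : ev u * ev v = 0 := by
    rw [← map_mul, huv, hev, hpt, AlgEquiv.apply_symm_apply, hgy, map_zero, map_zero]
  rcases mul_eq_zero.1 hprod with h | h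
  · exact Or.inr (key u v huv h m₂ h₂)
  · exact Or.inl (key v u (mul_comm u v ▸ huv) h m₁ h₁)

end AbsoluteIrreducibility

section GenericSpecialization

open MvPolynomial

/-- A criterion for the specialization of a monic polynomial over a polynomial ring to be prime. -/
theorem prime_map_of_forall_coeff {A κ σ : Type} [CommRing A] [Field κ] (ψ : A →+* κ)
    {g : Polynomial (MvPolynomial σ A)} (hg : g.Monic) (hdeg : 0 < g.natDegree)
    (h : ∀ u v : MvPolynomial (Option σ) κ, u ≠ 0 → v ≠ 0 →
      u * v = map ψ ((optionEquivLeft A σ).symm g) → ∀ m₁ m₂, m₁ ≠ 0 → m₂ ≠ 0 →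
      coeff m₁ u = 0 ∨ coeff m₂ v = 0) : Prime (g.map (map ψ)) := by
  have hmon : (g.map (map (σ := σ) ψ)).Monic := hg.map _
  have hG : (optionEquivLeft κ σ).symm (g.map (map ψ)) =
      map ψ ((optionEquivLeft A σ).symm g) := by
    rw [AlgEquiv.symm_apply_eq, optionEquivLeft_map, AlgEquiv.apply_symm_apply]
  have hunit : ∀ u : MvPolynomial (Option σ) κ, u ≠ 0 → (∀ m ≠ 0, coeff m u = 0) → IsUnit u := by
    intro u hu hm
    have h1 := eq_C_of_forall_coeff_eq_zero hm
    rw [h1]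
    refine (IsUnit.mk0 _ fun h0 => hu ?_).map C
    rw [h1, h0, map_zero]
  have hirr : Irreducible ((optionEquivLeft κ σ).symm (g.map (map ψ))) := by
    refine ⟨fun hu => ?_, fun u v huv => ?_⟩
    · rw [MulEquiv.isUnit_map] at hu
      have := Polynomial.natDegree_eq_zero_of_isUnit hu
      rw [hg.natDegree_map] at this
      omega
    · have hne : u * v ≠ 0 := by
        rw [← huv]
        exact (map_ne_zero_iff _ (optionEquivLeft κ σ).symm.injective).2 hmon.ne_zero
      have hu := left_ne_zero_of_mul hne
      have hv := right_ne_zero_of_mul hne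
      by_contra hcon
      rw [not_or] at hcon
      have h1 : ∃ m₁ ≠ 0, coeff m₁ u ≠ 0 := by
        by_contra h'
        push Not at h'
        exact hcon.1 (hunit u hu h')
      have h2 : ∃ m₂ ≠ 0, coeff m₂ v ≠ 0 := by
        by_contra h'
        push Not at h'
        exact hcon.2 (hunit v hv h')
      obtain ⟨m₁, hm₁, h1⟩ := h1
      obtain ⟨m₂, hm₂, h2⟩ := h2
      rcases h u v hu hv (by rw [← huv, hG]) m₁ m₂ hm₁ hm₂ with h' | h'
      exacts [h1 h', h2 h']
  exact (MulEquiv.prime_iff (optionEquivLeft κ σ).symm).1 hirr.prime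

/-- For a regular extension of finite type, the fibres over general primes are irreducible. -/
theorem exists_prime_over_of_algebra {A B : Type} [CommRing A] [IsDomain A] [CharZero A]
    [CommRing B] [IsDomain B] [Algebra A B] [FaithfulSMul A B] [Algebra.FiniteType A B]
    (hcl : FracRelAlgClosedVia (algebraMap A B)) :
    ∃ a : A, a ≠ 0 ∧ ∃ b : B, b ≠ 0 ∧ ∀ t : Ideal A, t.IsPrime → a ∉ t →
      ∃ Q : Ideal B, Q.IsPrime ∧ Q.comap (algebraMap A B) = t ∧ b ∉ Q ∧
        ∀ Q' : Ideal B, Q'.IsPrime → b ∉ Q' → (∀ s ∈ t, algebraMap A B s ∈ Q') → Q ≤ Q' := by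
  classical
  obtain ⟨G, hG⟩ := Algebra.FiniteType.out (R := A) (A := B)
  have hAB := FaithfulSMul.algebraMap_injective A B
  have : Algebra.IsAlgebraic (Algebra.adjoin A (G : Set B)) B := by
    rw [hG]
    exact ⟨fun x => isAlgebraic_algebraMap (R := (⊤ : Subalgebra A B)) (A := B) ⟨x, trivial⟩⟩
  obtain ⟨u, -, huG, hu⟩ := exists_isTranscendenceBasis_between (R := A) (∅ : Set B) (G : Set B)
    (Set.empty_subset _) ((algebraicIndependent_empty_iff ..).mpr hAB)
  have : Finite u := (G.finite_toSet.subset huG).to_subtype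
  let x : u → B := Subtype.val
  let S := MvPolynomial u A
  let : Algebra S B := (aeval (R := A) x).toAlgebra
  have halg : algebraMap S B = (aeval (R := A) x).toRingHom := rfl
  have : IsScalarTower A S B := IsScalarTower.of_algebraMap_eq fun a => by
    rw [halg]
    simp [S]
  have : FaithfulSMul S B := by
    rw [faithfulSMul_iff_algebraMap_injective]
    exact hu.1
  have : Algebra.IsAlgebraic S B := hu.isAlgebraic_iff.2 fun i => by
    have : algebraMap S B (X i) = x i := by
      exact aeval_X x i
    change IsAlgebraic S (x i)
    rw [← this]
    exact isAlgebraic_algebraMap _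
  have : Algebra.FiniteType S B := Algebra.FiniteType.of_restrictScalars_finiteType A S B
  obtain ⟨y, g, hg, hdeg, hgy, hmin, h, hh, hB⟩ := exists_monic_generator S B
  have hker : ∀ p : Polynomial S, p.eval₂ (algebraMap S B) y = 0 → g ∣ p := by
    intro p hp
    rw [← Polynomial.modByMonic_eq_zero_iff_dvd hg]
    refine hmin _ (Polynomial.natDegree_modByMonic_lt p hg fun h1 => ?_) ?_
    · rw [h1, Polynomial.natDegree_one] at hdeg
      exact lt_irrefl _ hdeg
    · have h1 := congrArg (Polynomial.aeval y) (Polynomial.modByMonic_add_div p g)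
      rw [map_add, map_mul, hgy, zero_mul, add_zero] at h1
      rw [h1]
      exact hp
  obtain ⟨a, ha, hbd⟩ := exists_specialization_bound
    (algebraMap A (AlgebraicClosure (FractionRing A)))
    ((algebraMap (FractionRing A) _).injective.comp (IsFractionRing.injective A (FractionRing A)))
    ((optionEquivLeft A u).symm g) (coeff_eq_zero_of_mul_eq_map hcl x hg hdeg hgy hmin)
  obtain ⟨m, hm⟩ := exists_coeff_ne_zero hh
  refine ⟨a * coeff m h, mul_ne_zero ha hm, algebraMap S B h,
    (map_ne_zero_iff _ (FaithfulSMul.algebraMap_injective S B)).2 hh, fun t ht hat => ?_⟩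
  let κ := FractionRing (A ⧸ t)
  let ψ : A →+* κ := (algebraMap (A ⧸ t) κ).comp (Ideal.Quotient.mk t)
  have hψ : ∀ s, ψ s = 0 ↔ s ∈ t := fun s => by
    rw [RingHom.comp_apply, map_eq_zero_iff _ (IsFractionRing.injective (A ⧸ t) κ),
      Ideal.Quotient.eq_zero_iff_mem]
  have hkt : ∀ p : S, p ∈ RingHom.ker (map (σ := u) ψ) ↔ ∀ m, coeff m p ∈ t := fun p => by
    rw [RingHom.mem_ker, MvPolynomial.ext_iff]
    refine forall_congr' fun m => ?_
    rw [coeff_zero, ← hψ]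
    exact Eq.congr_left (coeff_map ψ p m)
  have hprime := prime_map_of_forall_coeff ψ hg hdeg (hbd κ ψ fun h0 =>
    hat (t.mul_mem_right _ ((hψ a).1 h0)))
  have hhρ : map (σ := u) ψ h ≠ 0 := fun h0 => hat (t.mul_mem_left _ ((hkt h).1 h0 m))
  obtain ⟨Q, hQ, hQc, hQm⟩ := exists_prime_over_of_prime_map (map ψ) (algebraMap S B) hg hdeg hprime
    hgy hker hhρ hB
  refine ⟨Q, hQ, ?_, fun hbQ => ?_, fun Q' hQ' hb hle => hQm Q' hQ' hb fun s hs => ?_⟩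
  · rw [IsScalarTower.algebraMap_eq A S B, ← Ideal.comap_comap, hQc]
    ext s
    rw [Ideal.mem_comap, hkt]
    refine ⟨fun hs => ?_, fun hs m => ?_⟩
    · have := hs 0
      rwa [algebraMap_eq, coeff_C, if_pos rfl] at this
    · rw [algebraMap_eq, coeff_C]
      split_ifs
      exacts [hs, t.zero_mem]
  · rw [← Ideal.mem_comap, hQc, RingHom.mem_ker] at hbQ
    exact hhρ hbQ
  · rw [hkt] at hs
    rw [s.as_sum, map_sum]
    refine Ideal.sum_mem _ fun m _ => ?_
    rw [halg]
    simp only [AlgHom.toRingHom_eq_coe, RingHom.coe_coe, aeval_monomial]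
    exact Ideal.mul_mem_right _ _ (hle _ (hs m))

/-- For a regular extension of finite type, the fibres over general primes are irreducible. -/
theorem exists_prime_over {A B : Type} [CommRing A] [IsDomain A] [CharZero A]
    [CommRing B] [IsDomain B] {f : A →+* B} (hf : Function.Injective f) (hft : f.FiniteType)
    (hcl : FracRelAlgClosedVia f) :
    ∃ a : A, a ≠ 0 ∧ ∃ b : B, b ≠ 0 ∧ ∀ t : Ideal A, t.IsPrime → a ∉ t →
      ∃ Q : Ideal B, Q.IsPrime ∧ Q.comap f = t ∧ b ∉ Q ∧
        ∀ Q' : Ideal B, Q'.IsPrime → b ∉ Q' → (∀ s ∈ t, f s ∈ Q') → Q ≤ Q' := by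
  let : Algebra A B := f.toAlgebra
  have : FaithfulSMul A B := (faithfulSMul_iff_algebraMap_injective A B).2 hf
  have : Algebra.FiniteType A B := hft
  exact exists_prime_over_of_algebra hcl

/-- For a regular extension of finite type of noetherian domains, general prime divisors that are
not horizontal correspond to prime divisors of the base. -/
theorem exists_prime_divisor_over {A B : Type} [CommRing A] [IsDomain A] [CharZero A]
    [IsNoetherianRing A] [CommRing B] [IsDomain B] [IsNoetherianRing B]
    {f : A →+* B} (hf : Function.Injective f) (hft : f.FiniteType)
    (hcl : FracRelAlgClosedVia f) :
    ∃ a : A, a ≠ 0 ∧ ∃ b : B, b ≠ 0 ∧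
      (∀ t : Ideal A, HeightOnePrime t → a ∉ t →
        ∃ Q : Ideal B, HeightOnePrime Q ∧ Q.comap f = t ∧ b ∉ Q) ∧
      (∀ Q : Ideal B, HeightOnePrime Q → b ∉ Q → Q.comap f ≠ ⊥ → a ∉ Q.comap f →
        HeightOnePrime (Q.comap f)) ∧
      ∀ Q₁ Q₂ : Ideal B, HeightOnePrime Q₁ → HeightOnePrime Q₂ → b ∉ Q₁ → b ∉ Q₂ →
        Q₁.comap f = Q₂.comap f → Q₁.comap f ≠ ⊥ → a ∉ Q₁.comap f → Q₁ = Q₂ := by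
  obtain ⟨a, ha, b, hb, h⟩ := exists_prime_over hf hft hcl
  have hbot : ∀ Q : Ideal B, Q.comap f ≠ ⊥ → Q ≠ ⊥ := by
    rintro Q hQ rfl
    refine hQ (le_bot_iff.1 fun x hx => ?_)
    rw [Ideal.mem_comap, Ideal.mem_bot, map_eq_zero_iff f hf] at hx
    exact hx
  have huniq : ∀ (Q : Ideal B), HeightOnePrime Q → b ∉ Q → ∀ t : Ideal A, t.IsPrime → t ≠ ⊥ →
      a ∉ t → t ≤ Q.comap f → Q.comap f = t ∧ ∀ Q' : Ideal B, HeightOnePrime Q' → b ∉ Q' →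
      t ≤ Q'.comap f → Q' = Q := by
    intro Q hQ hbQ t ht ht0 hat hle
    obtain ⟨Q₀, hQ₀, hQ₀t, -, hmin⟩ := h t ht hat
    have hQ₀0 : Q₀ ≠ ⊥ := hbot Q₀ (by rwa [hQ₀t])
    have h1 : Q₀ = Q := hQ.eq_of_le hQ₀ hQ₀0 (hmin Q hQ.1 hbQ hle)
    refine ⟨h1 ▸ hQ₀t, fun Q' hQ' hbQ' hle' => ?_⟩
    rw [← h1, hQ'.eq_of_le hQ₀ hQ₀0 (hmin Q' hQ'.1 hbQ' hle')]
  refine ⟨a, ha, b, hb, fun t ht hat => ?_, fun Q hQ hbQ hQ0 haQ => ?_,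
    fun Q₁ Q₂ hQ₁ hQ₂ hb₁ hb₂ he h0 haQ => ?_⟩
  · obtain ⟨Q, hQ, hQt, hbQ, hmin⟩ := h t ht.1 hat
    obtain ⟨c, hc, hc0⟩ := Submodule.exists_mem_ne_zero_of_ne_bot ht.2.1
    have hcQ : Ideal.span {f c} ≤ Q := by
      rw [Ideal.span_singleton_le_iff_mem, ← Ideal.mem_comap, hQt]
      exact hc
    obtain ⟨Q₀, hQ₀, hle⟩ := Ideal.exists_minimalPrimes_le hcQ
    have hQ₀1 := heightOnePrime_of_mem_minimalPrimes ((map_ne_zero_iff f hf).2 hc0) hQ₀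
    have := hQ₀1.1
    have hcQ₀ : c ∈ Q₀.comap f := hQ₀.1.2 (Ideal.mem_span_singleton_self _)
    have h1 : Q₀.comap f = t := ht.eq_of_le inferInstance
      (fun h' => hc0 (by rwa [h', Ideal.mem_bot] at hcQ₀)) (hQt ▸ Ideal.comap_mono hle)
    have h2 : Q ≤ Q₀ := hmin Q₀ this (fun h' => hbQ (hle h')) fun s hs => by
      rw [← Ideal.mem_comap, h1]
      exact hs
    exact ⟨Q, le_antisymm h2 hle ▸ hQ₀1, hQt, hbQ⟩
  · have := hQ.1
    obtain ⟨t, ht, hle⟩ := exists_heightOnePrime_le hQ0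
    rw [(huniq Q hQ hbQ t ht.1 ht.2.1 (fun h' => haQ (hle h')) hle).1]
    exact ht
  · have := hQ₁.1
    exact (huniq Q₂ hQ₂ hb₂ _ inferInstance h0 haQ he.le).2 Q₁ hQ₁ hb₁ le_rfl

end GenericSpecialization

section RelativeAlgebraicClosure

open IntermediateField algebraAdjoinAdjoin

/-- The relative algebraic closure in a finitely generated field extension is finite. -/
theorem finiteDimensional_algebraicClosure (L F : Type) [Field L] [Field F] [Algebra L F]
    [Algebra.EssFiniteType L F] : FiniteDimensional L (algebraicClosure L F) := by
  obtain ⟨u, hu⟩ := exists_isTranscendenceBasis L F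
  let M := adjoin L u
  have : Algebra.IsAlgebraic M F := by
    have := hu.isAlgebraic_field
    rwa [Subtype.range_coe] at this
  have : Algebra.EssFiniteType M F := Algebra.EssFiniteType.of_comp L M F
  have : Module.Finite M F := Algebra.finite_of_essFiniteType_of_isAlgebraic
  let b := Module.Free.chooseBasis L (algebraicClosure L F)
  have hind : AlgebraicIndependent (algebraicClosure L F) (Subtype.val : u → F) :=
    hu.1.extendScalars _
  have hb : LinearIndependent M fun i => (b i : F) := by
    rw [← LinearIndependent.iff_fractionRing (R := Algebra.adjoin L u) (K := M),
      linearIndependent_iff']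
    intro s g hg i hi
    have hp : ∀ i, ∃ p : MvPolynomial u L, MvPolynomial.aeval Subtype.val p = (g i : F) := by
      intro i
      have h1 : (Algebra.adjoin L u : Subalgebra L F) =
          (MvPolynomial.aeval (Subtype.val : u → F)).range := by
        rw [← Algebra.adjoin_range_eq_range_aeval, Subtype.range_coe]
      exact h1.le (g i).2
    choose p hp using hp
    have h1 : MvPolynomial.aeval (R := algebraicClosure L F) (Subtype.val : u → F)
        (∑ i ∈ s, MvPolynomial.C (b i) * MvPolynomial.map (algebraMap L _) (p i)) = 0 := by
      rw [map_sum, ← hg]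
      refine Finset.sum_congr rfl fun i _ => ?_
      rw [map_mul, MvPolynomial.aeval_map_algebraMap, hp, MvPolynomial.aeval_C, mul_comm]
      rfl
    have h2 := (map_eq_zero_iff _ hind).1 h1
    have h3 : p i = 0 := by
      ext m
      have h4 := congrArg (MvPolynomial.coeff m) h2
      rw [MvPolynomial.coeff_sum, MvPolynomial.coeff_zero] at h4
      refine linearIndependent_iff'.1 b.linearIndependent s (fun i => MvPolynomial.coeff m (p i))
        ?_ i hi
      rw [← h4]
      refine Finset.sum_congr rfl fun j _ => ?_
      rw [MvPolynomial.coeff_C_mul, MvPolynomial.coeff_map, Algebra.smul_def, mul_comm]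
    have h4 := hp i
    rw [h3, map_zero] at h4
    exact Subtype.ext h4.symm
  have := hb.finite
  exact Module.Finite.of_basis b

end RelativeAlgebraicClosure

section NormalModel

open IntermediateField.algebraAdjoinAdjoin

/-- An algebraically closed subfield of a finitely generated extension has a normal model of
finite type. -/
theorem exists_normal_model {k F : Type} [Field k] [CharZero k] [Field F] [Algebra k F]
    [Algebra.EssFiniteType k F] {E : Subfield F} (hk : ∀ c : k, algebraMap k F c ∈ E)
    (hE : ∀ x, IsAlgebraic E x → x ∈ E) :
    ∃ X' : Subalgebra k F, X'.FG ∧ IsIntegrallyClosed X' ∧ (∀ x ∈ X', x ∈ E) ∧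
      ∀ e ∈ E, ∃ d ∈ X', d ≠ 0 ∧ e * d ∈ X' := by
  let EI : IntermediateField k F := E.toIntermediateField hk
  obtain ⟨u, hu⟩ := exists_isTranscendenceBasis k EI
  let x : u → F := fun i => (i : EI)
  have hx : AlgebraicIndependent k x := hu.1.map' (f := EI.val) EI.val.injective
  have : Finite u := finite_of_algebraicIndependent hx
  let R := Algebra.adjoin k (Set.range x)
  let L := IntermediateField.adjoin k (Set.range x)
  have hRk : Algebra.FiniteType k R := by
    rw [← Subalgebra.fg_iff_finiteType]
    exact Subalgebra.fg_def.2 ⟨_, Set.finite_range x, rfl⟩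
  have : IsNoetherianRing R := Algebra.FiniteType.isNoetherianRing k R
  have : IsIntegrallyClosed R := IsIntegrallyClosed.of_equiv hx.aevalEquiv.toRingEquiv
  have : Algebra.EssFiniteType L F := Algebra.EssFiniteType.of_comp k L F
  let C := algebraicClosure L F
  have hCE : ∀ y : F, y ∈ C ↔ y ∈ E := by
    intro y
    rw [mem_algebraicClosure_iff]
    constructor
    · intro hy
      have hle : L ≤ EI := by
        rw [IntermediateField.adjoin_le_iff]
        rintro _ ⟨i, rfl⟩
        exact (i : EI).2
      let : Algebra L EI := (IntermediateField.inclusion hle).toRingHom.toAlgebra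
      have : IsScalarTower L EI F := IsScalarTower.of_algebraMap_eq' rfl
      exact hE y (hy.tower_top EI)
    · intro hy
      have hle : R ≤ EI.toSubalgebra := by
        rw [Algebra.adjoin_le_iff]
        rintro _ ⟨i, rfl⟩
        exact (i : EI).2
      let : Algebra R EI := (Subalgebra.inclusion hle).toRingHom.toAlgebra
      have : IsScalarTower R EI F := IsScalarTower.of_algebraMap_eq' rfl
      have : IsScalarTower k R EI := IsScalarTower.of_algebraMap_eq' rfl
      have h1 : Algebra.IsAlgebraic R EI := hu.isAlgebraic_iff.2 fun i =>
        isAlgebraic_algebraMap (⟨x i, Algebra.subset_adjoin ⟨i, rfl⟩⟩ : R)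
      have h2 : IsAlgebraic R y := (h1.1 ⟨y, hy⟩).algebraMap (A := F)
      exact h2.extendScalars (FaithfulSMul.algebraMap_injective R L)
  have : FiniteDimensional L C := finiteDimensional_algebraicClosure L F
  have : IsScalarTower k R C := IsScalarTower.of_algebraMap_eq' rfl
  let B := integralClosure R C
  have : Module.Finite R B := IsIntegralClosure.finite R L C B
  have : IsFractionRing B C := integralClosure.isFractionRing_of_finite_extension L C
  have : IsIntegrallyClosed B := integralClosure.isIntegrallyClosedOfFiniteExtension L
  have : Algebra.FiniteType R B := inferInstance
  have hBk : Algebra.FiniteType k B := Algebra.FiniteType.trans (S := R) hRk this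
  let v : C →ₐ[k] F := C.val.restrictScalars k
  let Bk : Subalgebra k C := B.restrictScalars k
  have hv : Function.Injective v := C.val.injective
  refine ⟨Bk.map v, ?_, ?_, ?_, ?_⟩
  · exact Subalgebra.FG.map _ (Subalgebra.fg_iff_finiteType _ |>.2 hBk)
  · have : IsIntegrallyClosed Bk := ‹IsIntegrallyClosed B›
    exact IsIntegrallyClosed.of_equiv (Bk.equivMapOfInjective v hv).toRingEquiv
  · rintro _ ⟨y, -, rfl⟩
    exact (hCE _).1 y.2
  · intro e he
    obtain ⟨a, d, hd, h⟩ := IsFractionRing.div_surjective (A := B) (⟨e, (hCE e).2 he⟩ : C)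
    have hd0 : (d : C) ≠ 0 := fun h => nonZeroDivisors.ne_zero hd (Subtype.ext h)
    refine ⟨v d, ⟨d, d.2, rfl⟩, (map_ne_zero_iff v hv).2 hd0, a, a.2, ?_⟩
    have h1 : (a : C) = ⟨e, (hCE e).2 he⟩ * d := (div_eq_iff hd0).1 h
    change v a = e * v d
    rw [h1, map_mul]
    rfl

end NormalModel

section Stable

variable {σ R : Type*} [CommRing R] [IsDomain R] [CharZero R]

/-- A nonempty set of nonzero polynomials stable under partial derivatives contains, up to zero,
a nonzero constant. -/
theorem MvPolynomial.exists_C_mem_of_pderiv_mem {J : Set (MvPolynomial σ R)}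
    (hJ : ∀ i, ∀ p ∈ J, MvPolynomial.pderiv i p ∈ J) {p : MvPolynomial σ R} (hp : p ∈ J)
    (hp0 : p ≠ 0) : ∃ c : R, c ≠ 0 ∧ MvPolynomial.C c ∈ J := by
  induction h : p.totalDegree using Nat.strong_induction_on generalizing p with
  | _ n ih =>
    subst h
    by_cases h0 : p.totalDegree = 0
    · rw [MvPolynomial.totalDegree_eq_zero_iff_eq_C] at h0
      refine ⟨MvPolynomial.coeff 0 p, fun h => hp0 ?_, h0 ▸ hp⟩
      rw [h0, h, map_zero]
    have hex : ∃ m ∈ p.support, ∃ i, m i ≠ 0 := by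
      by_contra! hcon
      apply h0
      rw [MvPolynomial.totalDegree_eq_zero_iff]
      exact fun m hm i => hcon m hm i
    obtain ⟨m, hm, i, hi⟩ := hex
    have hne : MvPolynomial.pderiv i p ≠ 0 := by
      intro h
      have h1 := MvPolynomial.coeff_pderiv (i := i) p (m - Finsupp.single i 1)
      have h2 : m - Finsupp.single i 1 + Finsupp.single i 1 = m :=
        tsub_add_cancel_of_le (Finsupp.single_le_iff.2 (Nat.one_le_iff_ne_zero.2 hi))
      rw [h, h2, MvPolynomial.coeff_zero] at h1
      rcases mul_eq_zero.1 h1.symm with h3 | h3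
      · exact MvPolynomial.mem_support_iff.1 hm h3
      · exact Nat.cast_add_one_ne_zero _ h3
    refine ih _ ?_ (hJ i p hp) hne rfl
    rw [MvPolynomial.totalDegree, Finset.sup_lt_iff (Nat.pos_of_ne_zero h0)]
    intro m' hm'
    have h1 := MvPolynomial.mem_support_iff.1 hm'
    rw [MvPolynomial.coeff_pderiv] at h1
    have h2 := MvPolynomial.le_totalDegree (MvPolynomial.mem_support_iff.2 (left_ne_zero_of_mul h1))
    rw [Finsupp.sum_add_index' (fun _ => rfl) (fun _ _ _ => rfl),
      Finsupp.sum_single_index rfl] at h2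
    exact h2

end Stable

section Vertical

theorem trace_ne_bot {k : Type} [Field k] {X : Type} [CommRing X] [IsDomain X] [Algebra k X]
    [IsDomain (AlgebraicClosure k ⊗[k] X)]
    {Q : Ideal (AlgebraicClosure k ⊗[k] X)} (h : HeightOnePrime Q) : trace Q ≠ ⊥ := by
  intro h0
  let := (Algebra.TensorProduct.includeRight :
      X →ₐ[k] AlgebraicClosure k ⊗[k] X).toRingHom.toAlgebra
  have : Algebra.IsIntegral X (AlgebraicClosure k ⊗[k] X) := by
    constructor
    intro z
    induction z using TensorProduct.induction_on with
    | zero => exact isIntegral_zero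
    | tmul a x =>
      have h1 : a ⊗ₜ[k] x = (a ⊗ₜ[k] (1 : X)) * algebraMap X (AlgebraicClosure k ⊗[k] X) x := by
        change _ = _ * ((1 : AlgebraicClosure k) ⊗ₜ[k] x)
        simp
      rw [h1]
      refine IsIntegral.mul ?_ isIntegral_algebraMap
      obtain ⟨p, hp, hpa⟩ := (AlgebraicClosure.isAlgebraic k).isAlgebraic a |>.isIntegral
      refine ⟨p.map (algebraMap k X), hp.map _, ?_⟩
      rw [Polynomial.eval₂_map]
      have h2 : (algebraMap X (AlgebraicClosure k ⊗[k] X)).comp (algebraMap k X) =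
          (Algebra.TensorProduct.includeLeft :
              AlgebraicClosure k →ₐ[k] AlgebraicClosure k ⊗[k] X).toRingHom.comp
            (algebraMap k (AlgebraicClosure k)) := by
        ext c
        change (1 : AlgebraicClosure k) ⊗ₜ[k] algebraMap k X c = algebraMap k _ c ⊗ₜ[k] (1 : X)
        rw [Algebra.algebraMap_eq_smul_one, Algebra.algebraMap_eq_smul_one, TensorProduct.smul_tmul]
      rw [h2]
      change Polynomial.eval₂ _
          ((Algebra.TensorProduct.includeLeft :
              AlgebraicClosure k →ₐ[k] AlgebraicClosure k ⊗[k] X).toRingHom a) p = 0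
      rw [← Polynomial.hom_eval₂, hpa, map_zero]
    | add x y hx hy => exact hx.add hy
  exact h.2.1 (Ideal.eq_bot_of_comap_eq_bot (R := X) h0)

variable {k : Type} [Field k] [CharZero k] {X : Type} [CommRing X] [IsDomain X] [Algebra k X]
  [Algebra.FiniteType k X] [IsDomain (AlgebraicClosure k ⊗[k] X)]
  {S : Set (Ideal (AlgebraicClosure k ⊗[k] X))} (hS : ∀ P ∈ S, HeightOnePrime P)

omit [IsDomain X] in
/-- A polynomial expression in elements of a local ring which is killed by its maximal ideal. -/
theorem exists_coeff_mem_locM {F : Type*} [Field F] [Algebra X F] {q : Ideal X}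
    (hq : q.IsPrime) {R : Type*} [CommRing R] [IsDomain R] [Algebra R F] [FaithfulSMul R F]
    (hR : ∀ c : R, algebraMap R F c ∈ locO F q hq) {x : F} (hx : x ∈ locM F q hq)
        (hxO : x ∈ locO F q hq)
    (hx0 : x ≠ 0) (halg : IsAlgebraic R x) : ∃ c : R, c ≠ 0 ∧ algebraMap R F c ∈ locM F q hq := by
  obtain ⟨p, hp0, hp⟩ := halg.exists_nonzero_coeff_and_aeval_eq_zero
    (mem_nonZeroDivisors_of_ne_zero hx0)
  refine ⟨p.coeff 0, hp0, ?_⟩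
  have h1 := congrArg (Polynomial.aeval x) (Polynomial.divX_mul_X_add p)
  rw [hp, map_add, map_mul, Polynomial.aeval_X, Polynomial.aeval_C] at h1
  rw [eq_neg_of_add_eq_zero_right h1]
  refine neg_mem (locO_mul_locM hq ?_ hx)
  rw [Polynomial.aeval_eq_sum_range]
  refine sum_mem fun i _ => ?_
  rw [Algebra.smul_def]
  exact mul_mem (hR _) (pow_mem hxO _)


omit [CharZero k] [IsDomain (AlgebraicClosure k ⊗[k] X)] in
theorem exists_transcendence_basis_of_subalgebra {E : Subfield (FractionRing X)}
    {X' : Subalgebra k (FractionRing X)} (hX'E : ∀ x ∈ X', x ∈ E)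
    (hE : ∀ e ∈ E, ∃ d ∈ X', d ≠ 0 ∧ e * d ∈ X') :
    ∃ u : Set (FractionRing X), u.Finite ∧ (∀ x ∈ u, ∃ a : X, x = algebraMap X _ a) ∧
      AlgebraicIndependent E (Subtype.val : u → FractionRing X) ∧
      Algebra.IsAlgebraic (Algebra.adjoin X' (Set.range (Subtype.val : u → FractionRing X)))
        (FractionRing X) := by
  classical
  obtain ⟨s, hs⟩ := (Algebra.FiniteType.out : (⊤ : Subalgebra k X).FG)
  set G : Set (FractionRing X) := algebraMap X (FractionRing X) '' (s : Set X) with hG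
  have hXG : ∀ a : X, algebraMap X (FractionRing X) a ∈ Algebra.adjoin X' G := by
    intro a
    have ha : a ∈ Algebra.adjoin k (s : Set X) := hs ▸ Algebra.mem_top
    induction ha using Algebra.adjoin_induction with
    | mem x hx => exact Algebra.subset_adjoin ⟨x, hx, rfl⟩
    | algebraMap c =>
      rw [← IsScalarTower.algebraMap_apply]
      exact Subalgebra.algebraMap_mem _ (⟨_, X'.algebraMap_mem c⟩ : X')
    | add x y _ _ hx hy => rw [map_add]; exact add_mem hx hy
    | mul x y _ _ hx hy => rw [map_mul]; exact mul_mem hx hy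
  have halg : Algebra.IsAlgebraic (Algebra.adjoin X' G) (FractionRing X) := by
    constructor
    intro x
    obtain ⟨a, b, hb, rfl⟩ := IsFractionRing.div_surjective (A := X) x
    have hb0 : algebraMap X (FractionRing X) b ≠ 0 := by
      simpa using nonZeroDivisors.ne_zero hb
    refine ⟨Polynomial.C ⟨_, hXG b⟩ * Polynomial.X - Polynomial.C ⟨_, hXG a⟩, ?_, ?_⟩
    · intro h
      have := congrArg (fun p => Polynomial.coeff p 1) h
      simp [Polynomial.coeff_C] at this
      exact hb0 ((sub_zero _).symm.trans (congrArg Subtype.val this))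
    · simp only [map_sub, map_mul, Polynomial.aeval_C, Polynomial.aeval_X]
      change algebraMap X _ b * _ - algebraMap X _ a = 0
      field_simp
      ring
  obtain ⟨u, huG, hu⟩ := exists_isTranscendenceBasis_subset (R := X') G
  refine ⟨u, (s.finite_toSet.image _).subset huG, fun x hx => ?_, ?_, hu.isAlgebraic⟩
  · obtain ⟨a, -, rfl⟩ := huG hx
    exact ⟨a, rfl⟩
  · let : Algebra X' E := (RingHom.codRestrict (algebraMap X' (FractionRing X)) E
      (fun x => hX'E _ x.2)).toAlgebra
    have : IsScalarTower X' E (FractionRing X) := IsScalarTower.of_algebraMap_eq fun x => rfl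
    have : Algebra.IsAlgebraic X' E := by
      constructor
      rintro ⟨e, he⟩
      obtain ⟨d, hd, hd0, hed⟩ := hE e he
      refine ⟨Polynomial.C ⟨d, hd⟩ * Polynomial.X - Polynomial.C ⟨_, hed⟩, ?_, ?_⟩
      · intro h
        have := congrArg (fun p => Polynomial.coeff p 1) h
        simp [Polynomial.coeff_C] at this
        exact hd0 (congrArg Subtype.val this)
      · simp only [map_sub, map_mul, Polynomial.aeval_C, Polynomial.aeval_X]
        apply Subtype.ext
        change d * e - e * d = 0
        ring
    exact hu.1.extendScalars E

/-- Almost all members of `S` lie over a proper closed subset of a model of the field of algebraic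
constants of `thetaS`. -/
theorem finite_trace_of_model {X' : Subalgebra k (FractionRing X)}
    (hX'E : ∀ x ∈ X', x ∈ algConstants (thetaS k hS))
    (hE : ∀ e ∈ algConstants (thetaS k hS), ∃ d ∈ X', d ≠ 0 ∧ e * d ∈ X')
    {r : X} (hr : r ≠ 0)
    (hrX : ∀ c ∈ X', ∃ (n : ℕ) (a : X), c * algebraMap X _ r ^ n = algebraMap X _ a) :
    {Q : S | ¬ ∃ c ∈ X', c ≠ 0 ∧
      c ∈ locM (FractionRing X) (trace Q.1) (trace_isPrime (hS _ Q.2))}.Finite := by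
  have : CharZero X := (RingHom.charZero_iff (algebraMap k X).injective).1 inferInstance
  have : CharZero (FractionRing X) :=
      (RingHom.charZero_iff (IsFractionRing.injective X (FractionRing X))).1 this
  obtain ⟨u, hu, huX, hind, halg⟩ := exists_transcendence_basis_of_subalgebra hX'E hE
  choose θ h1 h2 h3 h4 using fun i => exists_dual_derivation _ hind i
  have hmem : ∀ i, θ i ∈ thetaS k hS := fun i =>
    (algFoliation_thetaS k hS).mem_of_isDer (h1 i) (h2 i)
  have : Finite u := hu
  have hfin : {Q : S | r ∈ trace Q.1}.Finite := by
    refine Set.Finite.of_finite_image (f := Subtype.val)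
        ((finite_mem_trace k hr).subset ?_) Subtype.val_injective.injOn
    rintro _ ⟨Q, hQ, rfl⟩
    exact ⟨hS _ Q.2, hQ⟩
  refine (hfin.union (Set.finite_iUnion fun i => ((mem_thetaS k hS).1 (hmem i)).2.2)).subset ?_
  intro Q hQ
  by_contra hcon
  rw [Set.mem_union, not_or] at hcon
  obtain ⟨hrQ, hθQ⟩ := hcon
  have hrQ : r ∉ trace Q.1 := hrQ
  have hθQ : ∀ i, _ := fun i => not_not.1 fun h => hθQ (Set.mem_iUnion.2 ⟨i, h⟩)
  apply hQ
  set hq := trace_isPrime (hS _ Q.2)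
  have hX'O : ∀ c ∈ X', c ∈ locO (FractionRing X) (trace Q.1) hq := by
    intro c hc
    obtain ⟨n, a, h⟩ := hrX c hc
    exact ⟨a, r ^ n, fun h => hrQ (hq.mem_of_pow_mem n h), by rw [map_pow, h]⟩
  have hevO : ∀ p : MvPolynomial u X', MvPolynomial.aeval (Subtype.val : u → FractionRing X) p ∈
      locO (FractionRing X) (trace Q.1) hq := by
    intro p
    induction p using MvPolynomial.induction_on with
    | C c => rw [MvPolynomial.aeval_C]; exact hX'O _ c.2
    | add p q hp hq => rw [map_add]; exact add_mem hp hq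
    | mul_X p i hp =>
      rw [map_mul, MvPolynomial.aeval_X]
      obtain ⟨a, ha⟩ := huX _ i.2
      refine mul_mem hp ?_
      rw [ha]
      exact algebraMap_mem_locO _ _
  have hder : ∀ i, ∀ p : MvPolynomial u X',
      θ i (MvPolynomial.aeval (Subtype.val : u → FractionRing X) p) =
        MvPolynomial.aeval (Subtype.val : u → FractionRing X) (MvPolynomial.pderiv i p) := by
    intro i p
    induction p using MvPolynomial.induction_on with
    | C c => rw [MvPolynomial.aeval_C, MvPolynomial.pderiv_C, map_zero]; exact h2 i _ (hX'E _ c.2)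
    | add p q hp hq => rw [map_add, map_add, (h1 i).add, hp, hq, map_add]
    | mul_X p j hp =>
      rw [map_mul, (h1 i).mul, hp, MvPolynomial.pderiv_mul, map_add, map_mul, map_mul,
        MvPolynomial.aeval_X, add_comm]
      simp only [RingHom.id_apply]
      by_cases hij : j = i
      · subst hij
        rw [h3, MvPolynomial.pderiv_X_self, map_one]
        ring
      · rw [h4 i j hij, MvPolynomial.pderiv_X_of_ne hij, map_zero]
        ring
  obtain ⟨x, hx, hx0⟩ := Submodule.exists_mem_ne_zero_of_ne_bot (trace_ne_bot (hS _ Q.2))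
  obtain ⟨c, hc0, hc⟩ := exists_coeff_mem_locM hq (F := FractionRing X)
    (R := Algebra.adjoin X' (Set.range (Subtype.val : u → FractionRing X)))
    (x := algebraMap X _ x) (by
      rintro ⟨c, hc⟩
      rw [Algebra.adjoin_range_eq_range_aeval] at hc
      obtain ⟨p, rfl⟩ := hc
      exact hevO p)
    (algebraMap_mem_locM hq hx) (algebraMap_mem_locO hq x) (by simpa using hx0) (halg.isAlgebraic _)
  obtain ⟨c, hcR⟩ := c
  rw [Algebra.adjoin_range_eq_range_aeval] at hcR
  obtain ⟨p, rfl⟩ := hcR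
  obtain ⟨e, he0, he⟩ := MvPolynomial.exists_C_mem_of_pderiv_mem
    (J := {p : MvPolynomial u X' | MvPolynomial.aeval (Subtype.val : u → FractionRing X) p ∈
      locM (FractionRing X) (trace Q.1) hq})
    (fun i p hp => by
      rw [Set.mem_ofPred_eq, ← hder]
      exact (hθQ i).2 _ hp)
    (p := p) hc (fun h => hc0 (by apply Subtype.ext; subst h; simp))
  refine ⟨e, e.2, fun h => he0 (Subtype.ext h), ?_⟩
  rw [Set.mem_ofPred_eq, MvPolynomial.aeval_C] at he
  exact he

end Vertical

section Divisors

variable {A A₁ B : Type} [CommRing A] [IsDomain A] [CharZero A] [IsNoetherianRing A]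
  [CommRing A₁] [CommRing B] [IsDomain B] [IsNoetherianRing B]

/-- A set of prime divisors upstairs, almost all of which lie over a proper closed subset, comes
up to finitely many exceptions from a set of prime divisors downstairs. -/
theorem exists_heightOnePrime_set {f : A →+* B} (hf : Function.Injective f) (hft : f.FiniteType)
    (hcl : FracRelAlgClosedVia f) {P : Ideal B → Prop}
    (hP : {Q | HeightOnePrime Q ∧ P Q ∧ Q.comap f = ⊥}.Finite) :
    ∃ S' : Set (Ideal A), (∀ t ∈ S', HeightOnePrime t) ∧
      {Q | HeightOnePrime Q ∧ ¬ (P Q ↔ Q.comap f ∈ S')}.Finite := by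
  obtain ⟨a, ha, b, hb, -, h2, h3⟩ := exists_prime_divisor_over hf hft hcl
  refine ⟨{t | HeightOnePrime t ∧ ∃ Q, HeightOnePrime Q ∧ b ∉ Q ∧ P Q ∧ Q.comap f = t},
    fun t ht => ht.1, ?_⟩
  have hfa : f a ≠ 0 := fun h => ha (hf (h.trans (map_zero f).symm))
  refine (hP.union ((finite_heightOnePrime_mem hb).union (finite_heightOnePrime_mem hfa))).subset ?_
  rintro Q ⟨hQ, hQP⟩
  by_contra hcon
  simp only [Set.mem_union, not_or, Set.mem_ofPred_eq, not_and] at hcon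
  obtain ⟨hc1, hc2, hc3⟩ := hcon
  have hbQ := hc2 hQ
  have haQ := hc3 hQ
  apply hQP
  constructor
  · intro h
    exact ⟨h2 Q hQ hbQ (hc1 hQ h) haQ, Q, hQ, hbQ, h, rfl⟩
  · rintro ⟨ht, Q', hQ', hbQ', hPQ', h⟩
    rwa [← h3 Q' Q hQ' hQ hbQ' hbQ h (h ▸ ht.2.1) (h ▸ haQ)]

/-- Comparison of two sets of prime divisors can be checked upstairs. -/
theorem finite_of_finite_comap {f : A →+* B} (hf : Function.Injective f) (hft : f.FiniteType)
    (hcl : FracRelAlgClosedVia f) {P : Ideal B → Prop} {P₁ P₂ : Ideal A → Prop}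
    (h₁ : {Q | HeightOnePrime Q ∧ ¬ (P Q ↔ P₁ (Q.comap f))}.Finite)
    (h₂ : {Q | HeightOnePrime Q ∧ ¬ (P Q ↔ P₂ (Q.comap f))}.Finite) :
    {t | HeightOnePrime t ∧ ¬ (P₁ t ↔ P₂ t)}.Finite := by
  obtain ⟨a, ha, b, hb, h1, -, -⟩ := exists_prime_divisor_over hf hft hcl
  refine ((finite_heightOnePrime_mem ha).union ((h₁.union h₂).image (Ideal.comap f))).subset ?_
  rintro t ⟨ht, htP⟩
  by_cases hat : a ∈ t
  · exact Or.inl ⟨ht, hat⟩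
  obtain ⟨Q, hQ, rfl, -⟩ := h1 t ht hat
  refine Or.inr ⟨Q, ?_, rfl⟩
  by_cases hP : P Q ↔ P₁ (Q.comap f)
  · exact Or.inr ⟨hQ, fun h => htP (hP.symm.trans h)⟩
  · exact Or.inl ⟨hQ, hP⟩

end Divisors

section Transport

variable {k : Type} [Field k] {X : Type} [CommRing X] [IsDomain X] [Algebra k X]
  [Algebra.FiniteType k X] [IsDomain (AlgebraicClosure k ⊗[k] X)]
  {Y : Type} [CommRing Y] [Algebra k Y] [Algebra.FiniteType k Y]
      [IsDomain (AlgebraicClosure k ⊗[k] Y)]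
  {S : Set (Ideal (AlgebraicClosure k ⊗[k] X))} {T : Set (Ideal (AlgebraicClosure k ⊗[k] Y))}

omit [IsDomain X] [IsDomain (AlgebraicClosure k ⊗[k] X)] in
theorem isNoetherianRing_tensor_away (r : X) :
    IsNoetherianRing (AlgebraicClosure k ⊗[k] Localization.Away r) := by
  have : Algebra.FiniteType X (Localization.Away r) :=
      IsLocalization.finiteType_of_monoid_fg (.powers r) _
  have : Algebra.FiniteType k (Localization.Away r) := .trans (S := X) ‹_› ‹_›
  infer_instance

omit [IsDomain X] in
theorem isVMor_iff_finite (hT : ∀ t ∈ T, HeightOnePrime t) {r : X} (hr : r ≠ 0)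
    (f : Y →ₐ[k] Localization.Away r) :
    IsVMor k S T r f ↔ Function.Injective f ∧ FracRelAlgClosedVia (baseChange k f) ∧
      {Q : Ideal (AlgebraicClosure k ⊗[k] Localization.Away r) | HeightOnePrime Q ∧
        ¬ (Q.comap (baseChange k (IsScalarTower.toAlgHom k X (Localization.Away r))) ∈ S ↔
          Q.comap (baseChange k f) ∈ T)}.Finite := by
  have := isDomain_tensor_away (k := k) hr
  have := isNoetherianRing_tensor_away (k := k) r
  refine and_congr_right fun hf => and_congr_right fun _ => iff_of_eq (congrArg Set.Finite ?_)
  ext Q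
  have h : Q ∈ (⋃ t ∈ T, PTset (baseChange k f) t) ↔
      HeightOnePrime Q ∧ Q.comap (baseChange k f) ∈ T := by
    simp only [Set.mem_iUnion]
    constructor
    · rintro ⟨t, ht, hQ⟩
      obtain ⟨h1, rfl⟩ := (mem_PTset_iff (baseChange_injective hf) (hT t ht)).1 hQ
      exact ⟨h1, ht⟩
    · rintro ⟨h1, h2⟩
      exact ⟨_, h2, (mem_PTset_iff (baseChange_injective hf) (hT _ h2)).2 ⟨h1, rfl⟩⟩
  rw [Set.mem_symmDiff, h]
  simp only [Set.mem_ofPred_eq]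
  tauto

omit [Algebra.FiniteType k X] [IsDomain (AlgebraicClosure k ⊗[k] X)] in
theorem exists_awayMap {r R : X} (hR : R ≠ 0) (h : r ∣ R) :
    ∃ g : Localization.Away r →ₐ[k] Localization.Away R,
      (∀ x, g (algebraMap X _ x) = algebraMap X _ x) ∧
      IsAwayHom g.toRingHom (algebraMap X (Localization.Away r) R) := by
  have hu : ∀ y : Submonoid.powers r,
      IsUnit (IsScalarTower.toAlgHom k X (Localization.Away R) y) := by
    rintro ⟨_, n, rfl⟩
    have h1 : IsUnit (algebraMap X (Localization.Away R) R) :=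
      IsLocalization.Away.algebraMap_isUnit R
    have h2 := isUnit_of_dvd_unit (map_dvd (algebraMap X (Localization.Away R)) h) h1
    change IsUnit (algebraMap X (Localization.Away R) (r ^ n))
    rw [map_pow]
    exact h2.pow n
  let g : Localization.Away r →ₐ[k] Localization.Away R :=
    IsLocalization.liftAlgHom (M := Submonoid.powers r) hu
  have hg : ∀ x, g (algebraMap X _ x) = algebraMap X _ x := fun x =>
    IsLocalization.lift_eq (M := Submonoid.powers r) hu x
  have hr : r ≠ 0 := fun h0 => hR (by rw [h0] at h; exact zero_dvd_iff.1 h)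
  obtain ⟨ιr, hιr⟩ := exists_awayEmb hr
  obtain ⟨ι, hι⟩ := exists_awayEmb hR
  have hcomp : ι.comp g.toRingHom = ιr := by
    apply awayEmb_unique _ hιr
    rw [← hι]
    ext x
    exact congrArg ι (hg x)
  have hinj : Function.Injective g := by
    intro x y hxy
    apply awayEmb_injective hιr
    rw [← hcomp]
    exact congrArg ι hxy
  refine ⟨g, hg, ?_⟩
  let := g.toRingHom.toAlgebra
  change IsLocalization _ _
  have hmap : ∀ x : Localization.Away r, algebraMap _ (Localization.Away R) x = g x := fun x => rfl
  refine ⟨⟨?_, ?_, ?_⟩⟩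
  · rintro ⟨_, n, rfl⟩
    rw [hmap]
    simp only [map_pow, hg]
    exact (IsLocalization.Away.algebraMap_isUnit R).pow n
  · intro z
    obtain ⟨⟨a, _, n, rfl⟩, hz⟩ := IsLocalization.surj (Submonoid.powers R) z
    refine ⟨⟨algebraMap X _ a, _, n, rfl⟩, ?_⟩
    simp only [hmap, map_pow, hg]
    simpa using hz
  · intro x y hxy
    exact ⟨1, by rw [hinj hxy]⟩

omit [Algebra.FiniteType k Y] [IsDomain (AlgebraicClosure k ⊗[k] Y)] in
theorem finite_away_iff {r R : X} (hr : r ≠ 0) (hR : R ≠ 0)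
    {g : Localization.Away r →ₐ[k] Localization.Away R}
    (hg : ∀ x, g (algebraMap X _ x) = algebraMap X _ x)
    (hga : IsAwayHom g.toRingHom (algebraMap X (Localization.Away r) R))
    (f : Y →ₐ[k] Localization.Away r) :
    {Q : Ideal (AlgebraicClosure k ⊗[k] Localization.Away R) | HeightOnePrime Q ∧
        ¬ (Q.comap (baseChange k (IsScalarTower.toAlgHom k X (Localization.Away R))) ∈ S ↔
          Q.comap (baseChange k (g.comp f)) ∈ T)}.Finite ↔
    {Q : Ideal (AlgebraicClosure k ⊗[k] Localization.Away r) | HeightOnePrime Q ∧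
        ¬ (Q.comap (baseChange k (IsScalarTower.toAlgHom k X (Localization.Away r))) ∈ S ↔
          Q.comap (baseChange k f) ∈ T)}.Finite := by
  have := isDomain_tensor_away (k := k) hr
  have := isNoetherianRing_tensor_away (k := k) r
  have := isDomain_tensor_away (k := k) hR
  have h0 : algebraMap X (Localization.Away r) R ≠ 0 := by
    obtain ⟨ι, hι⟩ := exists_awayEmb hr
    intro h
    apply hR
    apply FaithfulSMul.algebraMap_injective X (FractionRing X)
    rw [← hι, RingHom.comp_apply, h, map_zero, map_zero]
  have h1 : IsScalarTower.toAlgHom k X (Localization.Away R) =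
      g.comp (IsScalarTower.toAlgHom k X (Localization.Away r)) := by
    ext x
    exact (hg x).symm
  rw [h1, baseChange_comp, baseChange_comp]
  simp only [← Ideal.comap_comap]
  exact (baseChange_isAwayHom hga).finite_iff (one_tmul_ne_zero h0)
    (fun Q => ¬ (Q.comap (baseChange k (IsScalarTower.toAlgHom k X (Localization.Away r))) ∈ S ↔
          Q.comap (baseChange k f) ∈ T))

end Transport

section Lift

variable {k : Type} [Field k]

theorem awayEmb_algebraMap {Z : Type} [CommRing Z] [IsDomain Z] [Algebra k Z] {s : Z}
    {ι : Localization.Away s →+* FractionRing Z}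
    (hι : ι.comp (algebraMap Z (Localization.Away s)) = algebraMap Z (FractionRing Z)) (c : k) :
    ι (algebraMap k _ c) = algebraMap k _ c := by
  rw [IsScalarTower.algebraMap_apply k Z, IsScalarTower.algebraMap_apply k Z (FractionRing Z), ← hι]
  rfl

theorem exists_awayEmb_eq_div {Z : Type} [CommRing Z] [IsDomain Z] {s : Z}
    {ι : Localization.Away s →+* FractionRing Z}
    (hι : ι.comp (algebraMap Z (Localization.Away s)) = algebraMap Z (FractionRing Z))
    (x : FractionRing Z) : ∃ a b : Localization.Away s, b ≠ 0 ∧ x = ι a / ι b := by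
  obtain ⟨a, b, hb, rfl⟩ := IsFractionRing.div_surjective (A := Z) x
  refine ⟨algebraMap Z _ a, algebraMap Z _ b, fun h => ?_, ?_⟩
  · apply nonZeroDivisors.ne_zero hb
    apply FaithfulSMul.algebraMap_injective Z (FractionRing Z)
    rw [← hι, RingHom.comp_apply, h, map_zero, map_zero]
  · rw [← hι]
    rfl

/-- A finitely generated algebra mapping to the function field maps to the ring of functions on
a basic open subset. -/
theorem exists_lift_away {W Z : Type} [CommRing W] [Algebra k W] [Algebra.FiniteType k W]
    [CommRing Z] [IsDomain Z] [Algebra k Z] (j : W →ₐ[k] FractionRing Z) :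
    ∃ s : Z, s ≠ 0 ∧ ∃ ψ : W →ₐ[k] Localization.Away s,
      ∀ ι : Localization.Away s →+* FractionRing Z,
        ι.comp (algebraMap Z (Localization.Away s)) = algebraMap Z (FractionRing Z) →
        ∀ x, ι (ψ x) = j x := by
  classical
  obtain ⟨G, hG⟩ := (Algebra.FiniteType.out : (⊤ : Subalgebra k W).FG)
  obtain ⟨⟨s, hs⟩, hsG⟩ := IsLocalization.exist_integer_multiples_of_finset (nonZeroDivisors Z)
    (G.image j)
  have hs0 := nonZeroDivisors.ne_zero hs
  obtain ⟨ι, hι⟩ := exists_awayEmb hs0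
  have hinj := awayEmb_injective hι
  let ιk : Localization.Away s →ₐ[k] FractionRing Z := ⟨ι, awayEmb_algebraMap hι⟩
  have hs1 : algebraMap Z (FractionRing Z) s ≠ 0 := by simpa using hs0
  have hrange : ∀ x, j x ∈ ιk.range := by
    intro x
    have hx : x ∈ Algebra.adjoin k (G : Set W) := hG ▸ Algebra.mem_top
    induction hx using Algebra.adjoin_induction with
    | mem x hx =>
      obtain ⟨a, ha⟩ := hsG (j x) (Finset.mem_image_of_mem j hx)
      refine ⟨IsLocalization.mk' _ a ⟨s, Submonoid.mem_powers s⟩, ?_⟩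
      change ι _ = _
      have h1 := congrArg ι (IsLocalization.mk'_spec (Localization.Away s) a
        (⟨s, Submonoid.mem_powers s⟩ : Submonoid.powers s))
      rw [map_mul, ← RingHom.comp_apply, ← RingHom.comp_apply, hι, ha] at h1
      apply mul_right_cancel₀ hs1
      rw [h1, Algebra.smul_def, mul_comm]
    | algebraMap c => rw [j.commutes]; exact Subalgebra.algebraMap_mem _ c
    | add x y _ _ hx hy => rw [map_add]; exact add_mem hx hy
    | mul x y _ _ hx hy => rw [map_mul]; exact mul_mem hx hy
  refine ⟨s, hs0, (AlgEquiv.ofInjective ιk hinj).symm.toAlgHom.comp (j.codRestrict _ hrange), ?_⟩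
  intro ι' hι' x
  rw [awayEmb_unique hι' hι]
  exact congrArg Subtype.val
    ((AlgEquiv.ofInjective ιk hinj).apply_symm_apply (j.codRestrict _ hrange x))

theorem baseChange_finiteType {A X : Type} [CommRing A] [Algebra k A] [CommRing X] [Algebra k X]
    [Algebra.FiniteType k X] {r : X} (f : A →ₐ[k] Localization.Away r) :
    (baseChange k f).FiniteType := by
  have : Algebra.FiniteType X (Localization.Away r) :=
    IsLocalization.finiteType_of_monoid_fg (.powers r) _
  have : Algebra.FiniteType k (Localization.Away r) := .trans (S := X) ‹_› ‹_›
  refine RingHom.FiniteType.of_comp_finiteType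
    (f := algebraMap (AlgebraicClosure k) (AlgebraicClosure k ⊗[k] A)) ?_
  have h : (baseChange k f).comp (algebraMap (AlgebraicClosure k) (AlgebraicClosure k ⊗[k] A)) =
      algebraMap (AlgebraicClosure k) (AlgebraicClosure k ⊗[k] Localization.Away r) :=
    (Algebra.TensorProduct.map (AlgHom.id (AlgebraicClosure k) (AlgebraicClosure k))
        f).comp_algebraMap
  rw [h, RingHom.finiteType_algebraMap]
  infer_instance

end Lift

section Descent

variable {k : Type} [Field k] [CharZero k] {X : Type} [CommRing X] [IsDomain X] [Algebra k X]
  {Y : Type} [CommRing Y] [IsDomain Y] [Algebra k Y] {r : X} {φ : Y →ₐ[k] Localization.Away r}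
  {ι : Localization.Away r →+* FractionRing X} {Φ : FractionRing Y →+* FractionRing X}

omit [CharZero k] in
/-- The function field of the target of a morphism with geometrically irreducible generic fibre is
algebraically closed in the function field of the source. -/
theorem mem_fieldRange_of_isAlgebraic (hφ : FracRelAlgClosedVia (baseChange k φ))
    (hι : ι.comp (algebraMap X (Localization.Away r)) = algebraMap X (FractionRing X))
    (hΦ : Φ.comp (algebraMap Y (FractionRing Y)) = ι.comp φ.toRingHom)
    {x : FractionRing X} (hx : IsAlgebraic Φ.fieldRange x) : x ∈ Φ.fieldRange := by
  let := Φ.toAlgebra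
  let : Algebra Y (FractionRing X) := (ι.comp φ.toRingHom).toAlgebra
  have : IsScalarTower Y (FractionRing Y) (FractionRing X) :=
    IsScalarTower.of_algebraMap_eq fun y => (RingHom.congr_fun hΦ y).symm
  have h1 : IsAlgebraic (FractionRing Y) x := by
    obtain ⟨p, hp, hpx⟩ := hx
    obtain ⟨q, hq⟩ := Polynomial.map_surjective Φ.rangeRestrictField
      (fun ⟨_, y, hy⟩ => ⟨y, Subtype.ext hy⟩) p
    refine ⟨q, fun h => hp (by rw [← hq, h, Polynomial.map_zero]), ?_⟩
    rw [← hpx, ← hq, Polynomial.aeval_def, Polynomial.aeval_def, Polynomial.eval₂_map]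
    rfl
  rw [← IsFractionRing.isAlgebraic_iff Y] at h1
  obtain ⟨p, hp, hpx⟩ := h1
  obtain ⟨c, d, hd, h⟩ := mem_of_fracRelAlgClosedVia hφ (awayEmb_injective hι)
    (exists_awayEmb_eq_div hι) hp hpx
  have hΦy : ∀ y, Φ (algebraMap Y _ y) = ι (φ y) := fun y => RingHom.congr_fun hΦ y
  refine ⟨algebraMap Y _ c / algebraMap Y _ d, ?_⟩
  have hd' : ι (φ d) ≠ 0 := by
    rw [← hΦy, Ne, map_eq_zero]
    simpa using hd
  rw [map_div₀, hΦy, hΦy, ← h, mul_div_cancel_right₀ _ hd']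

theorem IsVMor.algConstants_le [Algebra.FiniteType k X] [IsDomain (AlgebraicClosure k ⊗[k] X)]
    {S : Set (Ideal (AlgebraicClosure k ⊗[k] X))} (hS : ∀ P ∈ S, HeightOnePrime P)
    {T : Set (Ideal (AlgebraicClosure k ⊗[k] Y))} (hr : r ≠ 0) (hφ : IsVMor k S T r φ)
    (hι : ι.comp (algebraMap X (Localization.Away r)) = algebraMap X (FractionRing X))
    (hΦ : Φ.comp (algebraMap Y (FractionRing Y)) = ι.comp φ.toRingHom) :
    algConstants (thetaS k hS) ≤ Φ.fieldRange := by
  have : CharZero X := (RingHom.charZero_iff (algebraMap k X).injective).1 inferInstance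
  have : CharZero (FractionRing X) :=
    (RingHom.charZero_iff (IsFractionRing.injective X (FractionRing X))).1 this
  refine _root_.algConstants_le (fun θ hθ => ((_root_.mem_thetaS k hS).1 hθ).1)
    (fun x hx => mem_fieldRange_of_isAlgebraic hφ.2.1 hι hΦ hx)
    (fun θ hθ h0 => hφ.mem_thetaS hS hr hι hθ fun y => h0 _ ⟨algebraMap Y _ y, ?_⟩)
  exact RingHom.congr_fun hΦ y

end Descent

section Terminal

theorem isDomain_of_baseChange {k : Type} [Field k] {X : Type} [CommRing X] [Algebra k X]
    [IsDomain (AlgebraicClosure k ⊗[k] X)] {r : X} (hr : r ≠ 0) {A : Type} [CommRing A]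
    [Algebra k A] {f : A →ₐ[k] Localization.Away r} (hf : Function.Injective f) :
    IsDomain (AlgebraicClosure k ⊗[k] A) :=
  have := isDomain_tensor_away (k := k) hr
  (baseChange_injective hf).isDomain (baseChange k f)

theorem charZero_tensor (k : Type) [Field k] [CharZero k] (A : Type) [CommRing A] [Algebra k A]
    [IsDomain (AlgebraicClosure k ⊗[k] A)] : CharZero (AlgebraicClosure k ⊗[k] A) :=
  (RingHom.charZero_iff (algebraMap k (AlgebraicClosure k ⊗[k] A)).injective).1 inferInstance

variable {k : Type} [Field k] [CharZero k] {X : Type} [CommRing X] [IsDomain X] [Algebra k X]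
  [Algebra.FiniteType k X] [IsDomain (AlgebraicClosure k ⊗[k] X)]
  {S : Set (Ideal (AlgebraicClosure k ⊗[k] X))} (hS : ∀ P ∈ S, HeightOnePrime P)

theorem finite_comap_eq_bot {X' : Subalgebra k (FractionRing X)}
    (hX'E : ∀ x ∈ X', x ∈ algConstants (thetaS k hS))
    (hE : ∀ e ∈ algConstants (thetaS k hS), ∃ d ∈ X', d ≠ 0 ∧ e * d ∈ X')
    {r : X} (hr : r ≠ 0) {π : X' →ₐ[k] Localization.Away r}
    {ι : Localization.Away r →+* FractionRing X}
    (hι : ι.comp (algebraMap X (Localization.Away r)) = algebraMap X (FractionRing X))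
    (hπ : ∀ x : X', ι (π x) = (x : FractionRing X)) :
    {Q : Ideal (AlgebraicClosure k ⊗[k] Localization.Away r) | HeightOnePrime Q ∧
      Q.comap (baseChange k (IsScalarTower.toAlgHom k X (Localization.Away r))) ∈ S ∧
      Q.comap (baseChange k π) = ⊥}.Finite := by
  have hιa : ∀ a, ι (algebraMap X _ a) = algebraMap X _ a := fun a => RingHom.congr_fun hι a
  have hfin := finite_trace_of_model hS hX'E hE hr (fun c hc => by
    obtain ⟨⟨a, _, n, rfl⟩, h⟩ := IsLocalization.surj (Submonoid.powers r) (π ⟨c, hc⟩)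
    refine ⟨n, a, ?_⟩
    have h1 := congrArg ι h
    rwa [map_mul, hπ, hιa, hιa, map_pow] at h1)
  refine Set.Finite.of_finite_image ((hfin.image Subtype.val).subset ?_)
    (isAwayHom_baseChange_away (k := k) r).comap_injective.injOn
  rintro _ ⟨Q, ⟨hQ, hQS, hQ0⟩, rfl⟩
  refine ⟨⟨_, hQS⟩, ?_, rfl⟩
  rintro ⟨c, hc, hc0, a, b, ha, hb, h⟩
  have h1 : π ⟨c, hc⟩ * algebraMap X _ b = algebraMap X _ a := by
    apply awayEmb_injective hι
    rw [map_mul, hπ, hιa, hιa, h]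
  have htr : ∀ x : X, x ∈ trace (Q.comap (baseChange k
      (IsScalarTower.toAlgHom k X (Localization.Away r)))) ↔
      (1 : AlgebraicClosure k) ⊗ₜ[k] algebraMap X (Localization.Away r) x ∈ Q := fun x => Iff.rfl
  rw [htr, ← h1, ← mul_one (1 : AlgebraicClosure k), ← Algebra.TensorProduct.tmul_mul_tmul] at ha
  rw [htr] at hb
  have h2 : (1 : AlgebraicClosure k) ⊗ₜ[k] (⟨c, hc⟩ : X') ∈ Q.comap (baseChange k π) :=
    (hQ.1.mem_or_mem ha).resolve_right hb
  rw [hQ0] at h2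
  exact hc0 (congrArg Subtype.val (by_contra fun h => one_tmul_ne_zero (k := k) h h2 :
    (⟨c, hc⟩ : X') = 0))

/-- Descent of the divisor condition along a factorization `W → Y_s` of a morphism to `W` through
a morphism to `Y`. -/
theorem IsVMor.descend {W Y : Type} [CommRing W] [Algebra k W] [Algebra.FiniteType k W]
    [CommRing Y] [IsDomain Y] [Algebra k Y] [Algebra.FiniteType k Y]
    [IsDomain (AlgebraicClosure k ⊗[k] Y)]
    {T : Set (Ideal (AlgebraicClosure k ⊗[k] Y))} (hT : ∀ P ∈ T, HeightOnePrime P)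
    {S' : Set (Ideal (AlgebraicClosure k ⊗[k] W))} (hS' : ∀ P ∈ S', HeightOnePrime P)
    {r₀ r₁ : X} (hr₀ : r₀ ≠ 0) (hr₁ : r₁ ≠ 0) {π : W →ₐ[k] Localization.Away r₀}
    (hπ : IsVMor k S S' r₀ π) {φ : Y →ₐ[k] Localization.Away r₁} (hφ : IsVMor k S T r₁ φ)
    {ι₀ : Localization.Away r₀ →+* FractionRing X} {ι₁ : Localization.Away r₁ →+* FractionRing X}
    (hι₀ : ι₀.comp (algebraMap X (Localization.Away r₀)) = algebraMap X (FractionRing X))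
    (hι₁ : ι₁.comp (algebraMap X (Localization.Away r₁)) = algebraMap X (FractionRing X))
    {Φ : FractionRing Y →+* FractionRing X}
    (hΦ : Φ.comp (algebraMap Y (FractionRing Y)) = ι₁.comp φ.toRingHom)
    {s : Y} (hs : s ≠ 0) {ψ : W →ₐ[k] Localization.Away s}
    (hψ : Function.Injective ψ) (hψcl : FracRelAlgClosedVia (baseChange k ψ))
    {ιY : Localization.Away s →+* FractionRing Y}
    (hιY : ιY.comp (algebraMap Y (Localization.Away s)) = algebraMap Y (FractionRing Y))
    (hcomp : ∀ w, Φ (ιY (ψ w)) = ι₀ (π w)) : IsVMor k T S' s ψ := by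
  have : IsDomain W := by
    have := isDomain_away hr₀
    exact hπ.1.isDomain π
  have := isDomain_away hs
  have := isDomain_tensor_away (k := k) hs
  have := isDomain_of_baseChange hr₀ hπ.1
  have := isNoetherianRing_tensor_away (k := k) s
  have := charZero_tensor k (Localization.Away s)
  have : Algebra.FiniteType Y (Localization.Away s) :=
    IsLocalization.finiteType_of_monoid_fg (.powers s) _
  have : Algebra.FiniteType k (Localization.Away s) := .trans (S := Y) ‹_› ‹_›
  have hΦy : ∀ y, Φ (algebraMap Y _ y) = ι₁ (φ y) := fun y => RingHom.congr_fun hΦ y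
  have hιYa : ∀ a, ιY (algebraMap Y _ a) = algebraMap Y _ a := fun a => RingHom.congr_fun hιY a
  have hΦk : ∀ c : k, Φ (algebraMap k _ c) = algebraMap k _ c := fun c => by
    rw [IsScalarTower.algebraMap_apply k Y (FractionRing Y), hΦy, φ.commutes,
      awayEmb_algebraMap hι₁]
  obtain ⟨r₂, hr₂, f₀, hf₀⟩ := exists_lift_away (W := Localization.Away s) (Z := X)
    ((⟨Φ, hΦk⟩ : FractionRing Y →ₐ[k] FractionRing X).comp ⟨ιY, awayEmb_algebraMap hιY⟩)
  set R := r₀ * r₁ * r₂ with hRdef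
  have hR : R ≠ 0 := mul_ne_zero (mul_ne_zero hr₀ hr₁) hr₂
  obtain ⟨g₀, hg₀, hg₀'⟩ := exists_awayMap (k := k) hR (r := r₀) ⟨r₁ * r₂, by rw [hRdef]; ring⟩
  obtain ⟨g₁, hg₁, hg₁'⟩ := exists_awayMap (k := k) hR (r := r₁) ⟨r₀ * r₂, by rw [hRdef]; ring⟩
  obtain ⟨g₂, hg₂, hg₂'⟩ := exists_awayMap (k := k) hR (r := r₂) ⟨r₀ * r₁, by rw [hRdef]; ring⟩
  obtain ⟨ι, hι⟩ := exists_awayEmb hR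
  have hinj := awayEmb_injective hι
  have hιg : ∀ {r : X} {ι' : Localization.Away r →+* FractionRing X}
      (_ : ι'.comp (algebraMap X (Localization.Away r)) = algebraMap X (FractionRing X))
      {g : Localization.Away r →ₐ[k] Localization.Away R}
      (_ : ∀ x, g (algebraMap X _ x) = algebraMap X _ x) (x), ι (g x) = ι' x := by
    intro r ι' hι' g hg x
    have : ι.comp g.toRingHom = ι' := by
      apply awayEmb_unique _ hι'
      rw [← hι]
      ext x
      exact congrArg ι (hg x)
    exact RingHom.congr_fun this x
  obtain ⟨ι₂, hι₂⟩ := exists_awayEmb hr₂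
  set f := g₂.comp f₀
  have hf : ∀ y, ι (f y) = Φ (ιY y) := fun y =>
    (hιg hι₂ hg₂ (f₀ y)).trans (hf₀ ι₂ hι₂ y)
  have hfinj : Function.Injective f := fun x y hxy =>
    awayEmb_injective hιY (Φ.injective (by rw [← hf, ← hf, hxy]))
  have hfcl : FracRelAlgClosedVia (baseChange k f) := by
    refine fracRelAlgClosedVia_of_isAlgClosed hι hfinj Φ.fieldRange
      (fun x hx => mem_fieldRange_of_isAlgebraic hφ.2.1 hι₁ hΦ hx) (fun c => ⟨_, (hf c).symm⟩) ?_
    rintro _ ⟨e, rfl⟩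
    obtain ⟨a, b, hb, rfl⟩ := exists_awayEmb_eq_div hιY e
    refine ⟨b, hb, a, ?_⟩
    rw [hf, hf, ← map_mul, mul_div_cancel₀]
    exact fun h => hb (awayEmb_injective hιY (h.trans (map_zero _).symm))
  have h0 : f.comp ψ = g₀.comp π := by
    ext w
    apply hinj
    exact (hf _).trans ((hcomp w).trans (hιg hι₀ hg₀ _).symm)
  have h1 : f.comp (IsScalarTower.toAlgHom k Y (Localization.Away s)) = g₁.comp φ := by
    ext y
    apply hinj
    refine (hf _).trans (Eq.trans ?_ (hιg hι₁ hg₁ _).symm)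
    exact (congrArg Φ (hιYa y)).trans (hΦy y)
  have h0' := (finite_away_iff hr₀ hR hg₀ hg₀' π).2 ((isVMor_iff_finite hS' hr₀ π).1 hπ).2.2
  have h1' := (finite_away_iff hr₁ hR hg₁ hg₁' φ).2 ((isVMor_iff_finite hT hr₁ φ).1 hφ).2.2
  rw [← h0, baseChange_comp] at h0'
  rw [← h1, baseChange_comp] at h1'
  simp only [← Ideal.comap_comap (g := baseChange k f)] at h0' h1'
  have := isDomain_tensor_away (k := k) hR
  have := isNoetherianRing_tensor_away (k := k) R
  refine (isVMor_iff_finite hS' hs ψ).2 ⟨hψ, hψcl, ?_⟩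
  exact finite_of_finite_comap (baseChange_injective hfinj) (baseChange_finiteType f) hfcl
    (P := fun Q => Q.comap (baseChange k (IsScalarTower.toAlgHom k X (Localization.Away R))) ∈ S)
    (P₁ := fun t => t.comap (baseChange k (IsScalarTower.toAlgHom k Y (Localization.Away s))) ∈ T)
    (P₂ := fun t => t.comap (baseChange k ψ) ∈ S') h1' h0'

end Terminal

theorem isAlgebraic_map_of_comap {F G : Type*} [Field F] [Field G] (Φ : F →+* G) {E : Subfield G}
    {x : F} (hx : IsAlgebraic (E.comap Φ) x) : IsAlgebraic E (Φ x) := by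
  obtain ⟨p, hp, hpx⟩ := hx
  let Φ' : E.comap Φ →+* E := (Φ.comp (E.comap Φ).subtype).codRestrict E fun x => x.2
  refine ⟨p.map Φ', (Polynomial.map_ne_zero_iff Φ'.injective).2 hp, ?_⟩
  have h := congrArg Φ hpx
  rw [map_zero, Polynomial.aeval_def, Polynomial.hom_eval₂] at h
  rw [Polynomial.aeval_def, Polynomial.eval₂_map]
  exact h

theorem exists_algHom_lift {k F G : Type*} [Field k] [Field F] [Field G] [Algebra k F] [Algebra k G]
    (Φ : F →ₐ[k] G) {X' : Subalgebra k G} (h : ∀ x ∈ X', x ∈ (Φ : F →+* G).fieldRange) :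
    ∃ j : X' →ₐ[k] F, ∀ x : X', Φ (j x) = x := by
  let e := AlgEquiv.ofInjective Φ Φ.injective
  let i : X' →ₐ[k] Φ.range := X'.val.codRestrict Φ.range fun x => h x x.2
  exact ⟨e.symm.toAlgHom.comp i, fun x => congrArg Subtype.val (e.apply_symm_apply (i x))⟩

section Factor

variable {k : Type} [Field k] {X Y : Type} [CommRing X] [IsDomain X] [Algebra k X]
  [CommRing Y] [IsDomain Y] [Algebra k Y]

omit [IsDomain Y] in
/-- The embeddings of function fields induced by a dominant map are determined by it. -/
theorem functionFieldEmb_unique {r : X} {φ : Y →ₐ[k] Localization.Away r}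
    {ι ι' : Localization.Away r →+* FractionRing X} {Φ Φ' : FractionRing Y →+* FractionRing X}
    (hι : ι.comp (algebraMap X (Localization.Away r)) = algebraMap X (FractionRing X))
    (hι' : ι'.comp (algebraMap X (Localization.Away r)) = algebraMap X (FractionRing X))
    (hΦ : Φ.comp (algebraMap Y (FractionRing Y)) = ι.comp φ.toRingHom)
    (hΦ' : Φ'.comp (algebraMap Y (FractionRing Y)) = ι'.comp φ.toRingHom) : Φ = Φ' := by
  rw [awayEmb_unique hι hι', ← hΦ'] at hΦ
  exact IsLocalization.ringHom_ext (nonZeroDivisors Y) hΦ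

theorem exists_extend_fractionRing {A L : Type*} [CommRing A] [IsDomain A] [Field L] {g : A →+* L}
    (hg : Function.Injective g) :
    ∃ Φ : FractionRing A →+* L, Φ.comp (algebraMap A (FractionRing A)) = g :=
  ⟨IsFractionRing.lift hg, RingHom.ext fun y => IsFractionRing.lift_algebraMap hg y⟩

theorem exists_functionFieldEmb {r : X} {φ : Y →ₐ[k] Localization.Away r}
    (hφ : Function.Injective φ) {ι : Localization.Away r →+* FractionRing X}
    (hι : ι.comp (algebraMap X (Localization.Away r)) = algebraMap X (FractionRing X)) :
    ∃ Φ : FractionRing Y →+* FractionRing X,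
      Φ.comp (algebraMap Y (FractionRing Y)) = ι.comp φ.toRingHom := by
  have hinj : Function.Injective (ι.comp φ.toRingHom) := (awayEmb_injective hι).comp hφ
  exact exists_extend_fractionRing hinj

/-- Every morphism from `(X, S)` factors the morphism to a model of the field of algebraic
constants of `thetaS`. -/
theorem IsVMor.exists_factorization [CharZero k] [Algebra.FiniteType k X]
    [IsDomain (AlgebraicClosure k ⊗[k] X)] [Algebra.FiniteType k Y]
    [IsDomain (AlgebraicClosure k ⊗[k] Y)]
    {S : Set (Ideal (AlgebraicClosure k ⊗[k] X))} (hS : ∀ P ∈ S, HeightOnePrime P)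
    {T : Set (Ideal (AlgebraicClosure k ⊗[k] Y))} (hT : ∀ P ∈ T, HeightOnePrime P)
    {X' : Subalgebra k (FractionRing X)} [Algebra.FiniteType k X']
    (hX'E : ∀ x ∈ X', x ∈ algConstants (thetaS k hS))
    (hE : ∀ e ∈ algConstants (thetaS k hS), ∃ d ∈ X', d ≠ 0 ∧ e * d ∈ X')
    {S' : Set (Ideal (AlgebraicClosure k ⊗[k] X'))} (hS' : ∀ P ∈ S', HeightOnePrime P)
    {r : X} (hr : r ≠ 0) {π : X' →ₐ[k] Localization.Away r} (hπmor : IsVMor k S S' r π)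
    {ι : Localization.Away r →+* FractionRing X}
    (hι : ι.comp (algebraMap X (Localization.Away r)) = algebraMap X (FractionRing X))
    (hπ : ∀ x : X', ι (π x) = (x : FractionRing X))
    {r₁ : X} (hr₁ : r₁ ≠ 0) {φ : Y →ₐ[k] Localization.Away r₁} (hφ : IsVMor k S T r₁ φ)
    {ι₁ : Localization.Away r₁ →+* FractionRing X}
    (hι₁ : ι₁.comp (algebraMap X (Localization.Away r₁)) = algebraMap X (FractionRing X))
    {Φ : FractionRing Y →+* FractionRing X}
    (hΦ : Φ.comp (algebraMap Y (FractionRing Y)) = ι₁.comp φ.toRingHom) :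
    ∃ s : Y, s ≠ 0 ∧ ∃ ψ : X' →ₐ[k] Localization.Away s, IsVMor k T S' s ψ ∧
      ∀ ιY : Localization.Away s →+* FractionRing Y,
        ιY.comp (algebraMap Y (Localization.Away s)) = algebraMap Y (FractionRing Y) →
        ∀ x : X', Φ (ιY (ψ x)) = (x : FractionRing X) := by
  have : CharZero X := (RingHom.charZero_iff (algebraMap k X).injective).1 inferInstance
  have : CharZero (FractionRing X) :=
    (RingHom.charZero_iff (IsFractionRing.injective X (FractionRing X))).1 this
  have hFol := algFoliation_thetaS k hS
  have hle := hφ.algConstants_le hS hr₁ hι₁ hΦ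
  have hΦk : ∀ c : k, Φ (algebraMap k _ c) = algebraMap k _ c := fun c => by
    rw [IsScalarTower.algebraMap_apply k Y (FractionRing Y), ← RingHom.comp_apply, hΦ]
    exact (congrArg ι₁ (φ.commutes c)).trans (awayEmb_algebraMap hι₁ c)
  obtain ⟨j, hj⟩ := exists_algHom_lift ⟨Φ, hΦk⟩ (X' := X') fun x hx => hle (hX'E x hx)
  have hj : ∀ x : X', Φ (j x) = x := hj
  obtain ⟨s, hs, ψ, hψ⟩ := exists_lift_away j
  obtain ⟨ιY, hιY⟩ := exists_awayEmb hs
  have hψΦ : ∀ x : X', Φ (ιY (ψ x)) = x := fun x => by rw [hψ ιY hιY, hj]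
  have hψinj : Function.Injective ψ := fun x y hxy =>
    Subtype.ext ((hψΦ x).symm.trans ((congrArg (fun z => Φ (ιY z)) hxy).trans (hψΦ y)))
  have hψcl : FracRelAlgClosedVia (baseChange k ψ) := by
    refine fracRelAlgClosedVia_of_isAlgClosed hιY hψinj ((algConstants (thetaS k hS)).comap Φ)
      (fun x hx => hFol.mem_of_isAlgebraic (isAlgebraic_map_of_comap Φ hx))
      (fun c => ?_) ?_
    · rw [Subfield.mem_comap, hψΦ]
      exact hX'E _ c.2
    intro e he
    obtain ⟨d, hd, hd0, hed⟩ := hE _ he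
    refine ⟨⟨d, hd⟩, fun h => hd0 (congrArg Subtype.val h), ⟨_, hed⟩, Φ.injective ?_⟩
    rw [map_mul, hψΦ, hψΦ, mul_comm]
  refine ⟨s, hs, ψ, IsVMor.descend hT hS' hr hr₁ hπmor hφ hι hι₁ hΦ hs hψinj hψcl hιY
      fun x => (hψΦ x).trans (hπ x).symm, ?_⟩
  intro ιY' h x
  rw [awayEmb_unique h hιY, hψΦ]

end Factor

/-- **Theorem 7.2.** Every object `(X, S)` of `𝒱_k`, for `k` a finitely generated field of
characteristic zero, admits a terminal morphism `π : (X, S) → (X', S')`. -/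
theorem terminal_morphism_exists
    (k : Type) [Field k] [CharZero k]
    -- `k` is a finitely generated field
    (hk : (⊤ : IntermediateField ℚ k).FG)
    -- the object `(X, S)`:
    (X : Type) [CommRing X] [IsDomain X] [Algebra k X] [Algebra.FiniteType k X]
    [IsIntegrallyClosed X]
    (hgeoX : IsDomain (AlgebraicClosure k ⊗[k] X))
    (S : Set (Ideal (AlgebraicClosure k ⊗[k] X))) (hS : ∀ P ∈ S, HeightOnePrime P) :
    -- there is an object `(X', S')`, with `X'` realised inside `Frac(X)` ...
    ∃ X' : Subalgebra k (FractionRing X), X'.FG ∧ IsIntegrallyClosed X' ∧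
      IsDomain (AlgebraicClosure k ⊗[k] X') ∧
    ∃ S' : Set (Ideal (AlgebraicClosure k ⊗[k] X')), (∀ P ∈ S', HeightOnePrime P) ∧
    -- ... and a morphism `π : (X, S) → (X', S')` ...
    ∃ (r : X), r ≠ 0 ∧ ∃ π : X' →ₐ[k] Localization.Away r,
      IsVMor k S S' r π ∧
      -- ... which is dual to the inclusion `X' ⊆ Frac(X)`:
      (∀ ιX : Localization.Away r →+* FractionRing X,
        ιX.comp (algebraMap X (Localization.Away r)) = algebraMap X (FractionRing X) →
        ∀ x : X', ιX (π x) = (x : FractionRing X)) ∧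
      -- terminality: for every object `(Y, T)` and morphism `φ : (X, S) → (Y, T)` ...
      (∀ (Y : Type) [CommRing Y] [IsDomain Y] [Algebra k Y] [Algebra.FiniteType k Y]
          [IsIntegrallyClosed Y],
        IsDomain (AlgebraicClosure k ⊗[k] Y) →
        ∀ T : Set (Ideal (AlgebraicClosure k ⊗[k] Y)), (∀ P ∈ T, HeightOnePrime P) →
        ∀ (r₁ : X), r₁ ≠ 0 → ∀ φ : Y →ₐ[k] Localization.Away r₁, IsVMor k S T r₁ φ →
        -- ... there is a morphism `ψ : (Y, T) → (X', S')` ...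
        ∃ (s : Y), s ≠ 0 ∧ ∃ ψ : X' →ₐ[k] Localization.Away s,
          IsVMor k T S' s ψ ∧
          -- ... with `ψ ∘ φ = π` as rational maps (all checked in `Frac(X)`, via the
          -- canonical embeddings `ι` and the embedding `Φ : Frac(Y) → Frac(X)` induced
          -- by `φ`; recall `π` corresponds to the inclusion `X' ⊆ Frac(X)`):
          (∀ (ιX : Localization.Away r₁ →+* FractionRing X)
              (ιY : Localization.Away s →+* FractionRing Y)
              (Φ : FractionRing Y →+* FractionRing X),
            ιX.comp (algebraMap X (Localization.Away r₁)) = algebraMap X (FractionRing X) →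
            ιY.comp (algebraMap Y (Localization.Away s)) = algebraMap Y (FractionRing Y) →
            Φ.comp (algebraMap Y (FractionRing Y)) = ιX.comp φ.toRingHom →
            ∀ x : X', Φ (ιY (ψ x)) = (x : FractionRing X)) ∧
          -- ... and `ψ` is unique as a rational map `Y ⇢ X'`:
          (∀ (s₂ : Y), s₂ ≠ 0 → ∀ ψ₂ : X' →ₐ[k] Localization.Away s₂,
            IsVMor k T S' s₂ ψ₂ →
            (∀ (ιX : Localization.Away r₁ →+* FractionRing X)
                (ιY₂ : Localization.Away s₂ →+* FractionRing Y)
                (Φ : FractionRing Y →+* FractionRing X),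
              ιX.comp (algebraMap X (Localization.Away r₁)) = algebraMap X (FractionRing X) →
              ιY₂.comp (algebraMap Y (Localization.Away s₂)) = algebraMap Y (FractionRing Y) →
              Φ.comp (algebraMap Y (FractionRing Y)) = ιX.comp φ.toRingHom →
              ∀ x : X', Φ (ιY₂ (ψ₂ x)) = (x : FractionRing X)) →
            ∀ (ιY : Localization.Away s →+* FractionRing Y)
              (ιY₂ : Localization.Away s₂ →+* FractionRing Y),
              ιY.comp (algebraMap Y (Localization.Away s)) = algebraMap Y (FractionRing Y) →
              ιY₂.comp (algebraMap Y (Localization.Away s₂)) = algebraMap Y (FractionRing Y) →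
              ∀ x : X', ιY₂ (ψ₂ x) = ιY (ψ x))) := by
  have hcX : CharZero X := (RingHom.charZero_iff (algebraMap k X).injective).1 inferInstance
  have hcF : CharZero (FractionRing X) :=
    (RingHom.charZero_iff (IsFractionRing.injective X (FractionRing X))).1 hcX
  have hess : Algebra.EssFiniteType k (FractionRing X) :=
    have : Algebra.EssFiniteType X (FractionRing X) := .of_isLocalization _ (nonZeroDivisors X)
    .comp k X (FractionRing X)
  have hFol := algFoliation_thetaS k hS
  have hkE : ∀ c : k, algebraMap k (FractionRing X) c ∈ algConstants (thetaS k hS) := fun c =>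
    (mem_algConstants fun θ hθ => ((mem_thetaS k hS).1 hθ).1).2 fun θ hθ =>
      ((mem_thetaS k hS).1 (hFol.sub hθ)).2.1 c
  obtain ⟨X', hFG, hIC, hX'E, hE⟩ := exists_normal_model hkE fun x hx => hFol.mem_of_isAlgebraic hx
  have hFT : Algebra.FiniteType k X' := X'.fg_iff_finiteType.1 hFG
  obtain ⟨r, hr, π, hπ⟩ := exists_lift_away X'.val
  obtain ⟨ι, hι⟩ := exists_awayEmb hr
  have hπinj : Function.Injective π := fun x y hxy =>
    Subtype.ext ((hπ ι hι x).symm.trans ((congrArg ι hxy).trans (hπ ι hι y)))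
  have hdom' := isDomain_of_baseChange hr hπinj
  have hdomr := isDomain_tensor_away (k := k) hr
  have hnoeth := isNoetherianRing_tensor_away (k := k) r
  have hch := charZero_tensor k X'
  have hπcl : FracRelAlgClosedVia (baseChange k π) := by
    refine fracRelAlgClosedVia_of_isAlgClosed hι hπinj (algConstants (thetaS k hS))
      (fun x hx => hFol.mem_of_isAlgebraic hx) (fun c => (hπ ι hι c).symm ▸ hX'E _ c.2) ?_
    intro e he
    obtain ⟨d, hd, hd0, hed⟩ := hE e he
    refine ⟨⟨d, hd⟩, fun h => hd0 (congrArg Subtype.val h), ⟨_, hed⟩, ?_⟩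
    rw [hπ ι hι, hπ ι hι, mul_comm]
    rfl
  obtain ⟨S', hS', hfin⟩ := exists_heightOnePrime_set (baseChange_injective hπinj)
    (baseChange_finiteType π) hπcl
    (P := fun Q => Q.comap (baseChange k (IsScalarTower.toAlgHom k X (Localization.Away r))) ∈ S)
    (finite_comap_eq_bot hS hX'E hE hr hι (hπ ι hι))
  have hπmor : IsVMor k S S' r π := (isVMor_iff_finite hS' hr π).2 ⟨hπinj, hπcl, hfin⟩
  refine ⟨X', hFG, hIC, hdom', S', hS', r, hr, π, hπmor, hπ, ?_⟩
  intro Y _ _ _ _ _ hgeoY T hT r₁ hr₁ φ hφ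
  obtain ⟨ι₁, hι₁⟩ := exists_awayEmb hr₁
  obtain ⟨Φ, hΦ⟩ := exists_functionFieldEmb hφ.1 hι₁
  obtain ⟨s, hs, ψ, hψ, hcomp⟩ := IsVMor.exists_factorization hS hT hX'E hE hS' hr
    hπmor hι (hπ ι hι) hr₁ hφ hι₁ hΦ
  refine ⟨s, hs, ψ, hψ, ?_, ?_⟩
  · intro ιX ιY Φ' h1 h2 h3 x
    rw [functionFieldEmb_unique h1 hι₁ h3 hΦ, hcomp ιY h2]
  · intro s₂ hs₂ ψ₂ _ h₂ ιY ιY₂ h3 h4 x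
    apply Φ.injective
    rw [h₂ ι₁ ιY₂ Φ hι₁ h4 hΦ, hcomp ιY h3]
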